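/- Let p be a prime number and let F be a field extension of the p-adic field ℚ_p that is finitely generated as a field extension of ℚ_p and of transcendence degree one over ℚ_p. Let ℓ be a prime with ℓ ≠ p, and let a, b be natural numbers with 1 ≤ a ≤ b ≤ 2a − 1. Then there exists a finite-dimensional central division algebra D over F such that: (i) the class of D in the Brauer group Br(F) has order ℓ^a (D has period ℓ^a); (ii) dim_F D = ℓ^{2b} (D has index ℓ^b); and (iii) D is indecomposable, i.e. there do not exist central division algebras D₁ and D₂ over F, each of F-dimension strictly greater than 1, together with an F-algebra isomorphism D ≅ D₁ ⊗_F D₂. -/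

import Mathlib

open scoped TensorProduct

/-- A (finite-dimensional) central division algebra over a field `F`: a finite-dimensional
`F`-algebra that is a division ring whose center is exactly `F`. -/
structure CentralDivisionAlgebra (F : Type) [Field F] : Type 1 where
  carrier : Type
  [divisionRing : DivisionRing carrier]
  [algebra : Algebra F carrier]
  finiteDimensional : FiniteDimensional F carrier
  central : Subalgebra.center F carrier = ⊥

attribute [instance] CentralDivisionAlgebra.divisionRing CentralDivisionAlgebra.algebra

/-- An `F`-algebra is *split* if it is isomorphic to a matrix algebra over `F`. -/
def IsSplitAlgebra (F : Type) [Field F] (A : Type) [Ring A] [Algebra F A] : Prop :=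
  ∃ n : ℕ, 0 < n ∧ Nonempty (A ≃ₐ[F] Matrix (Fin n) (Fin n) F)

/-- The class of `A` in the Brauer group `Br(F)` has order exactly `m`:
the `m`-th tensor power of `A` over `F` is split, while no smaller positive tensor
power is split.  (The order of `[A]` in `Br(F)` is the least `m > 0` with `[A]^m = 1`,
and `[A]^k = [A^{⊗k}]`.) -/
def BrauerClassHasOrder (F : Type) [Field F] (A : Type) [Ring A] [Algebra F A]
    (m : ℕ) : Prop :=
  0 < m ∧ IsSplitAlgebra F (⨂[F] (_ : Fin m), A) ∧
    ∀ k : ℕ, 0 < k → k < m → ¬ IsSplitAlgebra F (⨂[F] (_ : Fin k), A)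

/-- A division algebra `D` central over `F` is *indecomposable* if it is not isomorphic,
as an `F`-algebra, to a tensor product `D₁ ⊗[F] D₂` of two central division algebras over
`F` each of `F`-dimension strictly greater than `1`. -/
def IsIndecomposableDivisionAlgebra (F : Type) [Field F] (D : Type) [DivisionRing D]
    [Algebra F D] : Prop :=
  ∀ (D₁ D₂ : Type) [DivisionRing D₁] [DivisionRing D₂] [Algebra F D₁] [Algebra F D₂],
    FiniteDimensional F D₁ → FiniteDimensional F D₂ →
    Subalgebra.center F D₁ = ⊥ → Subalgebra.center F D₂ = ⊥ →
    1 < Module.finrank F D₁ → 1 < Module.finrank F D₂ →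
    IsEmpty (D ≃ₐ[F] (D₁ ⊗[F] D₂))


/-- Cyclic extension data. -/
structure CycData (F L : Type) [Field F] [Field L] [Algebra F L] (σ : L ≃ₐ[F] L) (n : ℕ) :
    Prop where
  pos : 0 < n
  pow_eq : σ ^ n = 1
  pow_ne : ∀ i, 0 < i → i < n → σ ^ i ≠ 1
  fix : ∀ x : L, σ x = x → ∃ y : F, algebraMap F L y = x
  finrank : Module.finrank F L = n

theorem semilin_pow {F L U : Type} [Field F] [Field L] [Algebra F L] [AddCommGroup U]
    [Module F U] [Module L U] (σ : L ≃ₐ[F] L)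
    (S : Module.End F U) (hS : ∀ (l : L) (u : U), S (l • u) = σ l • S u) (i : ℕ)
    (l : L) (u : U) : (S ^ i) (l • u) = (σ ^ i) l • (S ^ i) u := by
  induction i with
  | zero => simp
  | succ k ih => rw [pow_succ', pow_succ', Module.End.mul_apply, ih, hS]; rfl

theorem galois_descent {F L U : Type} [Field F] [Field L] [Algebra F L] [AddCommGroup U]
    [Module F U] [Module L U] [IsScalarTower F L U] (σ : L ≃ₐ[F] L) (n : ℕ) (hn : 0 < n)
    (h1 : ∀ i, 0 < i → i < n → σ ^ i ≠ 1)
    (S : Module.End F U) (hS : ∀ (l : L) (u : U), S (l • u) = σ l • S u) (hSn : S ^ n = 1) :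
    ∃ (ι : Type) (b : Module.Basis ι L U), ∀ i, S (b i) = b i := by
  classical
  have hspan : Submodule.span L {u : U | S u = u} = ⊤ := by
    by_contra hne
    obtain ⟨f, hf0, hf⟩ := Submodule.exists_le_ker_of_lt_top _ (lt_top_iff_ne_top.2 hne)
    apply hf0
    ext u
    have hli : LinearIndependent L (fun i : Fin n => ((σ ^ (i : ℕ) : L ≃ₐ[F] L) : L → L)) := by
      have h := linearIndependent_monoidHom L L
      have h2 := h.comp (fun i : Fin n => ((σ ^ (i : ℕ) : L ≃ₐ[F] L) : L →* L)) ?_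
      · exact h2
      · intro i j hij
        have hij' : σ ^ (i : ℕ) = σ ^ (j : ℕ) := by
          ext x; exact DFunLike.congr_fun hij x
        by_contra hne
        rcases lt_or_gt_of_ne (fun h => hne (Fin.ext h)) with hlt | hlt
        · refine h1 (j - i) (by omega) (by omega) ?_
          have : σ ^ (i : ℕ) * σ ^ ((j : ℕ) - i) = σ ^ (i : ℕ) * 1 := by
            rw [← pow_add, Nat.add_sub_cancel' hlt.le, mul_one, hij']
          exact mul_left_cancel this
        · refine h1 (i - j) (by omega) (by omega) ?_
          have : σ ^ (j : ℕ) * σ ^ ((i : ℕ) - j) = σ ^ (j : ℕ) * 1 := by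
            rw [← pow_add, Nat.add_sub_cancel' hlt.le, mul_one, hij']
          exact mul_left_cancel this
    have key : ∑ i : Fin n, f ((S ^ (i : ℕ)) u) • ((σ ^ (i : ℕ) : L ≃ₐ[F] L) : L → L) = 0 := by
      ext l
      have hfix : S (∑ i ∈ Finset.range n, (S ^ i) (l • u)) =
          ∑ i ∈ Finset.range n, (S ^ i) (l • u) := by
        rw [map_sum]
        have : ∀ i, S ((S ^ i) (l • u)) = (S ^ (i + 1)) (l • u) := fun i => by
          rw [pow_succ']; rfl
        simp_rw [this]
        have h2 := Finset.sum_range_succ' (fun i => (S ^ i) (l • u)) n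
        rw [Finset.sum_range_succ, hSn, pow_zero] at h2
        exact (add_right_cancel h2).symm
      have := hf (Submodule.subset_span hfix)
      rw [LinearMap.mem_ker, map_sum, Finset.sum_range] at this
      simp only [semilin_pow σ S hS, map_smul, smul_eq_mul] at this
      simpa [mul_comm] using this
    have := Fintype.linearIndependent_iff.1 hli _ key ⟨0, hn⟩
    simpa using this
  refine ⟨_, Module.Basis.ofSpan hspan.ge, fun i => ?_⟩
  have := Module.Basis.ofSpan_subset hspan.ge ⟨i, rfl⟩
  exact this

/-- Consequences: the fixed space. -/
def fixedSub {F U : Type} [Field F] [AddCommGroup U] [Module F U] (S : Module.End F U) :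
    Submodule F U where
  carrier := {u | S u = u}
  add_mem' := by intro a b ha hb; simp_all
  zero_mem' := by simp
  smul_mem' := by intro a b hb; simp_all

theorem mem_fixedSub {F U : Type} [Field F] [AddCommGroup U] [Module F U] (S : Module.End F U)
    (u : U) : u ∈ fixedSub S ↔ S u = u := Iff.rfl

theorem fixed_iff_coord {F L U : Type} [Field F] [Field L] [Algebra F L] [AddCommGroup U]
    [Module F U] [Module L U] [IsScalarTower F L U] (σ : L ≃ₐ[F] L)
    (S : Module.End F U) (hS : ∀ (l : L) (u : U), S (l • u) = σ l • S u)
    {ι : Type} (b : Module.Basis ι L U) (hb : ∀ i, S (b i) = b i) (u : U) :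
    S u = u ↔ ∀ i, σ (b.repr u i) = b.repr u i := by
  classical
  have h : b.repr (S u) = (b.repr u).mapRange σ (map_zero σ) := by
    have : u = (b.repr u).sum fun i l => l • b i := by
      conv_lhs => rw [← b.linearCombination_repr u]
      rfl
    conv_lhs => rw [this]
    rw [Finsupp.sum, map_sum]
    simp only [hS, hb]
    rw [map_sum]
    ext j
    simp only [map_smul, Module.Basis.repr_self, Finsupp.smul_single, smul_eq_mul, mul_one,
      Finsupp.finsetSum_apply, Finsupp.single_apply, Finsupp.mapRange_apply]
    rw [Finset.sum_ite_eq']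
    split_ifs with hj
    · rfl
    · rw [Finsupp.notMem_support_iff.1 hj, map_zero]
  constructor
  · intro hu i
    conv_rhs => rw [← hu, h]
    simp
  · intro hu
    apply b.repr.injective
    rw [h]
    ext i; simp [hu]

theorem finrank_fixedSub {F L U : Type} [Field F] [Field L] [Algebra F L] [AddCommGroup U]
    [Module F U] [Module L U] [IsScalarTower F L U] (σ : L ≃ₐ[F] L) (n : ℕ) (hn : 0 < n)
    (h1 : ∀ i, 0 < i → i < n → σ ^ i ≠ 1) [FiniteDimensional L U] [FiniteDimensional F L]
    (S : Module.End F U) (hS : ∀ (l : L) (u : U), S (l • u) = σ l • S u) (hSn : S ^ n = 1)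
    (K : IntermediateField F L) (hK : ∀ x, x ∈ K ↔ σ x = x) :
    Module.finrank F (fixedSub S) = Module.finrank F K * Module.finrank L U := by
  classical
  obtain ⟨ι, b, hb⟩ := galois_descent σ n hn h1 S hS hSn
  haveI : Fintype ι := FiniteDimensional.fintypeBasisIndex b
  let e : fixedSub S ≃ₗ[F] (ι → K) :=
    { toFun := fun u i => ⟨b.repr u.1 i, (hK _).2 ((fixed_iff_coord σ S hS b hb u.1).1 u.2 i)⟩
      invFun := fun f => ⟨∑ i, (f i : L) • b i, by
        rw [mem_fixedSub, fixed_iff_coord σ S hS b hb]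
        intro i
        rw [b.repr_sum_self]
        exact (hK _).1 (f i).2⟩
      map_add' := fun u v => by ext i; simp
      map_smul' := fun r u => by
        ext i
        have : b.repr (r • (u : U)) i = r • b.repr (u : U) i := by
          rw [← algebraMap_smul L r (u : U), map_smul, Finsupp.smul_apply, algebraMap_smul]
        simpa using this
      left_inv := fun u => by
        apply Subtype.ext
        simp [b.sum_repr]
      right_inv := fun f => by
        ext i
        simp only
        rw [b.repr_sum_self] }
  rw [e.finrank_eq, Module.finrank_pi_fintype, Module.finrank_eq_card_basis b]
  simp [mul_comm]

theorem span_fixedSub {F L U : Type} [Field F] [Field L] [Algebra F L] [AddCommGroup U]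
    [Module F U] [Module L U] [IsScalarTower F L U] (σ : L ≃ₐ[F] L) (n : ℕ) (hn : 0 < n)
    (h1 : ∀ i, 0 < i → i < n → σ ^ i ≠ 1)
    (S : Module.End F U) (hS : ∀ (l : L) (u : U), S (l • u) = σ l • S u) (hSn : S ^ n = 1) :
    Submodule.span L (fixedSub S : Set U) = ⊤ := by
  obtain ⟨ι, b, hb⟩ := galois_descent σ n hn h1 S hS hSn
  rw [← top_le_iff, ← b.span_eq]
  apply Submodule.span_mono
  rintro _ ⟨i, rfl⟩
  exact hb i


section CycAlg

variable {F L : Type} [Field F] [Field L] [Algebra F L]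

/-- weights of the companion matrix -/
def cycW (L : Type) [Field L] [Algebra F L] (n : ℕ) [NeZero n] (c : F) (i : Fin n) : L :=
  if i + 1 = 0 then algebraMap F L c else 1

/-- companion matrix of `X ^ n - c` -/
def cycP (L : Type) [Field L] [Algebra F L] (n : ℕ) [NeZero n] (c : F) :
    Matrix (Fin n) (Fin n) L :=
  Matrix.of fun i j => if j = i + 1 then cycW L n c i else 0

theorem cycP_mul (n : ℕ) [NeZero n] (c : F) (Y : Matrix (Fin n) (Fin n) L) (i j : Fin n) :
    (cycP L n c * Y) i j = cycW L n c i * Y (i + 1) j := by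
  simp [Matrix.mul_apply, cycP]

theorem mul_cycP (n : ℕ) [NeZero n] (c : F) (Y : Matrix (Fin n) (Fin n) L) (i j : Fin n) :
    (Y * cycP L n c) i (j + 1) = Y i j * cycW L n c j := by
  simp [Matrix.mul_apply, cycP]

theorem cycP_map (σ : L ≃ₐ[F] L) (n : ℕ) [NeZero n] (c : F) :
    (cycP L n c).map σ = cycP L n c := by
  ext i j
  simp only [cycP, cycW, Matrix.map_apply, Matrix.of_apply]
  split_ifs <;> simp

theorem fin_add_one_eq_zero_iff (n : ℕ) [NeZero n] (i : Fin n) :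
    i + 1 = 0 ↔ (i : ℕ) + 1 = n := by
  rw [Fin.ext_iff, Fin.val_add]
  have hn : 0 < n := Nat.pos_of_ne_zero (NeZero.ne n)
  rcases Nat.lt_or_ge 1 n with h | h
  · have h1 : ((1 : Fin n) : ℕ) = 1 := by
      rw [Fin.val_one', Nat.mod_eq_of_lt h]
    rw [h1]
    have := i.2
    rcases Nat.lt_or_ge ((i : ℕ) + 1) n with h2 | h2
    · rw [Nat.mod_eq_of_lt h2]; simp; omega
    · have : (i : ℕ) + 1 = n := by omega
      simp [this]
  · have : n = 1 := by omega
    subst this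
    simp

theorem fin_val_add_one (n : ℕ) [NeZero n] (i : Fin n) (h : i + 1 ≠ 0) :
    ((i + 1 : Fin n) : ℕ) = i + 1 := by
  have h' : (i : ℕ) + 1 ≠ n := fun h2 => h ((fin_add_one_eq_zero_iff n i).2 h2)
  have := i.2
  have h1 : ((1 : Fin n) : ℕ) = 1 := by
    rw [Fin.val_one', Nat.mod_eq_of_lt (by omega)]
  rw [Fin.val_add, h1, Nat.mod_eq_of_lt (by omega)]

theorem cycP_pow_mul (n : ℕ) [NeZero n] (c : F) (k : ℕ) (Y : Matrix (Fin n) (Fin n) L)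
    (i j : Fin n) : (cycP L n c ^ k * Y) i j =
      (∏ t ∈ Finset.range k, cycW L n c (i + Fin.ofNat n t)) * Y (i + Fin.ofNat n k) j := by
  induction k generalizing Y with
  | zero => simp
  | succ k ih =>
    rw [pow_succ, Matrix.mul_assoc, ih, cycP_mul, Finset.prod_range_succ, mul_assoc]
    congr 3
    ext; simp [Fin.val_add, add_assoc]

theorem cycP_pow (n : ℕ) [NeZero n] (c : F) :
    cycP L n c ^ n = Matrix.scalar (Fin n) (algebraMap F L c) := by
  rw [← Matrix.mul_one (cycP L n c ^ n)]
  ext i j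
  rw [cycP_pow_mul]
  have h1 : i + Fin.ofNat n n = i := by
    ext; simp
  have h2 : ∏ t ∈ Finset.range n, cycW L n c (i + Fin.ofNat n t) = algebraMap F L c := by
    rw [Finset.prod_range]
    have : ∀ t : Fin n, Fin.ofNat n (t : ℕ) = t := by intro t; ext; simp [Nat.mod_eq_of_lt t.2]
    simp only [this]
    rw [Fintype.prod_equiv (Equiv.addLeft i) (fun t => cycW L n c (i + t)) (cycW L n c)
      (fun t => rfl)]
    have : ∀ j : Fin n, cycW L n c j = if j = -1 then algebraMap F L c else 1 := by
      intro j; simp only [cycW, eq_neg_iff_add_eq_zero]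
    simp [this]
  rw [h1, h2]
  simp [Matrix.one_apply, Matrix.diagonal_apply]

/-- the cyclic algebra as a subalgebra of matrices -/
def cycAlg (σ : L ≃ₐ[F] L) (n : ℕ) [NeZero n] (c : F) :
    Subalgebra F (Matrix (Fin n) (Fin n) L) where
  carrier := {X | X.map σ * cycP L n c = cycP L n c * X}
  mul_mem' := by
    intro X Y hX hY
    simp only [Set.mem_ofPred_eq] at *
    have : (X * Y).map σ = X.map σ * Y.map σ := Matrix.map_mul (f := (σ : L →+* L))
    rw [this, Matrix.mul_assoc, hY, ← Matrix.mul_assoc, hX, Matrix.mul_assoc]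
  add_mem' := by
    intro X Y hX hY
    simp only [Set.mem_ofPred_eq] at *
    rw [Matrix.map_add σ (map_add σ), Matrix.add_mul, hX, hY, Matrix.mul_add]
  algebraMap_mem' := by
    intro r
    simp only [Set.mem_ofPred_eq]
    ext i j
    simp [Matrix.mul_apply, Matrix.algebraMap_matrix_apply, apply_ite σ]
    ring

theorem mem_cycAlg (σ : L ≃ₐ[F] L) (n : ℕ) [NeZero n] (c : F) (X : Matrix (Fin n) (Fin n) L) :
    X ∈ cycAlg σ n c ↔ X.map σ * cycP L n c = cycP L n c * X := Iff.rfl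

theorem mem_cycAlg_iff (σ : L ≃ₐ[F] L) (n : ℕ) [NeZero n] (c : F)
    (X : Matrix (Fin n) (Fin n) L) :
    X ∈ cycAlg σ n c ↔ ∀ i j, cycW L n c i * X (i + 1) (j + 1) = σ (X i j) * cycW L n c j := by
  rw [mem_cycAlg]
  constructor
  · intro h i j
    have := congrFun (congrFun h i) (j + 1)
    rw [mul_cycP, cycP_mul] at this
    exact this.symm
  · intro h
    ext i j
    obtain ⟨j, rfl⟩ : ∃ j', j = j' + 1 := ⟨j - 1, by simp⟩
    rw [mul_cycP, cycP_mul]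
    exact (h i j).symm

/-- element with a given first row -/
def cycMat (σ : L ≃ₐ[F] L) (n : ℕ) [NeZero n] (c : F) (x : Fin n → L) :
    Matrix (Fin n) (Fin n) L :=
  Matrix.of fun i j => (σ ^ (i : ℕ)) (x (j - i)) * if j < i then algebraMap F L c else 1

theorem cycMat_mem (σ : L ≃ₐ[F] L) (n : ℕ) [NeZero n] (c : F) (hσ : σ ^ n = 1)
    (x : Fin n → L) : cycMat σ n c x ∈ cycAlg σ n c := by
  rw [mem_cycAlg_iff]
  intro i j
  have hs : ∀ k (y : L), σ ((σ ^ k) y) = (σ ^ (k + 1)) y := fun k y => by rw [pow_succ']; rfl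
  simp only [cycMat, Matrix.of_apply, cycW, add_sub_add_right_eq_sub, map_mul, hs]
  have hi := fin_add_one_eq_zero_iff n i
  have hj := fin_add_one_eq_zero_iff n j
  have hi2 := fin_val_add_one n i
  have hj2 := fin_val_add_one n j
  by_cases h1 : i + 1 = 0 <;> by_cases h2 : j + 1 = 0
  · have : i = j := by ext; rw [hi] at h1; rw [hj] at h2; omega
    subst this
    rw [if_pos h1, h1]
    have : (i : ℕ) + 1 = n := hi.1 h1
    rw [this, hσ]
    simp [mul_comm]
  · rw [if_pos h1, if_neg h2, h1]
    have hin : (i : ℕ) + 1 = n := hi.1 h1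
    have hji : j < i := by
      rw [Fin.lt_def]; have := hj.not.1 h2; have := j.2; omega
    rw [hin, hσ, if_pos hji]
    simp [mul_comm]
  · rw [if_neg h1, if_pos h2, h2]
    have hjn : (j : ℕ) + 1 = n := hj.1 h2
    have hji : ¬ (j < i) := by
      rw [Fin.lt_def]; have := i.2; omega
    have h0 : (0 : Fin n) < i + 1 := by
      rw [Fin.pos_iff_ne_zero]; exact h1
    rw [if_pos h0, if_neg hji, hi2 h1]
    simp
  · rw [if_neg h1, if_neg h2, hi2 h1]
    have : (j + 1 < i + 1) ↔ j < i := by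
      rw [Fin.lt_def, Fin.lt_def, hi2 h1, hj2 h2]; omega
    simp only [this]
    split_ifs <;> simp

theorem cycMat_zero_row (σ : L ≃ₐ[F] L) (n : ℕ) [NeZero n] (c : F)
    (x : Fin n → L) (j : Fin n) : cycMat σ n c x 0 j = x j := by
  simp [cycMat]

theorem cycAlg_eq_of_row (σ : L ≃ₐ[F] L) (n : ℕ) [NeZero n] (c : F)
    {X Y : Matrix (Fin n) (Fin n) L} (hX : X ∈ cycAlg σ n c) (hY : Y ∈ cycAlg σ n c)
    (h : ∀ j, X 0 j = Y 0 j) : X = Y := by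
  rw [mem_cycAlg_iff] at hX hY
  have key : ∀ k (hk : k < n), ∀ j, X ⟨k, hk⟩ j = Y ⟨k, hk⟩ j := by
    intro k
    induction k with
    | zero => intro hk j; exact h j
    | succ k ih =>
      intro hk j
      have hk' : k < n := by omega
      obtain ⟨j, rfl⟩ : ∃ j', j = j' + 1 := ⟨j - 1, by simp⟩
      have h1 : (⟨k, hk'⟩ : Fin n) + 1 ≠ 0 := by
        rw [Ne, fin_add_one_eq_zero_iff]; simp; omega
      have h2 : (⟨k, hk'⟩ : Fin n) + 1 = ⟨k + 1, hk⟩ := by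
        ext; rw [fin_val_add_one _ _ h1]
      have hx := hX ⟨k, hk'⟩ j
      have hy := hY ⟨k, hk'⟩ j
      rw [ih] at hx
      rw [← hy, h2, cycW, if_neg h1] at hx
      simpa using hx
  ext i j
  exact key i i.2 j

theorem cycAlg_apply (σ : L ≃ₐ[F] L) (n : ℕ) [NeZero n] (c : F) (hσ : σ ^ n = 1)
    {X : Matrix (Fin n) (Fin n) L} (hX : X ∈ cycAlg σ n c) (i j : Fin n) :
    X i j = (σ ^ (i : ℕ)) (X 0 (j - i)) * if j < i then algebraMap F L c else 1 := by
  have : X = cycMat σ n c (X 0) :=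
    cycAlg_eq_of_row σ n c hX (cycMat_mem σ n c hσ _) (fun j => (cycMat_zero_row σ n c _ j).symm)
  conv_lhs => rw [this]
  rfl

/-- linear equivalence with rows -/
def cycEquiv (σ : L ≃ₐ[F] L) (n : ℕ) [NeZero n] (c : F) (hσ : σ ^ n = 1) :
    cycAlg σ n c ≃ₗ[F] (Fin n → L) where
  toFun X := X.1 0
  invFun x := ⟨cycMat σ n c x, cycMat_mem σ n c hσ x⟩
  map_add' X Y := rfl
  map_smul' r X := rfl
  left_inv X := Subtype.ext (cycAlg_eq_of_row σ n c (cycMat_mem σ n c hσ _) X.2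
    (fun j => cycMat_zero_row σ n c _ j))
  right_inv x := funext fun j => cycMat_zero_row σ n c _ j

theorem cycAlg_finrank (σ : L ≃ₐ[F] L) (n : ℕ) [NeZero n] (c : F) (h : CycData F L σ n) :
    Module.finrank F (cycAlg σ n c) = n ^ 2 := by
  haveI : FiniteDimensional F L := FiniteDimensional.of_finrank_pos (by rw [h.finrank]; exact h.pos)
  rw [(cycEquiv σ n c h.pow_eq).finrank_eq, Module.finrank_pi_fintype]
  simp [h.finrank, sq]

theorem cycAlg_finiteDimensional (σ : L ≃ₐ[F] L) (n : ℕ) [NeZero n] (c : F)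
    (h : CycData F L σ n) : FiniteDimensional F (cycAlg σ n c) := by
  apply FiniteDimensional.of_finrank_pos
  rw [cycAlg_finrank σ n c h]
  exact pow_pos h.pos 2

theorem cycAlg_center (σ : L ≃ₐ[F] L) (n : ℕ) [NeZero n] (c : F) (hc : c ≠ 0)
    (h : CycData F L σ n) : Subalgebra.center F (cycAlg σ n c) = ⊥ := by
  rw [eq_bot_iff]
  rintro ⟨X, hX⟩ hcen
  rw [Subalgebra.mem_center_iff] at hcen
  -- off-diagonal entries of the first row vanish
  have hcomm : ∀ Y ∈ cycAlg σ n c, Y * X = X * Y := fun Y hY =>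
    congrArg Subtype.val (hcen ⟨Y, hY⟩)
  have hrow : ∀ j : Fin n, j ≠ 0 → X 0 j = 0 := by
    intro j hj
    by_contra hne
    have hj' : (j : ℕ) ≠ 0 := fun h0 => hj (Fin.ext h0)
    apply h.pow_ne j (Nat.pos_of_ne_zero hj') j.2
    ext y
    have := congrFun (congrFun (hcomm _ (cycMat_mem σ n c h.pow_eq (Pi.single 0 y))) 0) j
    rw [Matrix.mul_apply, Matrix.mul_apply, Finset.sum_eq_single 0, Finset.sum_eq_single j] at this
    · rw [cycMat_zero_row, Pi.single_eq_same] at this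
      simp only [cycMat, Matrix.of_apply, sub_self, Pi.single_eq_same, lt_irrefl, if_false,
        mul_one] at this
      rw [mul_comm] at this
      exact (mul_left_cancel₀ hne this).symm
    · intro i _ hi
      simp [cycMat, Pi.single_apply, sub_eq_zero, hi.symm]
    · simp
    · intro i _ hi
      rw [cycMat_zero_row, Pi.single_eq_of_ne hi, zero_mul]
    · simp
  have hP : cycP L n c ∈ cycAlg σ n c := by rw [mem_cycAlg, cycP_map]
  have hfix : σ (X 0 0) = X 0 0 := by
    have hh := hcomm _ hP
    have h1 := (mem_cycAlg σ n c X).1 hX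
    rw [hh] at h1
    have h2 := congrFun (congrFun h1 0) (0 + 1)
    rw [mul_cycP, mul_cycP] at h2
    have hw : cycW L n c 0 ≠ 0 := by
      rw [cycW]; split_ifs
      · simpa using hc
      · exact one_ne_zero
    exact mul_right_cancel₀ hw h2
  obtain ⟨r, hr⟩ := h.fix _ hfix
  refine ⟨r, ?_⟩
  apply Subtype.ext
  refine cycAlg_eq_of_row σ n c (SetLike.coe_mem _) hX ?_
  intro j
  change (algebraMap F (Matrix (Fin n) (Fin n) L) r) 0 j = X 0 j
  rw [Matrix.algebraMap_matrix_apply]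
  split_ifs with h0
  · rw [← h0, hr]
  · exact (hrow j (Ne.symm h0)).symm

end CycAlg


section CycAlg2

variable {F L : Type} [Field F] [Field L] [Algebra F L]

theorem cycAlg_domain {Γ₁ Γ₂ : Type} [LinearOrderedCommGroupWithZero Γ₁]
    [LinearOrderedCommGroupWithZero Γ₂] (σ : L ≃ₐ[F] L) (n m : ℕ) [NeZero n] (c : F) (hc : c ≠ 0)
    (hσ : σ ^ n = 1) (v : Valuation L Γ₁) (ν : Valuation L Γ₂)
    (hcoarse : ∀ x y, v x < v y → ν x < ν y) (hvσ : ∀ x, v (σ x) = v x)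
    (hνσ : ∀ x, ν ((σ ^ m) x) = ν x)
    (hv : ∀ (g : L) (i : ℕ), v (g ^ n) = v (algebraMap F L c ^ i) → m ∣ i)
    (hν : ∀ (g : L) (i : ℕ), ν (g ^ n) = ν (algebraMap F L c ^ i) → n ∣ i)
    (X Y : cycAlg σ n c) (hXY : X * Y = 0) : X = 0 ∨ Y = 0 := by
  by_contra hcon
  push Not at hcon
  obtain ⟨hX, hY⟩ := hcon
  have hn : 0 < n := Nat.pos_of_ne_zero (NeZero.ne n)
  set C : L := algebraMap F L c with hC
  have hC0 : C ≠ 0 := by simpa [hC] using hc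
  set x : Fin n → L := X.1 0 with hx
  set y : Fin n → L := Y.1 0 with hy
  have hx0 : ∃ j, x j ≠ 0 := by
    by_contra h
    push Not at h
    exact hX (Subtype.ext (cycAlg_eq_of_row σ n c X.2 (Subalgebra.zero_mem _) h))
  have hy0 : ∃ j, y j ≠ 0 := by
    by_contra h
    push Not at h
    exact hY (Subtype.ext (cycAlg_eq_of_row σ n c Y.2 (Subalgebra.zero_mem _) h))
  have hle : ∀ a b, ν a ≤ ν b → v a ≤ v b := fun a b hab =>
    not_lt.1 fun h => absurd (hcoarse _ _ h) (not_lt.2 hab)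
  have hvσk : ∀ k a, v ((σ ^ k) a) = v a := by
    intro k
    induction k with
    | zero => intro a; rfl
    | succ k ih => intro a; rw [pow_succ']; exact (hvσ _).trans (ih a)
  have hνmk : ∀ k a, ν ((σ ^ (m * k)) a) = ν a := by
    intro k
    induction k with
    | zero => intro a; rfl
    | succ k ih =>
      intro a
      rw [Nat.mul_succ, Nat.add_comm, pow_add]
      exact (hνσ _).trans (ih a)
  let A : Fin n → L := fun j => x j ^ n * C ^ (j : ℕ)
  let B : ℕ → Fin n → L := fun k j => (σ ^ k) (y j) ^ n * C ^ (j : ℕ)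
  haveI : Nonempty (Fin n) := ⟨⟨0, hn⟩⟩
  obtain ⟨i0, hi0⟩ := Finite.exists_max (fun j => ν (A j))
  obtain ⟨j0, hj0⟩ := Finite.exists_max (fun j => ν (B i0 j))
  have hA0 : A i0 ≠ 0 := by
    obtain ⟨j, hj⟩ := hx0
    intro h
    have := hi0 j
    simp only [h, map_zero, le_zero_iff, map_eq_zero] at this
    exact mul_ne_zero (pow_ne_zero _ hj) (pow_ne_zero _ hC0) this
  have hB0 : B i0 j0 ≠ 0 := by
    obtain ⟨j, hj⟩ := hy0
    intro h
    have := hj0 j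
    simp only [h, map_zero, le_zero_iff, map_eq_zero] at this
    refine mul_ne_zero (pow_ne_zero _ ?_) (pow_ne_zero _ hC0) this
    exact (map_ne_zero_iff _ (σ ^ (i0 : ℕ)).injective).2 hj
  have hvB : ∀ k j, v (B k j) = v (y j ^ n * C ^ (j : ℕ)) := by
    intro k j
    simp only [B, map_mul, map_pow, hvσk]
  -- distinctness
  have hdist : ∀ (i j : Fin n), i ≠ j → A i ≠ 0 → A j ≠ 0 → ν (A i) ≠ ν (A j) := by
    have main : ∀ (i j : Fin n), i < j → A i ≠ 0 → A j ≠ 0 → ν (A i) ≠ ν (A j) := by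
      intro i j hij hi hj heq
      have hxj : x j ≠ 0 := fun h => hj (by simp [A, h, hn.ne'])
      have h1 := hν (x i / x j) (j - i) (by
        have hsub : (j : ℕ) = i + ((j : ℕ) - i) := by rw [Fin.lt_def] at hij; omega
        simp only [A] at heq
        rw [hsub, pow_add, map_mul, map_mul, map_mul, ← mul_assoc, mul_right_comm] at heq
        have hCi : ν (C ^ (i : ℕ)) ≠ 0 := by simpa using fun h => absurd h hC0
        have := mul_right_cancel₀ hCi heq
        have hxjn : ν (x j ^ n) ≠ 0 := by
          rw [Ne, map_eq_zero]; exact pow_ne_zero _ hxj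
        rw [div_pow, map_div₀, div_eq_iff hxjn, this, mul_comm])
      have := Nat.le_of_dvd (by rw [Fin.lt_def] at hij; omega) h1
      have := j.2
      omega
    intro i j hij hi hj
    rcases lt_or_gt_of_ne hij with h | h
    · exact main i j h hi hj
    · exact (main j i h hj hi).symm
  have hvdist : ∀ (i j : Fin n), A i ≠ 0 → A j ≠ 0 → v (A i) = v (A j) →
      (i : ℕ) ≤ j → m ∣ (j : ℕ) - i := by
    intro i j hi hj heq hij
    have hxj : x j ≠ 0 := fun h => hj (by simp [A, h, hn.ne'])
    refine hv (x i / x j) (j - i) ?_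
    have hsub : (j : ℕ) = i + ((j : ℕ) - i) := by omega
    simp only [A] at heq
    rw [hsub, pow_add, map_mul, map_mul, map_mul, ← mul_assoc, mul_right_comm] at heq
    have hCi : v (C ^ (i : ℕ)) ≠ 0 := by simpa using fun h => absurd h hC0
    have := mul_right_cancel₀ hCi heq
    have hxjn : v (x j ^ n) ≠ 0 := by
      rw [Ne, map_eq_zero]; exact pow_ne_zero _ hxj
    rw [div_pow, map_div₀, div_eq_iff hxjn, this, mul_comm]
  set s : Fin n := i0 + j0 with hs
  let t : Fin n → L := fun j => x j * Y.1 j s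
  have ht : ∀ j, t j ^ n * C ^ (s : ℕ) = A j * B j (s - j) := by
    intro j
    simp only [t, A, B]
    rw [cycAlg_apply σ n c hσ Y.2]
    have hval : (if s < j then C else 1) ^ n * C ^ (s : ℕ) = C ^ (j : ℕ) * C ^ ((s - j : Fin n) : ℕ) := by
      split_ifs with h
      · rw [← pow_add, ← pow_add]
        congr 1
        rw [Fin.lt_def] at h
        rw [Fin.sub_def]
        simp only
        rw [Nat.mod_eq_of_lt (by have := j.2; omega)]
        have := j.2
        omega
      · rw [one_pow, one_mul, ← pow_add]
        congr 1
        rw [not_lt] at h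
        rw [Fin.sub_val_of_le h]
        rw [Fin.le_def] at h
        omega
    calc _ = x j ^ n * (σ ^ (j : ℕ)) (y (s - j)) ^ n * ((if s < j then C else 1) ^ n * C ^ (s : ℕ)) := by
          ring
      _ = _ := by rw [hval]; ring
  have hsi : s - i0 = j0 := by rw [hs]; simp
  have hdom : ∀ j, j ≠ i0 → ν (t j) < ν (t i0) := by
    intro j hj
    have hti : t i0 ^ n * C ^ (s : ℕ) ≠ 0 := by
      rw [ht, hsi]; exact mul_ne_zero hA0 hB0
    have hti0 : t i0 ≠ 0 := fun h => hti (by rw [h, zero_pow hn.ne', zero_mul])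
    by_cases htj : t j = 0
    · rw [htj, map_zero]
      exact (Valuation.pos_iff _).2 hti0
    have hAB : A j * B j (s - j) ≠ 0 := by
      rw [← ht]; exact mul_ne_zero (pow_ne_zero _ htj) (pow_ne_zero _ hC0)
    have hAj : A j ≠ 0 := left_ne_zero_of_mul hAB
    have hBj : B j (s - j) ≠ 0 := right_ne_zero_of_mul hAB
    have key : ν (A j * B j (s - j)) < ν (A i0 * B i0 j0) := by
      rcases (hle _ _ (hi0 j)).lt_or_eq with hlt | heq
      · apply hcoarse
        rw [map_mul v (A j), map_mul v (A i0)]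
        have h1 : v (B j (s - j)) ≤ v (B i0 j0) := by
          rw [hvB, ← hvB i0]
          exact hle _ _ (hj0 _)
        have h2 : 0 < v (B i0 j0) := (Valuation.pos_iff _).2 hB0
        calc _ ≤ v (A j) * v (B i0 j0) := mul_le_mul_right h1 _
          _ < _ := mul_lt_mul_of_pos_right hlt h2
      · rw [map_mul ν (A j), map_mul ν (A i0)]
        have hAlt : ν (A j) < ν (A i0) := lt_of_le_of_ne (hi0 j) (hdist _ _ hj hAj hA0)
        have hBeq : ν (B j (s - j)) = ν (B i0 (s - j)) := by
          rcases le_total (j : ℕ) i0 with h | h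
          · obtain ⟨k, hk⟩ := hvdist j i0 hAj hA0 heq h
            have : (i0 : ℕ) = m * k + j := by omega
            simp only [B, map_mul, map_pow]
            rw [this, pow_add]
            congr 2
            exact (hνmk k _).symm
          · obtain ⟨k, hk⟩ := hvdist i0 j hA0 hAj heq.symm h
            have : (j : ℕ) = m * k + i0 := by omega
            simp only [B, map_mul, map_pow]
            rw [this, pow_add]
            congr 2
            exact (hνmk k _)
        have h2 : 0 < ν (B i0 j0) := (Valuation.pos_iff _).2 hB0
        rw [hBeq]
        calc _ ≤ ν (A j) * ν (B i0 j0) := mul_le_mul_right (hj0 _) _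
          _ < _ := mul_lt_mul_of_pos_right hAlt h2
    have h3 : ν (t j ^ n * C ^ (s : ℕ)) < ν (t i0 ^ n * C ^ (s : ℕ)) := by
      rw [ht, ht, hsi]; exact key
    rw [map_mul, map_mul, map_pow ν (t j), map_pow ν (t i0)] at h3
    exact lt_of_pow_lt_pow_left₀ n zero_le' (lt_of_mul_lt_mul_right h3 zero_le')
  have hsum : ∑ j, t j = 0 := by
    have := congrFun (congrFun (congrArg Subtype.val hXY) 0) s
    exact this
  rw [← Finset.add_sum_erase _ _ (Finset.mem_univ i0)] at hsum
  have hti : t i0 ≠ 0 := by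
    intro h
    have h1 := ht i0
    rw [h, zero_pow hn.ne', zero_mul, hsi] at h1
    exact mul_ne_zero hA0 hB0 h1.symm
  have hlt : ν (∑ j ∈ Finset.univ.erase i0, t j) < ν (t i0) :=
    Valuation.map_sum_lt _ (by rw [Ne, map_eq_zero]; exact hti)
      (fun j hj => hdom j (Finset.ne_of_mem_erase hj))
  have h4 := Valuation.map_add_eq_of_lt_left ν hlt
  rw [hsum, map_zero] at h4
  exact hti ((map_eq_zero ν).1 h4.symm)

theorem cycAlg_span (σ : L ≃ₐ[F] L) (n : ℕ) [NeZero n] (c : F) (hc : c ≠ 0)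
    (h : CycData F L σ n) :
    Submodule.span L (cycAlg σ n c : Set (Matrix (Fin n) (Fin n) L)) = ⊤ := by
  set P := cycP L n c with hP
  have hC0 : algebraMap F L c ≠ 0 := by simpa using hc
  have hPn : P ^ n = Matrix.scalar (Fin n) (algebraMap F L c) := cycP_pow n c
  let Q : Matrix (Fin n) (Fin n) L := (algebraMap F L c)⁻¹ • P ^ (n - 1)
  have hPQ : P * Q = 1 := by
    simp only [Q, Matrix.mul_smul]
    rw [← pow_succ', Nat.sub_add_cancel h.pos, hPn]
    ext i j; simp [Matrix.diagonal_apply, Matrix.one_apply, hC0]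
  have hQP : Q * P = 1 := mul_eq_one_comm.1 hPQ
  let f : L →+* L := (σ : L →+* L)
  let S : Module.End F (Matrix (Fin n) (Fin n) L) :=
    { toFun := fun X => Q * X.map σ * P
      map_add' := fun X Y => by
        rw [Matrix.map_add σ (map_add σ), Matrix.mul_add, Matrix.add_mul]
      map_smul' := fun r X => by
        rw [Matrix.map_smul σ r (fun a => map_smul σ r a)]
        simp }
  have hSX : ∀ X, S X = Q * X.map σ * P := fun X => rfl
  have hPmap : P.map σ = P := cycP_map σ n c
  have hQmap : Q.map σ = Q := by
    have h1 : (P * Q).map σ = P * Q.map σ := by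
      have : (P * Q).map σ = P.map σ * Q.map σ := Matrix.map_mul (f := (σ : L →+* L))
      rw [this, hPmap]
    rw [hPQ] at h1
    have h2 : (1 : Matrix (Fin n) (Fin n) L).map σ = 1 :=
      Matrix.map_one σ (map_zero σ) (map_one σ)
    rw [h2] at h1
    calc Q.map σ = (Q * P) * Q.map σ := by rw [hQP, one_mul]
      _ = Q := by rw [Matrix.mul_assoc, ← h1, Matrix.mul_one]
  have hSk : ∀ k X, (S ^ k) X = Q ^ k * X.map (σ ^ k : L ≃ₐ[F] L) * P ^ k := by
    intro k
    induction k with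
    | zero => intro X; ext; simp
    | succ k ih =>
      intro X
      have hpm : ∀ (k : ℕ) (M : Matrix (Fin n) (Fin n) L), (M ^ k).map σ = (M.map σ) ^ k := by
        intro k M
        exact map_pow ((σ : L →+* L).mapMatrix) M k
      have hmm : ∀ (M N : Matrix (Fin n) (Fin n) L), (M * N).map σ = M.map σ * N.map σ :=
        fun M N => Matrix.map_mul (f := (σ : L →+* L))
      rw [pow_succ', Module.End.mul_apply, ih, hSX, hmm, hmm, hpm, hpm, hPmap, hQmap]
      rw [pow_succ' Q, pow_succ P, pow_succ' σ]
      simp only [Matrix.mul_assoc]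
      rfl
  have hSn : S ^ n = 1 := by
    ext1 X
    rw [hSk, h.pow_eq, hPn]
    have hX : X.map ((1 : L ≃ₐ[F] L)) = X := by ext; rfl
    rw [hX, Matrix.mul_assoc, ← (Matrix.scalar_commute _ (fun r => Commute.all _ _) X).eq, ← hPn,
      ← Matrix.mul_assoc, ← (show Commute Q P from by rw [Commute, SemiconjBy, hPQ, hQP]).mul_pow,
      hQP, one_pow, one_mul]
    rfl
  have hspan := span_fixedSub σ n h.pos h.pow_ne S (by
    intro l X
    simp only [hSX]
    have : (l • X).map σ = σ l • X.map σ := by ext; simp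
    rw [this]; simp) hSn
  rw [← hspan]
  congr 1
  ext X
  simp only [SetLike.mem_coe, mem_fixedSub, mem_cycAlg, hSX]
  constructor
  · intro hh; rw [Matrix.mul_assoc, hh, ← Matrix.mul_assoc, hQP, Matrix.one_mul]
  · intro hh
    conv_rhs => rw [← hh]
    rw [← hP, Matrix.mul_assoc, ← Matrix.mul_assoc, hPQ, Matrix.one_mul]

/-- A `σ`-semilinear operator with `T ^ n = c` gives a module over the cyclic algebra. -/
def cycAct {U : Type} [AddCommGroup U] [Module F U] [Module L U] [IsScalarTower F L U]
    (σ : L ≃ₐ[F] L) (n : ℕ) [NeZero n] (c : F) (T : Module.End F U)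
    (hT : ∀ (l : L) (u : U), T (l • u) = σ l • T u) (hTn : T ^ n = algebraMap F _ c) :
    cycAlg σ n c →ₐ[F] Module.End F U := by
  let lam : L →ₐ[F] Module.End F U := Algebra.lsmul F F U
  have hlam : ∀ l, T * lam l = lam (σ l) * T := fun l => LinearMap.ext fun u => hT l u
  let row : Matrix (Fin n) (Fin n) L → Fin n → Module.End F U :=
    fun Y j => ∑ s, lam (Y j s) * T ^ (s : ℕ)
  have hrow : ∀ Y ∈ cycAlg σ n c, ∀ j, row Y j = T ^ (j : ℕ) * row Y 0 := by
    intro Y hY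
    have hY' := (mem_cycAlg_iff σ n c Y).1 hY
    have key : ∀ k (hk : k < n), row Y ⟨k, hk⟩ = T ^ k * row Y 0 := by
      intro k
      induction k with
      | zero => intro hk; rw [pow_zero, one_mul]; rfl
      | succ k ih =>
        intro hk
        have hk' : k < n := by omega
        have h1 : (⟨k, hk'⟩ : Fin n) + 1 ≠ 0 := by
          rw [Ne, fin_add_one_eq_zero_iff]; simp; omega
        have h2 : (⟨k, hk'⟩ : Fin n) + 1 = ⟨k + 1, hk⟩ := by
          ext; rw [fin_val_add_one _ _ h1]
        rw [pow_succ', mul_assoc, ← ih hk']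
        simp only [row]
        rw [← Equiv.sum_comp (Equiv.addRight (1 : Fin n)), Finset.mul_sum]
        refine Finset.sum_congr rfl fun s _ => ?_
        have hs := hY' ⟨k, hk'⟩ s
        rw [cycW, if_neg h1, one_mul, h2] at hs
        rw [Equiv.coe_addRight]
        beta_reduce
        rw [hs, map_mul, ← mul_assoc, hlam, mul_assoc, mul_assoc]
        congr 1
        rw [cycW]
        by_cases h0 : s + 1 = 0
        · have := (fin_add_one_eq_zero_iff n s).1 h0
          rw [if_pos h0, h0, ← pow_succ', this, hTn, AlgHom.commutes]
          simp
        · rw [if_neg h0, fin_val_add_one _ _ h0, map_one, one_mul, pow_succ']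
    intro j
    exact key j j.2
  refine AlgHom.ofLinearMap
    { toFun := fun X => row X.1 0
      map_add' := fun X Y => by
        simp only [row, ← Finset.sum_add_distrib, ← add_mul, ← map_add]
        rfl
      map_smul' := fun r X => by
        simp only [row, Finset.smul_sum, RingHom.id_apply, ← smul_mul_assoc, ← map_smul]
        rfl } ?_ ?_
  · change row 1 0 = 1
    simp only [row]
    rw [Finset.sum_eq_single 0]
    · simp
    · intro s _ hs
      rw [Matrix.one_apply_ne hs.symm, map_zero, zero_mul]
    · simp
  · intro X Y
    change row (X.1 * Y.1) 0 = row X.1 0 * row Y.1 0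
    have : row (X.1 * Y.1) 0 = ∑ j, lam (X.1 0 j) * row Y.1 j := by
      simp only [row, Matrix.mul_apply, map_sum, Finset.sum_mul, Finset.mul_sum, map_mul]
      rw [Finset.sum_comm]
      simp only [mul_assoc]
    rw [this, Finset.sum_congr rfl fun j _ => by rw [hrow Y.1 Y.2 j]]
    change _ = (∑ s, lam (X.1 0 s) * T ^ (s : ℕ)) * row Y.1 0
    rw [Finset.sum_mul]
    simp only [mul_assoc]

/-- modules over a division cyclic algebra have dimension divisible by `n ^ 2`. -/
theorem cyc_dvd {U : Type} [AddCommGroup U] [Module F U] [Module L U] [IsScalarTower F L U]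
    (σ : L ≃ₐ[F] L) (n : ℕ) [NeZero n] (c : F) (h : CycData F L σ n)
    (hdom : ∀ X Y : cycAlg σ n c, X * Y = 0 → X = 0 ∨ Y = 0)
    (T : Module.End F U)
    (hT : ∀ (l : L) (u : U), T (l • u) = σ l • T u) (hTn : T ^ n = algebraMap F _ c) :
    n ^ 2 ∣ Module.finrank F U := by
  haveI := cycAlg_finiteDimensional σ n c h
  haveI : NoZeroDivisors (cycAlg σ n c) := ⟨fun {a b} => hdom a b⟩
  haveI : IsDomain (cycAlg σ n c) := NoZeroDivisors.to_isDomain _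
  letI : DivisionRing (cycAlg σ n c) := divisionRingOfFiniteDimensional F _
  letI : Module (cycAlg σ n c) U := Module.compHom U (cycAct σ n c T hT hTn).toRingHom
  haveI : IsScalarTower F (cycAlg σ n c) U := ⟨fun r X u => by
    change (cycAct σ n c T hT hTn (r • X)) u = r • (cycAct σ n c T hT hTn X u)
    rw [map_smul]; rfl⟩
  rw [← cycAlg_finrank σ n c h]
  exact ⟨_, (Module.finrank_mul_finrank F (cycAlg σ n c) U).symm⟩

end CycAlg2


open scoped TensorProduct

section Kron

/-- Kronecker product of a family of matrices, as a multilinear map. -/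
noncomputable def kron (K ι : Type) [Field K] (k : ℕ) :
    MultilinearMap K (fun _ : Fin k => Matrix ι ι K) (Matrix (Fin k → ι) (Fin k → ι) K) :=
  MultilinearMap.pi fun r => MultilinearMap.pi fun s =>
    (MultilinearMap.mkPiAlgebra K (Fin k) K).compLinearMap
      (fun i => Matrix.entryLinearMap K K (r i) (s i))

variable {K ι : Type} [Field K] {k : ℕ}

theorem kron_apply (M : Fin k → Matrix ι ι K) (r s : Fin k → ι) :
    kron K ι k M r s = ∏ i, M i (r i) (s i) := by
  change (MultilinearMap.mkPiAlgebra K (Fin k) K) _ = _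
  rw [MultilinearMap.mkPiAlgebra_apply]
  rfl

theorem kron_mul [Fintype ι] (M N : Fin k → Matrix ι ι K) :
    kron K ι k (fun i => M i * N i) = kron K ι k M * kron K ι k N := by
  classical
  ext r s
  rw [kron_apply, Matrix.mul_apply]
  simp only [Matrix.mul_apply, kron_apply]
  rw [Finset.prod_univ_sum, Fintype.piFinset_univ]
  simp only [Finset.prod_mul_distrib]

theorem kron_scalar [Fintype ι] [DecidableEq ι] (x : K) :
    kron K ι k (fun _ => Matrix.scalar ι x) = Matrix.scalar (Fin k → ι) (x ^ k) := by
  ext r s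
  rw [kron_apply]
  by_cases h : r = s
  · subst h; simp
  · obtain ⟨i, hi⟩ := Function.ne_iff.1 h
    rw [Finset.prod_eq_zero (Finset.mem_univ i)]
    · simp [Matrix.diagonal_apply, h]
    · simp [Matrix.diagonal_apply, hi]

theorem kron_one [Fintype ι] [DecidableEq ι] :
    kron K ι k (fun _ => 1) = 1 := by
  have := kron_scalar (K := K) (ι := ι) (k := k) 1
  simpa using this

theorem kron_pow [Fintype ι] [DecidableEq ι] (M : Fin k → Matrix ι ι K) (j : ℕ) :
    kron K ι k (fun i => M i ^ j) = kron K ι k M ^ j := by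
  induction j with
  | zero => simp [kron_one]
  | succ j ih => simp only [pow_succ, kron_mul, ih]

theorem kron_map {K' : Type} [Field K'] (f : K →+* K') (M : Fin k → Matrix ι ι K) :
    (kron K ι k M).map f = kron K' ι k (fun i => (M i).map f) := by
  ext r s
  simp [kron_apply]

end Kron

section SplitForm

/-- A split form. -/
structure SplitForm {F K A ι : Type} [Field F] [Field K] [Algebra F K] [Ring A] [Algebra F A]
    [Fintype ι] [DecidableEq ι] (ρ : A →ₐ[F] Matrix ι ι K) : Prop where
  span : Submodule.span K (Set.range ρ) = ⊤
  finrank : Module.finrank F A = Fintype.card ι ^ 2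
  nonempty : Nonempty ι

variable {F K A ι : Type} [Field F] [Field K] [Algebra F K] [Ring A] [Algebra F A]
    [Fintype ι] [DecidableEq ι] {ρ : A →ₐ[F] Matrix ι ι K}

theorem SplitForm.finiteDimensional (h : SplitForm ρ) : FiniteDimensional F A := by
  apply FiniteDimensional.of_finrank_pos
  rw [h.finrank]
  have := h.nonempty
  exact pow_pos Fintype.card_pos 2

theorem SplitForm.exists_basis (h : SplitForm ρ) {κ : Type} [Fintype κ]
    (b : Module.Basis κ F A) : ∃ B : Module.Basis κ K (Matrix ι ι K), ∀ i, B i = ρ (b i) := by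
  have hspan : ⊤ ≤ Submodule.span K (Set.range fun i => ρ (b i)) := by
    rw [← h.span, Submodule.span_le]
    rintro _ ⟨a, rfl⟩
    rw [← b.sum_repr a, map_sum]
    refine Submodule.sum_mem _ fun i _ => ?_
    rw [map_smul, ← algebraMap_smul K]
    exact Submodule.smul_mem _ _ (Submodule.subset_span ⟨i, rfl⟩)
  have hcard : Fintype.card κ = Module.finrank K (Matrix ι ι K) := by
    rw [← Module.finrank_eq_card_basis b, h.finrank, Module.finrank_matrix]
    simp [sq]
  refine ⟨basisOfTopLeSpanOfCardEqFinrank _ hspan hcard, fun i => ?_⟩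
  rw [coe_basisOfTopLeSpanOfCardEqFinrank]

theorem SplitForm.injective (h : SplitForm ρ) : Function.Injective ρ := by
  haveI := h.finiteDimensional
  let b := Module.finBasis F A
  obtain ⟨B, hB⟩ := h.exists_basis b
  rw [injective_iff_map_eq_zero]
  intro a ha
  rw [← b.sum_repr a, map_sum] at ha
  have hli := Fintype.linearIndependent_iff.1 B.linearIndependent
    (fun i => algebraMap F K (b.repr a i)) (by
      rw [← ha]
      refine Finset.sum_congr rfl fun i _ => ?_
      rw [hB, map_smul, algebraMap_smul])
  apply b.repr.injective
  ext i
  simpa using hli i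

/-- tensor power representation -/
noncomputable def rhoPow (ρ : A →ₐ[F] Matrix ι ι K) (k : ℕ) :
    (⨂[F] (_ : Fin k), A) →ₐ[F] Matrix (Fin k → ι) (Fin k → ι) K :=
  PiTensorProduct.liftAlgHom
    (((kron K ι k).restrictScalars F).compLinearMap (fun _ => ρ.toLinearMap))
    (by
      change kron K ι k (fun i => ρ 1) = 1
      simp only [map_one, kron_one])
    (fun x y => by
      change kron K ι k (fun i => ρ (x i * y i)) = kron K ι k (fun i => ρ (x i)) *
        kron K ι k (fun i => ρ (y i))
      simp only [map_mul, kron_mul])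

theorem rhoPow_tprod (k : ℕ) (x : Fin k → A) :
    rhoPow ρ k (PiTensorProduct.tprod F x) = kron K ι k (fun i => ρ (x i)) := by
  exact PiTensorProduct.lift.tprod (φ := ((kron K ι k).restrictScalars F).compLinearMap (fun _ => ρ.toLinearMap)) x

theorem finrank_tensorPower (F A : Type) [Field F] [Ring A] [Algebra F A] [FiniteDimensional F A]
    (k : ℕ) : Module.finrank F (⨂[F] (_ : Fin k), A) = Module.finrank F A ^ k := by
  let b := Module.finBasis F A
  rw [Module.finrank_eq_card_basis (_root_.Basis.piTensorProduct (fun _ : Fin k => b))]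
  simp

theorem SplitForm.tensorPower (h : SplitForm ρ) (k : ℕ) : SplitForm (rhoPow ρ k) where
  finrank := by
    haveI := h.finiteDimensional
    rw [finrank_tensorPower, h.finrank]
    simp only [Fintype.card_fun, Fintype.card_fin]
    ring
  nonempty := by
    have := h.nonempty
    infer_instance
  span := by
    classical
    haveI := h.finiteDimensional
    let b := Module.finBasis F A
    obtain ⟨B, hB⟩ := h.exists_basis b
    have key : ∀ M : Fin k → Matrix ι ι K,
        kron K ι k M ∈ Submodule.span K (Set.range (rhoPow ρ k)) := by
      intro M
      have : M = fun i => ∑ j, B.repr (M i) j • B j := by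
        ext1 i; rw [B.sum_repr]
      rw [this, MultilinearMap.map_sum]
      refine Submodule.sum_mem _ fun p _ => ?_
      rw [MultilinearMap.map_smul_univ]
      refine Submodule.smul_mem _ _ (Submodule.subset_span ⟨PiTensorProduct.tprod F (fun i => b (p i)), ?_⟩)
      rw [rhoPow_tprod]
      simp only [hB]
    rw [eq_top_iff]
    rintro M -
    rw [Matrix.matrix_eq_sum_single M]
    refine Submodule.sum_mem _ fun r _ => Submodule.sum_mem _ fun s _ => ?_
    have h1 : Matrix.single r s (M r s) =
        M r s • kron K ι k (fun i => Matrix.single (r i) (s i) 1) := by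
      ext r' s'
      rw [Matrix.smul_apply, kron_apply, Matrix.single_apply]
      split_ifs with hh
      · obtain ⟨rfl, rfl⟩ := hh
        simp
      · rw [not_and_or] at hh
        rcases hh with hh | hh
        · obtain ⟨i, hi⟩ := Function.ne_iff.1 hh
          rw [Finset.prod_eq_zero (Finset.mem_univ i), smul_zero]
          simp [Matrix.single_apply, hi]
        · obtain ⟨i, hi⟩ := Function.ne_iff.1 hh
          rw [Finset.prod_eq_zero (Finset.mem_univ i), smul_zero]
          simp [Matrix.single_apply, hi]
    rw [h1]
    exact Submodule.smul_mem _ _ (key _)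

end SplitForm


open scoped TensorProduct

theorem split_of_inj {F A V : Type} [Field F] [Ring A] [Algebra F A] [AddCommGroup V] [Module F V]
    [FiniteDimensional F V] [FiniteDimensional F A] (Ψ : A →ₐ[F] Module.End F V)
    (hinj : Function.Injective Ψ) (N : ℕ) (hV : Module.finrank F V = N)
    (hA : Module.finrank F A = N ^ 2) : Nonempty (A ≃ₐ[F] Matrix (Fin N) (Fin N) F) := by
  have hdim : Module.finrank F A = Module.finrank F (Module.End F V) := by
    rw [Module.finrank_linearMap, hV, hA, sq]
  have hs : Function.Surjective Ψ.toLinearMap :=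
    (LinearMap.injective_iff_surjective_of_finrank_eq_finrank (f := Ψ.toLinearMap) hdim).1 hinj
  have hbij : Function.Bijective Ψ := ⟨hinj, hs⟩
  exact ⟨(AlgEquiv.ofBijective Ψ hbij).trans
    (algEquivMatrix ((Module.finBasis F V).reindex (finCongr hV)))⟩

section TwForm

variable {F L A ι : Type} [Field F] [Field L] [Algebra F L] [Ring A] [Algebra F A]
    [Fintype ι] [DecidableEq ι]

/-- A split form with explicit descent datum. -/
structure TwForm (σ : L ≃ₐ[F] L) (n : ℕ) (γ : F) (ρ : A →ₐ[F] Matrix ι ι L) (P : Matrix ι ι L) :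
    Prop where
  split : SplitForm ρ
  Pmap : P.map σ = P
  conj : ∀ a, (ρ a).map σ * P = P * ρ a
  Ppow : P ^ n = Matrix.scalar ι (algebraMap F L γ)
  ne_zero : γ ≠ 0

theorem cycAlg_twForm (σ : L ≃ₐ[F] L) (n : ℕ) [NeZero n] (c : F) (hc : c ≠ 0)
    (h : CycData F L σ n) : TwForm σ n c (cycAlg σ n c).val (cycP L n c) where
  split :=
    { span := by
        have := cycAlg_span σ n c hc h
        rw [← this]
        congr 1
        ext X
        simp
      finrank := by rw [cycAlg_finrank σ n c h]; simp
      nonempty := ⟨0⟩ }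
  Pmap := cycP_map σ n c
  conj := fun a => a.2
  Ppow := cycP_pow n c
  ne_zero := hc

theorem TwForm.tensorPower {σ : L ≃ₐ[F] L} {n : ℕ} {γ : F} {ρ : A →ₐ[F] Matrix ι ι L}
    {P : Matrix ι ι L} (h : TwForm σ n γ ρ P) (k : ℕ) :
    TwForm σ n (γ ^ k) (rhoPow ρ k) (kron L ι k (fun _ => P)) where
  split := h.split.tensorPower k
  Pmap := by
    have := kron_map (σ : L →+* L) (fun _ : Fin k => P)
    have h2 := h.Pmap
    simp only [RingHom.coe_coe] at this
    rw [this]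
    congr 1
    ext1 i
    exact h2
  conj := fun a => by
    induction a using PiTensorProduct.induction_on with
    | smul_tprod r x =>
      rw [map_smul, rhoPow_tprod, Matrix.map_smul σ r (fun a => map_smul σ r a)]
      have := kron_map (σ : L →+* L) (fun i : Fin k => ρ (x i))
      have h1 : (kron L ι k (fun i : Fin k => ρ (x i))).map σ =
        kron L ι k (fun i => (ρ (x i)).map σ) := this
      rw [h1, Matrix.smul_mul, ← kron_mul, Matrix.mul_smul, ← kron_mul]
      simp only [h.conj]
    | add x y hx hy =>
      rw [map_add, Matrix.map_add σ (map_add σ), Matrix.add_mul, hx, hy, Matrix.mul_add]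
  Ppow := by
    rw [← kron_pow]
    simp only [h.Ppow, kron_scalar, map_pow]
  ne_zero := pow_ne_zero _ h.ne_zero

theorem TwForm.split_of_norm {σ : L ≃ₐ[F] L} {n : ℕ} {γ : F} {ρ : A →ₐ[F] Matrix ι ι L}
    {P : Matrix ι ι L} (hd : CycData F L σ n) (h : TwForm σ n γ ρ P) (g : L)
    (hg : algebraMap F L γ = ∏ i ∈ Finset.range n, (σ ^ i) g) :
    Nonempty (A ≃ₐ[F] Matrix (Fin (Fintype.card ι)) (Fin (Fintype.card ι)) F) := by
  haveI : FiniteDimensional F L := FiniteDimensional.of_finrank_pos (by rw [hd.finrank]; exact hd.pos)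
  have hC0 : algebraMap F L γ ≠ 0 := by simpa using h.ne_zero
  let Q : Matrix ι ι L := (algebraMap F L γ)⁻¹ • P ^ (n - 1)
  have hPQ : P * Q = 1 := by
    simp only [Q, Matrix.mul_smul]
    rw [← pow_succ', Nat.sub_add_cancel hd.pos, h.Ppow]
    ext i j; simp [Matrix.diagonal_apply, Matrix.one_apply, hC0]
  have hQP : Q * P = 1 := mul_eq_one_comm.1 hPQ
  have hmm : ∀ (M N : Matrix ι ι L), (M * N).map σ = M.map σ * N.map σ :=
        fun M N => Matrix.map_mul (f := (σ : L →+* L))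
  have hQmap : Q.map σ = Q := by
    have h1 : (P * Q).map σ = P * Q.map σ := by rw [hmm, h.Pmap]
    rw [hPQ] at h1
    have h2 : (1 : Matrix ι ι L).map σ = 1 := Matrix.map_one σ (map_zero σ) (map_one σ)
    rw [h2] at h1
    calc Q.map σ = (Q * P) * Q.map σ := by rw [hQP, one_mul]
      _ = Q := by rw [Matrix.mul_assoc, ← h1, Matrix.mul_one]
  have hmv : ∀ (M : Matrix ι ι L) (x : ι → L) (i : ι), σ ((M.mulVec x) i) =
      ((M.map σ).mulVec (fun j => σ (x j))) i := by
    intro M x i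
    simp [Matrix.mulVec, dotProduct]
  let S : Module.End F (ι → L) :=
    { toFun := fun ξ => g • Q.mulVec (fun j => σ (ξ j))
      map_add' := fun X Y => by
        rw [← smul_add, ← Matrix.mulVec_add]
        congr 2; ext j; simp
      map_smul' := fun r X => by
        have : (fun j => σ ((r • X) j)) = r • fun j => σ (X j) := by ext j; simp
        rw [this, Matrix.mulVec_smul, smul_comm]; rfl }
  have hSX : ∀ ξ, S ξ = g • Q.mulVec (fun j => σ (ξ j)) := fun ξ => rfl
  have hSl : ∀ (l : L) (u : ι → L), S (l • u) = σ l • S u := by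
    intro l u
    have : (fun j => σ ((l • u) j)) = σ l • fun j => σ (u j) := by ext j; simp
    rw [hSX, this, Matrix.mulVec_smul, smul_comm]; rfl
  have hSk : ∀ k ξ, (S ^ k) ξ = (∏ i ∈ Finset.range k, (σ ^ i) g) •
      (Q ^ k).mulVec (fun j => (σ ^ k) (ξ j)) := by
    intro k
    induction k with
    | zero => intro ξ; simp
    | succ k ih =>
      intro ξ
      rw [pow_succ', Module.End.mul_apply, ih, hSl, hSX, smul_smul]
      have h1 : (fun j => σ (((Q ^ k).mulVec fun j => (σ ^ k) (ξ j)) j)) =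
          (Q ^ k).mulVec (fun j => (σ ^ (k + 1)) (ξ j)) := by
        ext j
        have : (Q ^ k).map σ = Q ^ k := by
          have := map_pow ((σ : L →+* L).mapMatrix) Q k
          have h3 : (σ : L →+* L).mapMatrix Q = Q := hQmap
          rw [h3] at this
          exact this
        rw [hmv, this]
        rw [pow_succ' σ]
        rfl
      rw [h1, Matrix.mulVec_mulVec, ← pow_succ', Finset.prod_range_succ', map_prod]
      congr 2
      refine Finset.prod_congr rfl fun i _ => ?_
      rw [pow_succ' σ]; rfl
  have hSn : S ^ n = 1 := by
    refine LinearMap.ext fun ξ => ?_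
    have hQn : (algebraMap F L γ) • Q ^ n = 1 := by
      have : P ^ n * Q ^ n = 1 := by
        rw [← (show Commute P Q from by rw [Commute, SemiconjBy, hPQ, hQP]).mul_pow,
          hPQ, one_pow]
      rw [h.Ppow] at this
      rw [← this, Matrix.scalar_apply, ← Matrix.smul_eq_diagonal_mul]
    rw [hSk, ← hg, hd.pow_eq, ← Matrix.smul_mulVec, hQn]
    simp
  have hVdim : Module.finrank F (fixedSub S) = Fintype.card ι := by
    rw [finrank_fixedSub σ n hd.pos hd.pow_ne S hSl hSn ⊥ (by
      intro x
      rw [IntermediateField.mem_bot]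
      constructor
      · rintro ⟨y, rfl⟩; simp
      · exact hd.fix x)]
    simp
  have hspan := span_fixedSub σ n hd.pos hd.pow_ne S hSl hSn
  haveI : FiniteDimensional F (fixedSub S) := inferInstance
  let act : A →ₐ[F] Module.End F (ι → L) :=
    { toFun := fun a => (Matrix.toLin' (ρ a)).restrictScalars F
      map_one' := by refine LinearMap.ext fun x => ?_; simp
      map_mul' := fun a b => by refine LinearMap.ext fun x => ?_; simp [Matrix.mulVec_mulVec]
      map_zero' := by refine LinearMap.ext fun x => ?_; simp
      map_add' := fun a b => by refine LinearMap.ext fun x => ?_; simp [Matrix.add_mulVec]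
      commutes' := fun r => by
        refine LinearMap.ext fun x => ?_
        simp only [AlgHom.commutes, LinearMap.restrictScalars_apply, Matrix.toLin'_apply,
          Module.algebraMap_end_apply]
        rw [Algebra.algebraMap_eq_smul_one, Matrix.smul_mulVec, Matrix.one_mulVec] }
  have hact : ∀ a ξ, act a ξ = (ρ a).mulVec ξ := fun a ξ => rfl
  have hstab : ∀ a, ∀ ξ ∈ fixedSub S, act a ξ ∈ fixedSub S := by
    intro a ξ hξ
    rw [mem_fixedSub] at *
    rw [hact, hSX]
    have h1 : (fun j => σ ((ρ a).mulVec ξ j)) = ((ρ a).map σ).mulVec (fun j => σ (ξ j)) := by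
      ext j; rw [hmv]
    have h2 : Q * (ρ a).map σ = ρ a * Q := by
      have := h.conj a
      calc Q * (ρ a).map σ = Q * ((ρ a).map σ * P) * Q := by
            rw [Matrix.mul_assoc, Matrix.mul_assoc, hPQ, Matrix.mul_one]
        _ = ρ a * Q := by rw [this, ← Matrix.mul_assoc, hQP, Matrix.one_mul]
    rw [h1, Matrix.mulVec_mulVec, h2, ← Matrix.mulVec_mulVec, ← Matrix.mulVec_smul, ← hSX, hξ]
  let Ψ : A →ₐ[F] Module.End F (fixedSub S) :=
    { toFun := fun a => (act a).restrict (hstab a)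
      map_one' := by refine LinearMap.ext fun x => ?_; apply Subtype.ext; simp
      map_mul' := fun a b => by refine LinearMap.ext fun x => ?_; apply Subtype.ext; simp
      map_zero' := by refine LinearMap.ext fun x => ?_; apply Subtype.ext; simp
      map_add' := fun a b => by refine LinearMap.ext fun x => ?_; apply Subtype.ext; simp
      commutes' := fun r => by refine LinearMap.ext fun x => ?_; apply Subtype.ext; simp }
  have hinj : Function.Injective Ψ := by
    rw [injective_iff_map_eq_zero]
    intro a ha
    apply h.split.injective
    rw [map_zero]
    have h0 : ∀ ξ ∈ fixedSub S, (ρ a).mulVec ξ = 0 := fun ξ hξ =>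
      congrArg Subtype.val (LinearMap.congr_fun ha ⟨ξ, hξ⟩)
    have h1 : ∀ ξ : ι → L, (Matrix.toLin' (ρ a)) ξ = 0 := by
      intro ξ
      have : ξ ∈ Submodule.span L (fixedSub S : Set (ι → L)) := by rw [hspan]; trivial
      have h2 : Submodule.span L (fixedSub S : Set (ι → L)) ≤ LinearMap.ker (Matrix.toLin' (ρ a)) := by
        rw [Submodule.span_le]
        intro x hx
        exact h0 x hx
      exact h2 this
    apply (Matrix.toLin' (R := L)).injective
    refine LinearMap.ext fun ξ => ?_
    simp [h1]
  haveI := h.split.finiteDimensional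
  exact split_of_inj Ψ hinj _ hVdim (by rw [h.split.finrank])

end TwForm


open scoped TensorProduct

section LemmaM

variable {F L A ι : Type} [Field F] [Field L] [Algebra F L] [Ring A] [Algebra F A]
    [Fintype ι] [DecidableEq ι]

theorem SplitForm.exists_ext {ρ : A →ₐ[F] Matrix ι ι L} (h : SplitForm ρ) {W : Type}
    [AddCommGroup W] [Module L W] (f : A → Module.End L W)
    (f1 : f 1 = 1) (fmul : ∀ a b, f (a * b) = f a * f b) (fadd : ∀ a b, f (a + b) = f a + f b)
    (fsmul : ∀ (r : F) a, f (r • a) = algebraMap F L r • f a) :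
    ∃ Φ : Matrix ι ι L →ₗ[L] Module.End L W, (∀ a, Φ (ρ a) = f a) ∧ Φ 1 = 1 ∧
      ∀ M N, Φ (M * N) = Φ M * Φ N := by
  haveI := h.finiteDimensional
  let b := Module.finBasis F A
  obtain ⟨B, hB⟩ := h.exists_basis b
  let Φ : Matrix ι ι L →ₗ[L] Module.End L W := B.constr L (fun i => f (b i))
  let f' : A →+ Module.End L W := AddMonoidHom.mk' f fadd
  have hΦ : ∀ a, Φ (ρ a) = f a := by
    intro a
    change _ = f' a
    rw [← b.sum_repr a, map_sum, map_sum, map_sum]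
    refine Finset.sum_congr rfl fun i _ => ?_
    change _ = f _
    rw [map_smul, ← algebraMap_smul L, map_smul, ← hB, fsmul]
    congr 1
    exact B.constr_basis L _ i
  refine ⟨Φ, hΦ, ?_, ?_⟩
  · rw [← map_one ρ, hΦ, f1]
  · intro M N
    have hM : M ∈ Submodule.span L (Set.range ρ) := by rw [h.span]; trivial
    have hN : N ∈ Submodule.span L (Set.range ρ) := by rw [h.span]; trivial
    induction hM using Submodule.span_induction with
    | zero => simp
    | add x y _ _ hx hy => rw [add_mul, map_add, hx, hy, map_add, add_mul]
    | smul l x _ hx => rw [smul_mul_assoc, map_smul, hx, map_smul, smul_mul_assoc]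
    | mem x hx =>
      obtain ⟨a, rfl⟩ := hx
      induction hN using Submodule.span_induction with
      | zero => simp
      | add x y _ _ hx hy => rw [mul_add, map_add, hx, hy, map_add, mul_add]
      | smul l x _ hx => rw [mul_smul_comm, map_smul, hx, map_smul, mul_smul_comm]
      | mem x hx =>
        obtain ⟨b, rfl⟩ := hx
        rw [← map_mul, hΦ, hΦ, hΦ, fmul]

theorem matrix_rep_dim {W : Type} [AddCommGroup W] [Module L W] [FiniteDimensional L W]
    (Φ : Matrix ι ι L →ₗ[L] Module.End L W) (h1 : Φ 1 = 1)
    (hm : ∀ M N, Φ (M * N) = Φ M * Φ N) (i0 : ι) :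
    Fintype.card ι * Module.finrank L
      (LinearMap.ker (Φ (Matrix.single i0 i0 1) - 1)) = Module.finrank L W := by
  set U := LinearMap.ker (Φ (Matrix.single i0 i0 1) - 1) with hU
  have hmem : ∀ w, w ∈ U ↔ Φ (Matrix.single i0 i0 1) w = w := by
    intro w
    rw [hU, LinearMap.mem_ker, LinearMap.sub_apply, sub_eq_zero]; rfl
  have hma : ∀ M N w, Φ M (Φ N w) = Φ (M * N) w := fun M N w => by rw [hm]; rfl
  let e : W ≃ₗ[L] (ι → U) :=
    { toFun := fun w i => ⟨Φ (Matrix.single i0 i 1) w, by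
        rw [hmem, hma, Matrix.single_mul_single_same, one_mul]⟩
      invFun := fun f => ∑ i, Φ (Matrix.single i i0 1) (f i)
      map_add' := fun u v => by ext i; simp
      map_smul' := fun r u => by ext i; simp
      left_inv := fun w => by
        simp only [hma, Matrix.single_mul_single_same, one_mul]
        rw [← LinearMap.sum_apply, ← map_sum]
        have : ∑ i : ι, Matrix.single i i (1 : L) = 1 := by
          ext a b
          rw [Matrix.sum_apply, Finset.sum_eq_single a]
          · simp [Matrix.single_apply, Matrix.one_apply]
          · intro c _ hc
            simp [Matrix.single_apply, hc]
          · simp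
        rw [this, h1]; rfl
      right_inv := fun f => by
        ext i
        simp only [map_sum, hma]
        rw [Finset.sum_eq_single i]
        · rw [Matrix.single_mul_single_same, one_mul, (hmem _).1 (f i).2]
        · intro j _ hj
          rw [Matrix.single_mul_single_of_ne _ _ _ _ hj.symm]
          simp
        · simp }
  rw [e.finrank_eq, Module.finrank_pi_fintype]
  simp

theorem TwForm.lemmaM {σ : L ≃ₐ[F] L} {n : ℕ} {γ : F} {ρ : A →ₐ[F] Matrix ι ι L}
    {P : Matrix ι ι L} (h : TwForm σ n γ ρ P) (hσ : σ ^ n = 1) {V : Type} [AddCommGroup V]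
    [Module F V] [FiniteDimensional F V] (φ : A →ₐ[F] Module.End F V) :
    ∃ (U : Type) (_ : AddCommGroup U) (_ : Module F U) (_ : Module L U)
      (_ : IsScalarTower F L U) (_ : FiniteDimensional L U) (T : Module.End F U),
      (∀ (l : L) (u : U), T (l • u) = σ l • T u) ∧ T ^ n = algebraMap F _ γ ∧
      Fintype.card ι * Module.finrank L U = Module.finrank F V := by
  obtain ⟨Φ, hΦ, hΦ1, hΦm⟩ := h.split.exists_ext (W := L ⊗[F] V)
    (fun a => LinearMap.baseChange L (φ a)) (by
      rw [map_one]; exact LinearMap.baseChange_id) (by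
      intro a b; rw [map_mul]; exact LinearMap.baseChange_comp _ _) (by
      intro a b; rw [map_add, LinearMap.baseChange_add]) (by
      intro r a; rw [map_smul, LinearMap.baseChange_smul, algebraMap_smul])
  obtain ⟨i0⟩ := h.split.nonempty
  let s : Module.End F (L ⊗[F] V) := LinearMap.rTensor V σ.toLinearMap
  have hs : ∀ (l : L) (w : L ⊗[F] V), s (l • w) = σ l • s w := by
    intro l w
    induction w with
    | zero => simp
    | add x y hx hy => rw [smul_add, map_add, hx, hy, map_add, smul_add]
    | tmul x y => simp [s, TensorProduct.smul_tmul']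
  have hsn : ∀ k, s ^ k = LinearMap.rTensor V (σ ^ k : L ≃ₐ[F] L).toLinearMap := by
    intro k
    induction k with
    | zero => refine (LinearMap.rTensor_id V L).symm
    | succ k ih =>
      rw [pow_succ', ih]
      refine (LinearMap.rTensor_comp V _ _).symm.trans ?_
      congr 1
      rw [pow_succ']; rfl
  let T : Module.End F (L ⊗[F] V) := (Φ P).restrictScalars F * s
  have hTl : ∀ (l : L) (w : L ⊗[F] V), T (l • w) = σ l • T w := by
    intro l w
    change Φ P (s (l • w)) = σ l • Φ P (s w)
    rw [hs, map_smul]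
  have hTM : ∀ M w, T (Φ M w) = Φ (M.map σ) (T w) := by
    intro M w
    have hM : M ∈ Submodule.span L (Set.range ρ) := by rw [h.split.span]; trivial
    induction hM using Submodule.span_induction with
    | zero => simp
    | add x y _ _ hx hy =>
      rw [map_add, LinearMap.add_apply, map_add, hx, hy, Matrix.map_add σ (map_add σ), map_add]
      rfl
    | smul l x _ hx =>
      have h1 : (l • x).map σ = σ l • x.map σ := by
        ext i j; simp
      rw [map_smul, LinearMap.smul_apply, hTl, hx, h1, map_smul]; rfl
    | mem x hx =>
      obtain ⟨a, rfl⟩ := hx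
      have h1 : s (Φ (ρ a) w) = Φ (ρ a) (s w) := by
        rw [hΦ]
        induction w with
        | zero => simp
        | add x y hx hy => simp only [map_add, hx, hy]
        | tmul x y => simp [s]
      change Φ P (s _) = Φ _ (Φ P (s w))
      rw [h1, ← Module.End.mul_apply, ← hΦm, ← Module.End.mul_apply, ← hΦm, h.conj]
  have hTk : ∀ k w, (T ^ k) w = Φ (P ^ k) ((s ^ k) w) := by
    intro k
    induction k with
    | zero => intro w; simp [hΦ1]
    | succ k ih =>
      intro w
      rw [pow_succ', Module.End.mul_apply, ih, hTM]
      have h1 : (P ^ k).map σ = P ^ k := by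
        have h2 := map_pow (RingHom.mapMatrix (σ : L →+* L)) P k
        simp only [RingHom.mapMatrix_apply, RingHom.coe_coe] at h2
        rw [h2, h.Pmap]
      rw [h1]
      change Φ (P ^ k) (Φ P (s _)) = _
      rw [← Module.End.mul_apply, ← hΦm, ← pow_succ, pow_succ' s]; rfl
  let U := LinearMap.ker (Φ (Matrix.single i0 i0 1) - 1)
  have hmem : ∀ w, w ∈ U ↔ Φ (Matrix.single i0 i0 1) w = w := by
    intro w
    rw [LinearMap.mem_ker, LinearMap.sub_apply, sub_eq_zero]; rfl
  have hstab : ∀ w ∈ U.restrictScalars F, T w ∈ U.restrictScalars F := by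
    intro w hw
    rw [Submodule.restrictScalars_mem, hmem] at *
    conv_rhs => rw [← hw]
    rw [hTM]
    congr 2
    ext i j
    simp [Matrix.single_apply, apply_ite σ]
  let TU : Module.End F U := T.restrict hstab
  have hTUk : ∀ (k : ℕ) (u : U), ((TU ^ k) u : L ⊗[F] V) = (T ^ k) (u : L ⊗[F] V) := by
    intro k
    induction k with
    | zero => intro u; rfl
    | succ k ih =>
      intro u
      rw [pow_succ', pow_succ', Module.End.mul_apply, Module.End.mul_apply, ← ih]; rfl
  refine ⟨U, inferInstance, inferInstance, inferInstance, inferInstance, inferInstance, TU,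
    ?_, ?_, ?_⟩
  · intro l u
    exact Subtype.ext (hTl l u)
  · refine LinearMap.ext fun u => ?_
    apply Subtype.ext
    rw [hTUk, hTk, hsn, hσ, h.Ppow]
    have : LinearMap.rTensor V ((1 : L ≃ₐ[F] L)).toLinearMap = LinearMap.id :=
      LinearMap.rTensor_id V L
    rw [this, LinearMap.id_apply]
    have h2 : Matrix.scalar ι (algebraMap F L γ) = (algebraMap F L γ) • (1 : Matrix ι ι L) := by
      rw [Matrix.scalar_apply, Matrix.smul_one_eq_diagonal]
    rw [h2, map_smul, hΦ1]
    simp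
  · rw [matrix_rep_dim Φ hΦ1 hΦm i0, Module.finrank_baseChange]

end LemmaM


open scoped TensorProduct

section S2

variable {F L A ι : Type} [Field F] [Field L] [Algebra F L] [Ring A] [Algebra F A]
    [Fintype ι] [DecidableEq ι]

theorem TwForm.norm_of_split {σ : L ≃ₐ[F] L} {n : ℕ} {γ : F} {ρ : A →ₐ[F] Matrix ι ι L}
    {P : Matrix ι ι L} (h : TwForm σ n γ ρ P) (hσ : σ ^ n = 1) (N : ℕ)
    (e : A ≃ₐ[F] Matrix (Fin N) (Fin N) F) :
    ∃ g : L, algebraMap F L γ = ∏ i ∈ Finset.range n, (σ ^ i) g := by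
  have hN : N = Fintype.card ι := by
    have h1 := h.split.finrank
    rw [e.toLinearEquiv.finrank_eq, Module.finrank_matrix] at h1
    simp only [Module.finrank_self, Fintype.card_fin, mul_one] at h1
    nlinarith
  obtain ⟨U, _, _, _, _, _, T, hT, hTn, hdim⟩ := h.lemmaM hσ
    ((Matrix.toLinAlgEquiv' : Matrix (Fin N) (Fin N) F ≃ₐ[F] _).toAlgHom.comp e.toAlgHom)
  have hι : 0 < Fintype.card ι := by
    have := h.split.nonempty
    exact Fintype.card_pos
  have h1 : Module.finrank L U = 1 := by
    rw [Module.finrank_fin_fun, hN] at hdim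
    exact Nat.eq_of_mul_eq_mul_left hι (by rw [hdim, mul_one])
  obtain ⟨u, hu, hu'⟩ := finrank_eq_one_iff'.1 h1
  obtain ⟨g, hg⟩ := hu' (T u)
  refine ⟨g, ?_⟩
  have hk : ∀ k, (T ^ k) u = (∏ i ∈ Finset.range k, (σ ^ i) g) • u := by
    intro k
    induction k with
    | zero => simp
    | succ k ih =>
      rw [pow_succ, Module.End.mul_apply, ← hg, semilin_pow σ T hT, ih, smul_smul,
        Finset.prod_range_succ, mul_comm]
  have h2 := hk n
  rw [hTn, Module.algebraMap_end_apply, ← algebraMap_smul L γ u] at h2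
  exact smul_left_injective L hu h2

end S2

section S3

variable {F L A ι : Type} [Field F] [Field L] [Algebra F L] [Ring A] [Algebra F A]
    [Fintype ι] [DecidableEq ι]

theorem CycData.finiteDimensional {σ : L ≃ₐ[F] L} {n : ℕ} (h : CycData F L σ n) :
    FiniteDimensional F L := FiniteDimensional.of_finrank_pos (by rw [h.finrank]; exact h.pos)

theorem CycData.orderOf {σ : L ≃ₐ[F] L} {n : ℕ} (h : CycData F L σ n) : orderOf σ = n :=
  (orderOf_eq_iff h.pos).2 ⟨h.pow_eq, fun i hi hi0 => h.pow_ne i hi0 hi⟩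

theorem CycData.sub {σ : L ≃ₐ[F] L} {l n' : ℕ} (h : CycData F L σ (l * n')) :
    ∃ (K : IntermediateField F L) (τ : K ≃ₐ[F] K), (∀ x, x ∈ K ↔ (σ ^ n') x = x) ∧
      (∀ x : K, (τ x : L) = σ x) ∧ CycData F K τ n' := by
  haveI := h.finiteDimensional
  have hpos := h.pos
  have hl : 0 < l := Nat.pos_of_mul_pos_right hpos
  have hn' : 0 < n' := Nat.pos_of_mul_pos_left hpos
  let K : IntermediateField F L := IntermediateField.fixedField (Subgroup.zpowers (σ ^ n'))
  have hK : ∀ x, x ∈ K ↔ (σ ^ n') x = x := by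
    intro x
    rw [IntermediateField.mem_fixedField_iff]
    constructor
    · intro hx; exact hx _ (Subgroup.mem_zpowers _)
    · intro hx f hf
      obtain ⟨k, rfl⟩ := Subgroup.mem_zpowers_iff.1 hf
      have : Subgroup.zpowers (σ ^ n') ≤ MulAction.stabilizer (L ≃ₐ[F] L) x := by
        rw [Subgroup.zpowers_le]; exact hx
      exact this hf
  have hστ : ∀ x ∈ K, σ x ∈ K := by
    intro x hx
    rw [hK] at *
    conv_rhs => rw [← hx]
    rw [← AlgEquiv.mul_apply, ← AlgEquiv.mul_apply, ← pow_succ, ← pow_succ']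
  let f : K →ₐ[F] K := AlgHom.codRestrict (σ.toAlgHom.comp K.val) K.toSubalgebra
    (fun x => hστ x x.2)
  have hf : Function.Bijective f := by
    have hi : Function.Injective f := f.toRingHom.injective
    exact ⟨hi, LinearMap.surjective_of_injective (f := f.toLinearMap) hi⟩
  let τ : K ≃ₐ[F] K := AlgEquiv.ofBijective f hf
  have hτ : ∀ x : K, (τ x : L) = σ x := fun x => rfl
  have hτk : ∀ (k : ℕ) (x : K), ((τ ^ k) x : L) = (σ ^ k) x := by
    intro k
    induction k with
    | zero => intro x; rfl
    | succ k ih => intro x; rw [pow_succ', pow_succ', AlgEquiv.mul_apply, hτ, ih]; rfl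
  refine ⟨K, τ, hK, hτ, hn', ?_, ?_, ?_, ?_⟩
  · ext x; rw [hτk, (hK _).1 x.2]; rfl
  · intro i hi hin h1
    have h2 : σ ^ i ∈ IntermediateField.fixingSubgroup K := by
      rw [IntermediateField.mem_fixingSubgroup_iff]
      intro x hx
      have := hτk i ⟨x, hx⟩
      rw [h1] at this
      exact this.symm
    rw [IntermediateField.fixingSubgroup_fixedField] at h2
    obtain ⟨k, hk⟩ := Subgroup.mem_zpowers_iff.1 h2
    have h3 : σ ^ ((n' : ℤ) * k - i) = 1 := by
      rw [zpow_sub, zpow_mul, zpow_natCast, zpow_natCast, hk, mul_inv_cancel]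
    rw [← orderOf_dvd_iff_zpow_eq_one, h.orderOf] at h3
    have h4 : (n' : ℤ) ∣ (n' : ℤ) * k - i := dvd_trans ⟨l, by push_cast; ring⟩ h3
    have h5 : (n' : ℤ) ∣ i := (dvd_sub_right ⟨k, rfl⟩).1 h4
    have h6 := Nat.le_of_dvd hi (Int.natCast_dvd_natCast.1 h5)
    omega
  · intro x hx
    obtain ⟨y, hy⟩ := h.fix x (by rw [← hτ, hx])
    exact ⟨y, Subtype.ext hy⟩
  · have h1 := Module.finrank_mul_finrank F K L
    rw [IntermediateField.finrank_fixedField_eq_card, h.finrank, Nat.card_zpowers,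
      orderOf_pow_of_dvd hn'.ne' (by rw [h.orderOf]; exact ⟨l, mul_comm _ _⟩), h.orderOf,
      Nat.mul_div_cancel _ hn', mul_comm l] at h1
    exact Nat.eq_of_mul_eq_mul_right hl h1

theorem TwForm.dvd_module {Γ₁ Γ₂ : Type} [LinearOrderedCommGroupWithZero Γ₁]
    [LinearOrderedCommGroupWithZero Γ₂] {σ : L ≃ₐ[F] L} {l n' m' : ℕ} {c : F} (hc : c ≠ 0)
    (hd : CycData F L σ (l * n'))
    (v : Valuation L Γ₁) (ν : Valuation L Γ₂)
    (hcoarse : ∀ x y, v x < v y → ν x < ν y) (hvσ : ∀ x, v (σ x) = v x)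
    (hνσ : ∀ x, ν ((σ ^ m') x) = ν x)
    (hv : ∀ (g : L) (i : ℕ), v (g ^ (l * n')) = v (algebraMap F L c ^ i) → l * m' ∣ i)
    (hν : ∀ (g : L) (i : ℕ), ν (g ^ (l * n')) = ν (algebraMap F L c ^ i) → l * n' ∣ i)
    {ρ : A →ₐ[F] Matrix ι ι L} {P : Matrix ι ι L} (h : TwForm σ (l * n') (c ^ l) ρ P)
    {V : Type} [AddCommGroup V] [Module F V] [FiniteDimensional F V]
    (φ : A →ₐ[F] Module.End F V) :
    Fintype.card ι * n' ∣ Module.finrank F V := by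
  haveI := hd.finiteDimensional
  have hpos := hd.pos
  have hl : 0 < l := Nat.pos_of_mul_pos_right hpos
  have hn' : 0 < n' := Nat.pos_of_mul_pos_left hpos
  haveI : NeZero n' := ⟨hn'.ne'⟩
  obtain ⟨U, _, _, _, _, _, T, hT, hTn, hdim⟩ := h.lemmaM hd.pow_eq φ
  obtain ⟨K, τ, hK, hτ, hKd⟩ := hd.sub
  let S : Module.End F U := c⁻¹ • T ^ n'
  have hSl : ∀ (x : L) (u : U), S (x • u) = (σ ^ n') x • S u := by
    intro x u
    change c⁻¹ • (T ^ n') (x • u) = (σ ^ n') x • c⁻¹ • (T ^ n') u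
    rw [semilin_pow σ T hT, smul_comm]
  have hSn : S ^ l = 1 := by
    change (c⁻¹ • T ^ n') ^ l = 1
    rw [smul_pow, ← pow_mul, mul_comm n' l, hTn, Algebra.algebraMap_eq_smul_one, smul_smul,
      ← mul_pow, inv_mul_cancel₀ hc, one_pow, one_smul]
  have hσ' : ∀ i, 0 < i → i < l → (σ ^ n') ^ i ≠ 1 := by
    intro i hi hil
    rw [← pow_mul]
    apply hd.pow_ne _ (Nat.mul_pos hn' hi)
    rw [mul_comm]
    exact Nat.mul_lt_mul_of_pos_right hil hn'
  have hfr := finrank_fixedSub (σ ^ n') l hl hσ' S hSl hSn K hK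
  rw [hKd.finrank] at hfr
  let US : Submodule K U :=
    { carrier := (fixedSub S : Set U)
      add_mem' := fun hx hy => (fixedSub S).add_mem hx hy
      zero_mem' := (fixedSub S).zero_mem
      smul_mem' := fun x u hu => by
        have hu' : S u = u := hu
        change S ((x : L) • u) = (x : L) • u
        rw [hSl, (hK x).1 x.2, hu'] }
  haveI : IsScalarTower F K U := ⟨fun r x u => by
    change ((r • x : K) : L) • u = r • ((x : L) • u)
    rw [← smul_assoc]; rfl⟩
  have hfr2 : Module.finrank F US = n' * Module.finrank L U := by
    rw [← hfr]; rfl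
  have hTS : ∀ u ∈ US.restrictScalars F, T u ∈ US.restrictScalars F := by
    intro u hu
    have hu' : S u = u := hu
    change S (T u) = T u
    conv_rhs => rw [← hu']
    change c⁻¹ • (T ^ n') (T u) = T (c⁻¹ • (T ^ n') u)
    rw [map_smul, ← Module.End.mul_apply, ← Module.End.mul_apply, ← pow_succ, ← pow_succ']
  let TU : Module.End F US := T.restrict hTS
  have hTUk : ∀ (k : ℕ) (u : US), ((TU ^ k) u : U) = (T ^ k) (u : U) := by
    intro k
    induction k with
    | zero => intro u; rfl
    | succ k ih =>
      intro u
      rw [pow_succ', pow_succ', Module.End.mul_apply, Module.End.mul_apply, ← ih]; rfl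
  have hτk : ∀ (k : ℕ) (x : K), ((τ ^ k) x : L) = (σ ^ k) x := by
    intro k
    induction k with
    | zero => intro x; rfl
    | succ k ih => intro x; rw [pow_succ', pow_succ', AlgEquiv.mul_apply, hτ, ih]; rfl
  have hdom : ∀ X Y : cycAlg τ n' c, X * Y = 0 → X = 0 ∨ Y = 0 := by
    apply cycAlg_domain τ n' m' c hc hKd.pow_eq (v.comap (algebraMap K L))
      (ν.comap (algebraMap K L))
    · intro x y hxy; exact hcoarse _ _ hxy
    · intro x; exact (congrArg v (hτ x)).trans (hvσ _)
    · intro x; exact (congrArg ν (hτk m' x)).trans (hνσ _)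
    · intro g i hg
      have hg' : v ((g : L) ^ n') = v (algebraMap F L c ^ i) := by
        simpa [map_pow] using hg
      have := hv g (l * i) (by
        rw [mul_comm l n', pow_mul, map_pow, hg', mul_comm l i, pow_mul, map_pow, map_pow, map_pow])
      exact Nat.dvd_of_mul_dvd_mul_left hl this
    · intro g i hg
      have hg' : ν ((g : L) ^ n') = ν (algebraMap F L c ^ i) := by
        simpa [map_pow] using hg
      have := hν g (l * i) (by
        rw [mul_comm l n', pow_mul, map_pow, hg', mul_comm l i, pow_mul, map_pow, map_pow, map_pow])
      exact Nat.dvd_of_mul_dvd_mul_left hl this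
  have hdvd := cyc_dvd τ n' c hKd hdom TU (by
      intro x u
      apply Subtype.ext
      change T ((x : L) • (u : U)) = ((τ x : K) : L) • T u
      rw [hT, hτ]) (by
      refine LinearMap.ext fun u => ?_
      apply Subtype.ext
      rw [hTUk]
      have hu : c⁻¹ • (T ^ n') (u : U) = u := u.2
      change _ = c • (u : U)
      conv_rhs => rw [← hu]
      rw [smul_smul, mul_inv_cancel₀ hc, one_smul])
  rw [hfr2, sq] at hdvd
  rw [← hdim]
  exact Nat.mul_dvd_mul_left _ (Nat.dvd_of_mul_dvd_mul_left hn' hdvd)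

end S3


open scoped TensorProduct

section Simple

variable {F K D : Type} [Field F] [Field K] [Algebra F K] [DivisionRing D] [Algebra F D]

theorem baseChange_simple (hcen : Subalgebra.center F D = ⊥) : IsSimpleRing (K ⊗[F] D) := by
  haveI : Nontrivial (K ⊗[F] D) := inferInstance
  let B := Module.Free.chooseBasis F K
  let e := TensorProduct.equivFinsuppOfBasisLeft (N := D) B
  have he : ∀ x z j, e ((1 ⊗ₜ[F] x) * z) j = x * e z j := by
    intro x z j
    induction z with
    | zero => simp
    | add a b ha hb => rw [mul_add, map_add, map_add, Finsupp.add_apply, ha, hb,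
        Finsupp.add_apply, mul_add]
    | tmul k d =>
      rw [Algebra.TensorProduct.tmul_mul_tmul, one_mul,
        TensorProduct.equivFinsuppOfBasisLeft_apply_tmul_apply,
        TensorProduct.equivFinsuppOfBasisLeft_apply_tmul_apply, mul_smul_comm]
  have he' : ∀ x z j, e (z * (1 ⊗ₜ[F] x)) j = e z j * x := by
    intro x z j
    induction z with
    | zero => simp
    | add a b ha hb => rw [add_mul, map_add, map_add, Finsupp.add_apply, ha, hb,
        Finsupp.add_apply, add_mul]
    | tmul k d =>
      rw [Algebra.TensorProduct.tmul_mul_tmul, mul_one,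
        TensorProduct.equivFinsuppOfBasisLeft_apply_tmul_apply,
        TensorProduct.equivFinsuppOfBasisLeft_apply_tmul_apply, smul_mul_assoc]
  constructor
  haveI : Nontrivial (TwoSidedIdeal (K ⊗[F] D)) := inferInstance
  constructor
  intro I
  by_cases hI : ∀ z ∈ I, z = 0
  · left
    rw [eq_bot_iff]
    intro z hz
    rw [hI z hz]; exact I.asIdeal.zero_mem |> fun _ => TwoSidedIdeal.zero_mem _
  right
  push Not at hI
  classical
  have hex : ∃ k, ∃ z ∈ I, z ≠ 0 ∧ (e z).support.card = k := by
    obtain ⟨z, hz, hz0⟩ := hI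
    exact ⟨_, z, hz, hz0, rfl⟩
  obtain ⟨z, hz, hz0, hzk⟩ := Nat.find_spec hex
  have hmin : ∀ w ∈ I, (e w).support.card < (e z).support.card → w = 0 := by
    intro w hw hlt
    by_contra hw0
    rw [hzk] at hlt
    exact Nat.find_min hex hlt ⟨w, hw, hw0, rfl⟩
  have hez : e z ≠ 0 := fun h => hz0 (e.injective (by rw [h, map_zero]))
  obtain ⟨i, hi⟩ := Finsupp.ne_iff.1 hez
  rw [Finsupp.zero_apply] at hi
  set w := (1 ⊗ₜ[F] (e z i)⁻¹) * z with hw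
  have hwI : w ∈ I := I.mul_mem_left _ _ hz
  have hwj : ∀ j, e w j = (e z i)⁻¹ * e z j := fun j => he _ _ _
  have hwi : e w i = 1 := by rw [hwj, inv_mul_cancel₀ hi]
  have hcomm : ∀ x, (1 ⊗ₜ[F] x) * w - w * (1 ⊗ₜ[F] x) = 0 := by
    intro x
    apply hmin
    · exact I.sub_mem (I.mul_mem_left _ _ hwI) (I.mul_mem_right _ _ hwI)
    · apply Finset.card_lt_card
      rw [Finset.ssubset_iff_of_subset]
      · refine ⟨i, by rwa [Finsupp.mem_support_iff], ?_⟩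
        rw [Finsupp.notMem_support_iff, map_sub, Finsupp.sub_apply, he, he', hwi]
        simp
      · intro j
        rw [Finsupp.mem_support_iff, Finsupp.mem_support_iff, map_sub, Finsupp.sub_apply, he, he',
          hwj]
        intro h1 h2
        apply h1
        simp [h2]
  have hcj : ∀ j, ∃ r : F, algebraMap F D r = e w j := by
    intro j
    have : e w j ∈ Subalgebra.center F D := by
      rw [Subalgebra.mem_center_iff]
      intro x
      have h1 := congrArg (fun y => e y j) (hcomm x)
      simp only [map_sub, Finsupp.sub_apply, he, he', map_zero, Finsupp.zero_apply] at h1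
      exact sub_eq_zero.1 h1
    rw [hcen] at this
    exact Algebra.mem_bot.1 this
  choose r hr using hcj
  have hwk : ∃ k : K, w = k ⊗ₜ[F] (1 : D) := by
    have h1 : w = e.symm (e w) := (e.symm_apply_apply w).symm
    rw [TensorProduct.equivFinsuppOfBasisLeft_symm_apply] at h1
    refine ⟨(e w).sum fun j _ => r j • B j, ?_⟩
    rw [Finsupp.sum, TensorProduct.sum_tmul]
    rw [Finsupp.sum] at h1
    conv_lhs => rw [h1]
    refine Finset.sum_congr rfl fun j _ => ?_
    rw [← hr, Algebra.algebraMap_eq_smul_one, TensorProduct.tmul_smul, TensorProduct.smul_tmul']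
  obtain ⟨k, hk⟩ := hwk
  have hk0 : k ≠ 0 := by
    rintro rfl
    rw [TensorProduct.zero_tmul] at hk
    rw [hk] at hwi
    simp at hwi
  have h1 : (1 : K ⊗[F] D) ∈ I := by
    have h2 : (k⁻¹ ⊗ₜ[F] (1 : D)) * w = 1 := by
      rw [hk, Algebra.TensorProduct.tmul_mul_tmul, inv_mul_cancel₀ hk0, one_mul]; rfl
    rw [← h2]
    exact I.mul_mem_left _ _ hwI
  rw [eq_top_iff]
  intro y _
  have := I.mul_mem_left y _ h1
  rwa [mul_one] at this

theorem exists_splitForm [FiniteDimensional F D] (hcen : Subalgebra.center F D = ⊥) :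
    ∃ (d : ℕ) (ψ : D →ₐ[F] Matrix (Fin d) (Fin d) (AlgebraicClosure F)), SplitForm ψ := by
  haveI := baseChange_simple (K := AlgebraicClosure F) hcen
  obtain ⟨d, hd, ⟨g⟩⟩ := IsSimpleRing.exists_algEquiv_matrix_of_isAlgClosed (AlgebraicClosure F)
    (AlgebraicClosure F ⊗[F] D)
  let ψ : D →ₐ[F] Matrix (Fin d) (Fin d) (AlgebraicClosure F) :=
    (g.toAlgHom.restrictScalars F).comp Algebra.TensorProduct.includeRight
  refine ⟨d, ψ, ⟨?_, ?_, ⟨0⟩⟩⟩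
  · rw [eq_top_iff]
    intro M _
    obtain ⟨z, rfl⟩ := g.surjective M
    induction z with
    | zero => simp
    | add x y hx hy => rw [map_add]; exact Submodule.add_mem _ (hx trivial) (hy trivial)
    | tmul k x =>
      have : k ⊗ₜ[F] x = k • ((1 : AlgebraicClosure F) ⊗ₜ[F] x) := by
        rw [TensorProduct.smul_tmul', smul_eq_mul, mul_one]
      rw [this, map_smul]
      exact Submodule.smul_mem _ _ (Submodule.subset_span ⟨x, rfl⟩)
  · rw [← Module.finrank_baseChange (R := AlgebraicClosure F), g.toLinearEquiv.finrank_eq,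
      Module.finrank_matrix]
    simp [sq]

end Simple


open scoped TensorProduct

section Trd

variable {F K A ι : Type} [Field F] [Field K] [Algebra F K] [Ring A] [Algebra F A]
    [Fintype ι] [DecidableEq ι] {ρ : A →ₐ[F] Matrix ι ι K}

theorem trace_mulRight_matrix (M : Matrix ι ι K) :
    LinearMap.trace K _ (LinearMap.mulRight K M) = Fintype.card ι * M.trace := by
  rw [LinearMap.trace_eq_matrix_trace K (Matrix.stdBasis K ι ι), Matrix.trace,
    Fintype.sum_prod_type]
  have : ∀ i j, (LinearMap.toMatrix (Matrix.stdBasis K ι ι) (Matrix.stdBasis K ι ι)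
      (LinearMap.mulRight K M)).diag (i, j) = M j j := by
    intro i j
    rw [Matrix.diag_apply, LinearMap.toMatrix_apply, Matrix.stdBasis_eq_single,
      LinearMap.mulRight_apply]
    have h1 : ∀ Y : Matrix ι ι K, (Matrix.stdBasis K ι ι).repr Y (i, j) = Y i j := by
      intro Y
      have := Matrix.matrix_eq_sum_single Y
      conv_lhs => rw [this]
      simp only [map_sum, Finsupp.finsetSum_apply]
      rw [Finset.sum_eq_single i, Finset.sum_eq_single j]
      · have h2 : Matrix.single i j (Y i j) = Y i j • Matrix.stdBasis K ι ι (i, j) := by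
          rw [Matrix.stdBasis_eq_single]; simp
        rw [h2, map_smul, Module.Basis.repr_self]; simp
      · intro b _ hb
        have h2 : Matrix.single i b (Y i b) = Y i b • Matrix.stdBasis K ι ι (i, b) := by
          rw [Matrix.stdBasis_eq_single]; simp
        rw [h2, map_smul, Module.Basis.repr_self]; simp [hb]
      · simp
      · intro a _ ha
        apply Finset.sum_eq_zero
        intro b _
        have h2 : Matrix.single a b (Y a b) = Y a b • Matrix.stdBasis K ι ι (a, b) := by
          rw [Matrix.stdBasis_eq_single]; simp
        rw [h2, map_smul, Module.Basis.repr_self]; simp [ha]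
      · simp
    rw [h1]
    simp
  simp only [this]
  simp [Matrix.trace]

theorem SplitForm.trace_mulRight (h : SplitForm ρ) (a : A) :
    algebraMap F K (LinearMap.trace F A (LinearMap.mulRight F a)) =
      Fintype.card ι * (ρ a).trace := by
  haveI := h.finiteDimensional
  rw [← trace_mulRight_matrix]
  let b := Module.finBasis F A
  obtain ⟨B, hB⟩ := h.exists_basis b
  rw [LinearMap.trace_eq_matrix_trace F b, LinearMap.trace_eq_matrix_trace K B, Matrix.trace,
    Matrix.trace, map_sum]
  refine Finset.sum_congr rfl fun i _ => ?_
  rw [Matrix.diag_apply, Matrix.diag_apply, LinearMap.toMatrix_apply, LinearMap.toMatrix_apply,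
    hB, LinearMap.mulRight_apply, LinearMap.mulRight_apply, ← map_mul]
  have : ∀ x : A, ∀ i, B.repr (ρ x) i = algebraMap F K (b.repr x i) := by
    intro x i
    conv_lhs => rw [← b.sum_repr x]
    rw [map_sum]
    have h2 : ∀ j, ρ (b.repr x j • b j) = algebraMap F K (b.repr x j) • B j := by
      intro j; rw [map_smul, hB, algebraMap_smul]
    simp only [h2]
    rw [B.repr_sum_self]
  rw [this]

theorem SplitForm.mem_range [CharZero F] (h : SplitForm ρ) (X : Matrix ι ι K)
    (hX : ∀ b, ∃ r : F, (X * ρ b).trace = algebraMap F K r) : ∃ a, ρ a = X := by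
  haveI := h.finiteDimensional
  have := h.nonempty
  haveI : CharZero K := charZero_of_injective_algebraMap (algebraMap F K).injective
  have hN : (Fintype.card ι : K) ≠ 0 := Nat.cast_ne_zero.2 Fintype.card_ne_zero
  have hnd : ∀ Y : Matrix ι ι K, (∀ b, (Y * ρ b).trace = 0) → Y = 0 := by
    intro Y hY
    rw [Matrix.ext_iff_trace_mul_right]
    intro M
    have hM : M ∈ Submodule.span K (Set.range ρ) := by rw [h.span]; trivial
    rw [Matrix.zero_mul, Matrix.trace_zero]
    induction hM using Submodule.span_induction with
    | zero => simp
    | add x y _ _ hx hy => rw [mul_add, Matrix.trace_add, hx, hy, add_zero]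
    | smul l x _ hx => rw [mul_smul_comm, Matrix.trace_smul, hx, smul_zero]
    | mem x hx => obtain ⟨b, rfl⟩ := hx; exact hY b
  let tr : A →ₗ[F] F := LinearMap.trace F A ∘ₗ (LinearMap.mul F A).flip
  have htr : ∀ a, algebraMap F K (tr a) = Fintype.card ι * (ρ a).trace := h.trace_mulRight
  let β : A →ₗ[F] Module.Dual F A := (LinearMap.mul F A).compr₂ tr
  have hβ : ∀ a b, β a b = tr (a * b) := fun a b => rfl
  have hinj : Function.Injective β := by
    rw [injective_iff_map_eq_zero]
    intro a ha
    apply h.injective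
    rw [map_zero]
    apply hnd
    intro b
    have h1 := htr (a * b)
    rw [← hβ, ha, LinearMap.zero_apply, map_zero, map_mul] at h1
    exact (mul_eq_zero.1 h1.symm).resolve_left hN
  have hsurj : Function.Surjective β :=
    (LinearMap.injective_iff_surjective_of_finrank_eq_finrank
      (Subspace.dual_finrank_eq).symm).1 hinj
  choose r hr using hX
  let f : Module.Dual F A :=
    { toFun := fun b => Fintype.card ι * r b
      map_add' := fun x y => by
        apply (algebraMap F K).injective
        simp only [map_mul, map_add, ← hr, mul_add, Matrix.trace_add]
      map_smul' := fun s x => by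
        apply (algebraMap F K).injective
        simp only [map_mul, ← hr, map_smul, mul_smul_comm, Matrix.trace_smul, RingHom.id_apply,
          smul_eq_mul, ← algebraMap_smul K s]
        ring }
  obtain ⟨a, ha⟩ := hsurj f
  refine ⟨a, sub_eq_zero.1 (hnd _ fun b => ?_)⟩
  have h1 := htr (a * b)
  rw [← hβ, ha, map_mul] at h1
  have h2 : algebraMap F K (f b) = Fintype.card ι * (X * ρ b).trace := by
    rw [hr, ← map_natCast (algebraMap F K), ← map_mul]; rfl
  rw [h2] at h1
  rw [sub_mul, Matrix.trace_sub, sub_eq_zero]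
  exact (mul_left_cancel₀ hN h1).symm

end Trd


open scoped TensorProduct

section Path

variable {K ι : Type} [Field K] [Fintype ι] [DecidableEq ι]

theorem path_prod (k : ℕ) (M : Fin (k + 1) → Matrix ι ι K) (x y : ι) :
    (List.ofFn M).prod x y = ∑ r : Fin k → ι, ∏ i : Fin (k + 1),
      M i ((Fin.cons x r : Fin (k + 1) → ι) i) ((Fin.snoc r y : Fin (k + 1) → ι) i) := by
  induction k generalizing x with
  | zero => simp [Fin.snoc]
  | succ k ih =>
    rw [List.ofFn_succ, List.prod_cons, Matrix.mul_apply,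
      ← (Fin.consEquiv (fun _ : Fin (k + 1) => ι)).sum_comp, Fintype.sum_prod_type]
    refine Finset.sum_congr rfl fun z _ => ?_
    rw [ih, Finset.mul_sum]
    refine Finset.sum_congr rfl fun r _ => ?_
    rw [Fin.prod_univ_succ (n := k + 1)]
    have h1 : (Fin.snoc (Fin.cons z r : Fin (k + 1) → ι) y : Fin (k + 2) → ι) =
        Fin.cons z (Fin.snoc r y : Fin (k + 1) → ι) :=
      (Fin.cons_snoc_eq_snoc_cons z r y).symm
    change _ = M 0 ((Fin.cons x (Fin.cons z r : Fin (k + 1) → ι) : Fin (k + 2) → ι) 0)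
      ((Fin.snoc (Fin.cons z r : Fin (k + 1) → ι) y : Fin (k + 2) → ι) 0) *
      ∏ i : Fin (k + 1), M i.succ ((Fin.cons x (Fin.cons z r : Fin (k + 1) → ι) : Fin (k + 2) → ι) i.succ)
      ((Fin.snoc (Fin.cons z r : Fin (k + 1) → ι) y : Fin (k + 2) → ι) i.succ)
    rw [h1]
    simp only [Fin.cons_zero, Fin.cons_succ]

/-- permutation matrix on tuples -/
def permM (K ι : Type) [Field K] [DecidableEq ι] {k : ℕ} (τ : Equiv.Perm (Fin k)) :
    Matrix (Fin k → ι) (Fin k → ι) K :=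
  Matrix.of fun r s => if r = s ∘ τ then 1 else 0

theorem permM_mul {k : ℕ} (τ τ' : Equiv.Perm (Fin k)) :
    permM K ι τ * permM K ι τ' = permM K ι (τ' * τ) := by
  ext r u
  rw [Matrix.mul_apply, Finset.sum_eq_single (u ∘ τ')]
  · have hc : u ∘ (τ' * τ : Equiv.Perm _) = (u ∘ τ') ∘ τ := rfl
    simp only [permM, Matrix.of_apply, if_true, mul_one, hc]
  · intro s _ hs
    simp [permM, hs]
  · simp

theorem permM_one {k : ℕ} : permM K ι (1 : Equiv.Perm (Fin k)) = 1 := by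
  ext r u
  simp [permM, Matrix.one_apply]

theorem permM_pow {k : ℕ} (τ : Equiv.Perm (Fin k)) (j : ℕ) :
    permM K ι τ ^ j = permM K ι (τ ^ j) := by
  induction j with
  | zero => rw [pow_zero, pow_zero, permM_one]
  | succ j ih => rw [pow_succ, ih, permM_mul, pow_succ']

theorem permM_trace {k : ℕ} (τ : Equiv.Perm (Fin k)) :
    (permM K ι τ).trace = (Finset.univ.filter fun r : Fin k → ι => r = r ∘ τ).card := by
  simp [permM, Matrix.trace]

theorem trace_permM_kron (k : ℕ) (M : Fin (k + 1) → Matrix ι ι K) :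
    (permM K ι (finRotate (k + 1)) * kron K ι (k + 1) M).trace = (List.ofFn M).prod.trace := by
  have h1 : (permM K ι (finRotate (k + 1)) * kron K ι (k + 1) M).trace =
      ∑ s : Fin (k + 1) → ι, ∏ i, M i (s i) (s (finRotate _ i)) := by
    rw [Matrix.trace_mul_comm, Matrix.trace]
    refine Finset.sum_congr rfl fun s _ => ?_
    rw [Matrix.diag_apply, Matrix.mul_apply, Finset.sum_eq_single (s ∘ finRotate (k + 1))]
    · simp [permM, kron_apply]
    · intro r _ hr
      simp [permM, hr]
    · simp
  rw [h1, Matrix.trace, ← (Fin.consEquiv (fun _ : Fin (k + 1) => ι)).sum_comp,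
    Fintype.sum_prod_type]
  refine Finset.sum_congr rfl fun x _ => ?_
  rw [Matrix.diag_apply, path_prod]
  refine Finset.sum_congr rfl fun r _ => ?_
  refine Finset.prod_congr rfl fun i _ => ?_
  rw [Fin.snoc_eq_cons_rotate]
  rfl

theorem finRotate_fixed_card (l : ℕ) (hl : l.Prime) (d j : ℕ) (hj : 0 < j) (hjl : j < l) :
    (Finset.univ.filter fun r : Fin l → Fin d => r = r ∘ ((finRotate l) ^ j : Equiv.Perm _)).card
      = d := by
  obtain ⟨k, rfl⟩ : ∃ k, l = k + 1 := ⟨l - 1, by have := hl.pos; omega⟩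
  have hord : (finRotate (k + 1)) ^ (k + 1) = 1 := by
    have h2 := (isCycle_finRotate_of_le hl.two_le).orderOf
    rw [support_finRotate_of_le hl.two_le, Finset.card_univ, Fintype.card_fin] at h2
    have := pow_orderOf_eq_one (finRotate (k + 1))
    rwa [h2] at this
  have hcop : Nat.Coprime j (k + 1) := by
    rw [Nat.coprime_comm, hl.coprime_iff_not_dvd]
    intro h
    exact absurd (Nat.le_of_dvd hj h) (by omega)
  obtain ⟨u, -, hu⟩ := Nat.exists_mul_mod_eq_one_of_coprime hcop hl.one_lt
  have hpow : ((finRotate (k + 1)) ^ j) ^ u = finRotate (k + 1) := by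
    rw [← pow_mul, ← Nat.div_add_mod (j * u) (k + 1), hu, pow_add, pow_mul, hord, one_pow, one_mul,
      pow_one]
  have key : (Finset.univ.filter fun r : Fin (k + 1) → Fin d =>
      r = r ∘ ((finRotate (k + 1)) ^ j : Equiv.Perm _)) =
      Finset.univ.image (fun x : Fin d => (fun _ => x : Fin (k + 1) → Fin d)) := by
    ext r
    simp only [Finset.mem_filter, Finset.mem_univ, true_and, Finset.mem_image]
    constructor
    · intro hr
      have h1 : ∀ w : ℕ, r = r ∘ (((finRotate (k + 1)) ^ j) ^ w : Equiv.Perm _) := by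
        intro w
        induction w with
        | zero => rfl
        | succ w ih =>
          rw [pow_succ, Equiv.Perm.coe_mul, ← Function.comp_assoc, ← ih]; exact hr
      have h2 := h1 u
      rw [hpow] at h2
      refine ⟨r 0, ?_⟩
      have h3 : ∀ w (hw : w < k + 1), r ⟨w, hw⟩ = r 0 := by
        intro w
        induction w with
        | zero => intro hw; rfl
        | succ w ih =>
          intro hw
          rw [← ih (by omega)]
          have h4 := congrFun h2 ⟨w, by omega⟩
          rw [h4, Function.comp_apply, finRotate_of_lt (by omega)]
      funext i
      exact (h3 i i.2).symm
    · rintro ⟨x, rfl⟩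
      rfl
  rw [key, Finset.card_image_of_injective, Finset.card_univ, Fintype.card_fin]
  intro x y hxy
  exact congrFun hxy 0

end Path

section SmallModule

variable {F K D : Type} [Field F] [CharZero F] [Field K] [Algebra F K] [Ring D] [Algebra F D]

theorem SplitForm.small_module {d : ℕ} {ψ : D →ₐ[F] Matrix (Fin d) (Fin d) K} (h : SplitForm ψ)
    (l : ℕ) (hl : l.Prime) :
    ∃ V : Submodule F (⨂[F] (_ : Fin l), D), ∃ _ : (⨂[F] (_ : Fin l), D) →ₐ[F] Module.End F V,
      l * Module.finrank F V = d ^ l * (d ^ l + (l - 1) * d) := by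
  have hB := h.tensorPower l
  haveI := h.finiteDimensional
  haveI : CharZero K := charZero_of_injective_algebraMap (algebraMap F K).injective
  have hl0 : (l : F) ≠ 0 := Nat.cast_ne_zero.2 hl.ne_zero
  haveI hBfd := hB.finiteDimensional
  have hd0 : (d : K) ≠ 0 := by
    obtain ⟨i⟩ := h.nonempty
    exact Nat.cast_ne_zero.2 (by have := i.2; omega)
  obtain ⟨t, ht⟩ := hB.mem_range (permM K (Fin d) (finRotate l)) (by
    obtain ⟨k, rfl⟩ : ∃ k, l = k + 1 := ⟨l - 1, by have := hl.pos; omega⟩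
    intro b
    induction b using PiTensorProduct.induction_on with
    | smul_tprod r x =>
      refine ⟨r * ((d : F)⁻¹ * LinearMap.trace F D (LinearMap.mulRight F (List.ofFn x).prod)), ?_⟩
      have h1 := h.trace_mulRight (List.ofFn x).prod
      rw [map_smul, rhoPow_tprod, mul_smul_comm, Matrix.trace_smul, trace_permM_kron, map_mul,
        map_mul, h1, map_inv₀, map_natCast, Fintype.card_fin, ← mul_assoc (d : K)⁻¹,
        inv_mul_cancel₀ hd0, one_mul, map_list_prod, List.map_ofFn, Algebra.smul_def]
      rfl
    | add x y hx hy =>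
      obtain ⟨r, hr⟩ := hx
      obtain ⟨s, hs⟩ := hy
      exact ⟨r + s, by rw [map_add, mul_add, Matrix.trace_add, hr, hs, map_add]⟩)
  set e : ⨂[F] (_ : Fin l), D := (l : F)⁻¹ • ∑ j ∈ Finset.range l, t ^ j with he
  have htl : t ^ l = 1 := by
    apply hB.injective
    rw [map_pow, ht, permM_pow, map_one]
    have h2 := (isCycle_finRotate_of_le hl.two_le).orderOf
    rw [support_finRotate_of_le hl.two_le, Finset.card_univ, Fintype.card_fin] at h2
    have := pow_orderOf_eq_one (finRotate l)
    rw [h2] at this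
    rw [this, permM_one]
  have hte : t * e = e := by
    rw [he, mul_smul_comm, Finset.mul_sum]
    congr 1
    have h1 := Finset.sum_range_succ' (fun j => t ^ j) l
    rw [Finset.sum_range_succ, htl, pow_zero] at h1
    rw [add_right_cancel h1]
    refine Finset.sum_congr rfl fun j _ => ?_
    rw [pow_succ']
  have htje : ∀ j, t ^ j * e = e := by
    intro j
    induction j with
    | zero => rw [pow_zero, one_mul]
    | succ j ih => rw [pow_succ, mul_assoc, hte, ih]
  have hee : e * e = e := by
    conv_lhs => rw [he]
    rw [smul_mul_assoc, Finset.sum_mul, Finset.sum_congr rfl fun j _ => htje j]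
    rw [Finset.sum_const, Finset.card_range, ← Nat.cast_smul_eq_nsmul F, smul_smul,
      inv_mul_cancel₀ hl0, one_smul]
  let V := LinearMap.range (LinearMap.mulRight F e)
  have hmem : ∀ x, x ∈ V ↔ x * e = x := by
    intro x
    constructor
    · rintro ⟨y, rfl⟩
      rw [LinearMap.mulRight_apply, mul_assoc, hee]
    · intro hx; exact ⟨x, hx⟩
  have hproj : LinearMap.IsProj V (LinearMap.mulRight F e) :=
    ⟨fun x => ⟨x, rfl⟩, fun x hx => (hmem x).1 hx⟩
  refine ⟨V, ?_, ?_⟩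
  · have hst : ∀ a, ∀ x ∈ V, LinearMap.mulLeft F a x ∈ V := by
      intro a x hx
      rw [hmem] at *
      rw [LinearMap.mulLeft_apply, mul_assoc, hx]
    exact
    { toFun := fun a => (LinearMap.mulLeft F a).restrict (hst a)
      map_one' := by refine LinearMap.ext fun x => ?_; apply Subtype.ext; simp
      map_mul' := fun a b => by
        refine LinearMap.ext fun x => ?_; apply Subtype.ext; simp [mul_assoc]
      map_zero' := by refine LinearMap.ext fun x => ?_; apply Subtype.ext; simp
      map_add' := fun a b => by
        refine LinearMap.ext fun x => ?_; apply Subtype.ext; simp [add_mul]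
      commutes' := fun r => by
        refine LinearMap.ext fun x => ?_; apply Subtype.ext; simp [Algebra.algebraMap_eq_smul_one] }
  · have h1 := hproj.trace
    have h2 := hB.trace_mulRight e
    rw [h1, map_natCast] at h2
    have h3 : (l : K) * (rhoPow ψ l e).trace = d ^ l + (l - 1) * d := by
      rw [he, map_smul, map_sum, Matrix.trace_smul, Matrix.trace_sum, Algebra.smul_def, map_inv₀,
        map_natCast, mul_inv_cancel_left₀ (Nat.cast_ne_zero.2 hl.ne_zero)]
      have h4 : ∀ j ∈ Finset.range l, (rhoPow ψ l (t ^ j)).trace =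
          if j = 0 then ((d : K) ^ l) else (d : K) := by
        intro j hj
        rw [Finset.mem_range] at hj
        rw [map_pow, ht, permM_pow]
        split_ifs with h0
        · rw [h0, pow_zero, permM_one, Matrix.trace_one]; simp
        · rw [permM_trace, finRotate_fixed_card l hl d j (Nat.pos_of_ne_zero h0) hj]
      rw [Finset.sum_congr rfl h4]
      obtain ⟨k, rfl⟩ : ∃ k, l = k + 1 := ⟨l - 1, by have := hl.pos; omega⟩
      rw [Finset.sum_range_succ']
      simp [add_comm]
    have h5 : ((l * Module.finrank F V : ℕ) : K) = ((d ^ l * (d ^ l + (l - 1) * d) : ℕ) : K) := by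
      push_cast [Nat.cast_sub hl.one_le]
      rw [h2, ← h3]
      simp
      ring
    exact_mod_cast h5

end SmallModule


open scoped TensorProduct

section Commuting

variable {F A B : Type} [Field F] [Ring A] [Algebra F A] [Ring B] [Algebra F B]

theorem list_prod_commuting (k : ℕ) (φ : Fin k → A →ₐ[F] B)
    (hφ : ∀ i j, i ≠ j → ∀ x y, Commute (φ i x) (φ j y)) (x y : Fin k → A) :
    (List.ofFn fun i => φ i (x i * y i)).prod =
      (List.ofFn fun i => φ i (x i)).prod * (List.ofFn fun i => φ i (y i)).prod := by
  induction k with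
  | zero => simp
  | succ k ih =>
    simp only [List.ofFn_succ, List.prod_cons]
    rw [ih (fun i => φ i.succ) (fun i j hij => hφ _ _ (by simpa using hij))
      (fun i => x i.succ) (fun i => y i.succ), map_mul]
    have hc : Commute (φ 0 (y 0)) (List.ofFn fun i : Fin k => φ i.succ (x i.succ)).prod := by
      apply Commute.list_prod_right
      intro z hz
      rw [List.mem_ofFn'] at hz
      obtain ⟨i, rfl⟩ := hz
      exact hφ _ _ (Fin.succ_ne_zero i).symm _ _
    simp only [mul_assoc]
    rw [← mul_assoc (φ 0 (y 0)), hc.eq, mul_assoc]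

/-- algebra map out of a tensor power from a commuting family -/
noncomputable def commutingLift (k : ℕ) (φ : Fin k → A →ₐ[F] B)
    (hφ : ∀ i j, i ≠ j → ∀ x y, Commute (φ i x) (φ j y)) :
    (⨂[F] (_ : Fin k), A) →ₐ[F] B :=
  PiTensorProduct.liftAlgHom
    ((MultilinearMap.mkPiAlgebraFin F k B).compLinearMap (fun i => (φ i).toLinearMap))
    (by
      rw [MultilinearMap.compLinearMap_apply, MultilinearMap.mkPiAlgebraFin_apply]
      simp)
    (fun x y => by
      simp only [MultilinearMap.compLinearMap_apply, MultilinearMap.mkPiAlgebraFin_apply]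
      exact list_prod_commuting k φ hφ x y)

theorem single_commute (k : ℕ) (i j : Fin k) (hij : i ≠ j) (x y : A) :
    Commute (PiTensorProduct.singleAlgHom (R := F) (A := fun _ : Fin k => A) i x)
      (PiTensorProduct.singleAlgHom (R := F) (A := fun _ : Fin k => A) j y) := by
  rw [Commute, SemiconjBy, PiTensorProduct.singleAlgHom_apply, PiTensorProduct.singleAlgHom_apply,
    PiTensorProduct.tprod_mul_tprod, PiTensorProduct.tprod_mul_tprod]
  congr 1
  exact (Pi.mulSingle_commute (f := fun _ : Fin k => A) hij x y).eq

end Commuting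

section Decomp

variable {F D D₁ D₂ : Type} [Field F] [CharZero F] [Ring D] [Algebra F D] [DivisionRing D₁]
  [DivisionRing D₂] [Algebra F D₁] [Algebra F D₂]

theorem tensor_power_hom (e : D →ₐ[F] (D₁ ⊗[F] D₂)) (k : ℕ) :
    Nonempty ((⨂[F] (_ : Fin k), D) →ₐ[F]
      ((⨂[F] (_ : Fin k), D₁) ⊗[F] (⨂[F] (_ : Fin k), D₂))) := by
  let φ : Fin k → D →ₐ[F] ((⨂[F] (_ : Fin k), D₁) ⊗[F] (⨂[F] (_ : Fin k), D₂)) := fun i =>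
    (Algebra.TensorProduct.map (PiTensorProduct.singleAlgHom (R := F) (A := fun _ : Fin k => D₁) i)
      (PiTensorProduct.singleAlgHom (R := F) (A := fun _ : Fin k => D₂) i)).comp e
  refine ⟨commutingLift k φ fun i j hij x y => ?_⟩
  simp only [φ, AlgHom.comp_apply]
  generalize e x = X
  generalize e y = Y
  induction X with
  | zero => rw [map_zero]; exact Commute.zero_left _
  | add a b ha hb => rw [map_add]; exact ha.add_left hb
  | tmul a b =>
    induction Y with
    | zero => rw [map_zero]; exact Commute.zero_right _
    | add a b ha hb => rw [map_add]; exact ha.add_right hb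
    | tmul c d =>
      rw [Algebra.TensorProduct.map_tmul, Algebra.TensorProduct.map_tmul, Commute, SemiconjBy,
        Algebra.TensorProduct.tmul_mul_tmul, Algebra.TensorProduct.tmul_mul_tmul,
        (single_commute k i j hij a c).eq, (single_commute k i j hij b d).eq]

theorem decomp_contra [FiniteDimensional F D₁] [FiniteDimensional F D₂]
    (h₁ : Subalgebra.center F D₁ = ⊥) (h₂ : Subalgebra.center F D₂ = ⊥)
    (g₁ : 1 < Module.finrank F D₁) (g₂ : 1 < Module.finrank F D₂)
    (e : D ≃ₐ[F] (D₁ ⊗[F] D₂)) (l : ℕ) (hl : l.Prime) (b : ℕ)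
    (hD : Module.finrank F D = l ^ (2 * b))
    (hmod : ∀ (V : Type) [AddCommGroup V] [Module F V] [FiniteDimensional F V]
      (_ : (⨂[F] (_ : Fin l), D) →ₐ[F] Module.End F V),
      (l ^ b) ^ l * l ^ (b - 1) ∣ Module.finrank F V) : False := by
  obtain ⟨d₁, ψ₁, s₁⟩ := exists_splitForm h₁
  obtain ⟨d₂, ψ₂, s₂⟩ := exists_splitForm h₂
  obtain ⟨V₁, φ₁, e₁⟩ := s₁.small_module l hl
  obtain ⟨V₂, φ₂, e₂⟩ := s₂.small_module l hl
  obtain ⟨f⟩ := tensor_power_hom e.toAlgHom l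
  have f₁ := s₁.finrank
  have f₂ := s₂.finrank
  rw [Fintype.card_fin] at f₁ f₂
  rw [f₁] at g₁
  rw [f₂] at g₂
  have hprod : d₁ * d₂ = l ^ b := by
    have := e.toLinearEquiv.finrank_eq
    rw [Module.finrank_tensorProduct, f₁, f₂, hD, ← mul_pow, mul_comm 2 b, pow_mul] at this
    exact (Nat.pow_left_injective (n := 2) (by norm_num) this).symm
  haveI := (s₁.tensorPower l).finiteDimensional
  haveI := (s₂.tensorPower l).finiteDimensional
  have hdvd := hmod (V₁ ⊗[F] V₂)
    ((Module.endTensorEndAlgHom (R := F) (S := F) (A := F) (M := V₁) (N := V₂)).comp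
      ((Algebra.TensorProduct.map φ₁ φ₂).comp f))
  rw [Module.finrank_tensorProduct] at hdvd
  have hd₁ : l ∣ d₁ := by
    obtain ⟨k, -, hk⟩ := (Nat.dvd_prime_pow hl).1 (Dvd.intro _ hprod)
    rcases k with _ | k
    · rw [hk] at g₁; simp at g₁
    · rw [hk]; exact dvd_pow_self _ (by omega)
  have hd₂ : l ∣ d₂ := by
    obtain ⟨k, -, hk⟩ := (Nat.dvd_prime_pow hl).1 (Dvd.intro_left _ hprod)
    rcases k with _ | k
    · rw [hk] at g₂; simp at g₂
    · rw [hk]; exact dvd_pow_self _ (by omega)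
  have hb : 1 ≤ b := by
    by_contra hb
    have hb0 : b = 0 := by omega
    rw [hb0, pow_zero] at hprod
    rw [Nat.eq_one_of_mul_eq_one_right hprod] at g₁
    simp at g₁
  have key : (l ^ b) ^ l * (l ^ b * l) ∣ (l ^ b) ^ l * (l ^ b *
      ((d₁ ^ (l - 1) + (l - 1)) * (d₂ ^ (l - 1) + (l - 1)))) := by
    have h1 : (l ^ b) ^ l * (l ^ b * l) = l * l * ((l ^ b) ^ l * l ^ (b - 1)) := by
      obtain ⟨c, rfl⟩ : ∃ c, b = c + 1 := ⟨b - 1, by omega⟩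
      rw [Nat.add_sub_cancel, pow_succ l c]; ring
    have h2 : (l ^ b) ^ l * (l ^ b *
      ((d₁ ^ (l - 1) + (l - 1)) * (d₂ ^ (l - 1) + (l - 1)))) =
      l * l * (Module.finrank F V₁ * Module.finrank F V₂) := by
      have : l * l * (Module.finrank F V₁ * Module.finrank F V₂) =
        (l * Module.finrank F V₁) * (l * Module.finrank F V₂) := by ring
      rw [this, e₁, e₂, ← hprod]
      have h3 : ∀ d : ℕ, d ^ l + (l - 1) * d = d * (d ^ (l - 1) + (l - 1)) := by
        intro d
        rw [mul_add, ← pow_succ', Nat.sub_add_cancel hl.one_le, mul_comm d (l - 1)]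
      rw [h3, h3, mul_pow]
      ring
    rw [h1, h2]
    exact Nat.mul_dvd_mul_left _ hdvd
  have hlp : 0 < l ^ b := pow_pos hl.pos b
  have k1 := Nat.dvd_of_mul_dvd_mul_left (pow_pos hlp l) key
  have k2 := Nat.dvd_of_mul_dvd_mul_left hlp k1
  have hl2 := hl.two_le
  have k3 : ∀ d, l ∣ d → ¬ l ∣ d ^ (l - 1) + (l - 1) := by
    intro d hd h
    have h1 : l ∣ d ^ (l - 1) := dvd_pow hd (by omega)
    have h2 := (Nat.dvd_add_right h1).1 h
    have := Nat.le_of_dvd (by omega) h2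
    omega
  rcases (hl.dvd_mul).1 k2 with h | h
  · exact k3 _ hd₁ h
  · exact k3 _ hd₂ h

end Decomp


open scoped TensorProduct

theorem final_of_arith {F : Type} [Field F] [CharZero F] (l : ℕ) (hl : l.Prime) (a b : ℕ)
    (ha : 1 ≤ a) (hab : a ≤ b) (hb : b ≤ 2 * a - 1)
    {L : Type} [Field L] [Algebra F L] (σ : L ≃ₐ[F] L) (hd : CycData F L σ (l ^ b))
    {Γ₁ Γ₂ : Type} [LinearOrderedCommGroupWithZero Γ₁] [LinearOrderedCommGroupWithZero Γ₂]
    (v : Valuation L Γ₁) (ν : Valuation L Γ₂)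
    (hcoarse : ∀ x y, v x < v y → ν x < ν y) (hvσ : ∀ x, v (σ x) = v x)
    (hνσ : ∀ x, ν ((σ ^ (l ^ (b - a))) x) = ν x) (c : F) (hc : c ≠ 0)
    (hv : ∀ (g : L) (i : ℕ), v (g ^ (l ^ b)) = v (algebraMap F L c ^ i) → l ^ a ∣ i)
    (hν : ∀ (g : L) (i : ℕ), ν (g ^ (l ^ b)) = ν (algebraMap F L c ^ i) → l ^ b ∣ i)
    (hh : L) (hhe : (σ ^ (l ^ (b - a))) hh = hh)
    (hhc : algebraMap F L c = ∏ i ∈ Finset.range (l ^ (b - a)), (σ ^ i) hh) :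
    ∃ D : CentralDivisionAlgebra F,
      BrauerClassHasOrder F D.carrier (l ^ a) ∧
      Module.finrank F D.carrier = l ^ (2 * b) ∧
      IsIndecomposableDivisionAlgebra F D.carrier := by
  haveI : NeZero (l ^ b) := ⟨hd.pos.ne'⟩
  have hνk : ∀ k x, ν ((σ ^ (l ^ (b - a) * k)) x) = ν x := by
    intro k
    induction k with
    | zero => intro x; simp
    | succ k ih => intro x; rw [mul_add, mul_one, pow_add, AlgEquiv.mul_apply, ih, hνσ]
  have hνm : ∀ j, b - a ≤ j → ∀ x, ν ((σ ^ (l ^ j)) x) = ν x := by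
    intro j hj x
    have := hνk (l ^ (j - (b - a))) x
    rwa [← pow_add, Nat.add_sub_cancel' hj] at this
  have hdom : ∀ X Y : cycAlg σ (l ^ b) c, X * Y = 0 → X = 0 ∨ Y = 0 :=
    cycAlg_domain σ (l ^ b) (l ^ a) c hc hd.pow_eq v ν hcoarse hvσ (hνm a (by omega)) hv hν
  haveI := cycAlg_finiteDimensional σ (l ^ b) c hd
  haveI : NoZeroDivisors (cycAlg σ (l ^ b) c) := ⟨fun {a b} => hdom a b⟩
  haveI : IsDomain (cycAlg σ (l ^ b) c) := NoZeroDivisors.to_isDomain _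
  have htw := cycAlg_twForm σ (l ^ b) c hc hd
  have hord : BrauerClassHasOrder F (cycAlg σ (l ^ b) c) (l ^ a) := by
    refine ⟨pow_pos hl.pos a, ?_, ?_⟩
    · have h1 := htw.tensorPower (l ^ a)
      refine ⟨Fintype.card (Fin (l ^ a) → Fin (l ^ b)), Fintype.card_pos, ?_⟩
      refine h1.split_of_norm hd hh ?_
      have hk : ∀ k, ∏ i ∈ Finset.range (l ^ (b - a) * k), (σ ^ i) hh =
          (∏ i ∈ Finset.range (l ^ (b - a)), (σ ^ i) hh) ^ k := by
        intro k
        induction k with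
        | zero => simp
        | succ k ih =>
          rw [mul_add, mul_one, Finset.prod_range_add, ih, pow_succ]
          congr 1
          refine Finset.prod_congr rfl fun i _ => ?_
          rw [add_comm, pow_add, AlgEquiv.mul_apply]
          congr 1
          clear ih
          induction k with
          | zero => simp
          | succ k ih => rw [mul_add, mul_one, pow_add, AlgEquiv.mul_apply, hhe, ih]
      have h2 := hk (l ^ a)
      rw [← pow_add, Nat.sub_add_cancel hab] at h2
      rw [map_pow, h2, hhc]
    · rintro k hk0 hkm ⟨N, hN, ⟨f⟩⟩
      have h1 := htw.tensorPower k
      obtain ⟨g, hg⟩ := h1.norm_of_split hd.pow_eq N f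
      have h2 : ∀ i x, v ((σ ^ i) x) = v x := by
        intro i
        induction i with
        | zero => intro x; rfl
        | succ i ih => intro x; rw [pow_succ', AlgEquiv.mul_apply, hvσ, ih]
      have h3 : v (g ^ (l ^ b)) = v (algebraMap F L c ^ k) := by
        rw [← map_pow (algebraMap F L), hg, map_prod,
          Finset.prod_congr rfl (fun i _ => h2 i g), Finset.prod_const, Finset.card_range,
          map_pow]
      have := Nat.le_of_dvd hk0 (hv g k h3)
      omega
  have hfin : Module.finrank F (cycAlg σ (l ^ b) c) = l ^ (2 * b) := by
    rw [cycAlg_finrank σ (l ^ b) c hd, ← pow_mul, mul_comm]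
  refine ⟨@CentralDivisionAlgebra.mk F _ (cycAlg σ (l ^ b) c)
    (divisionRingOfFiniteDimensional F _) _ inferInstance (cycAlg_center σ (l ^ b) c hc hd),
    hord, hfin, ?_⟩
  intro D₁ D₂ _ _ _ _ fd₁ fd₂ c₁ c₂ g₁ g₂
  constructor
  intro e
  haveI := fd₁
  haveI := fd₂
  refine decomp_contra (D := cycAlg σ (l ^ b) c) c₁ c₂ g₁ g₂ e l hl b hfin ?_
  intro V _ _ _ φ
  obtain ⟨b', rfl⟩ : ∃ b', b = b' + 1 := ⟨b - 1, by omega⟩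
  obtain ⟨a', rfl⟩ : ∃ a', a = a' + 1 := ⟨a - 1, by omega⟩
  have h1 := htw.tensorPower l
  have hpb : l ^ (b' + 1) = l * l ^ b' := by rw [pow_succ']
  have hpa : l ^ (a' + 1) = l * l ^ a' := by rw [pow_succ']
  have hd' : CycData F L σ (l * l ^ b') := by rw [← hpb]; exact hd
  have h1' : TwForm σ (l * l ^ b') (c ^ l) (rhoPow (cycAlg σ (l ^ (b' + 1)) c).val l)
      (kron L (Fin (l ^ (b' + 1))) l fun _ => cycP L (l ^ (b' + 1)) c) := by
    have h2 : ∀ N, N = l ^ (b' + 1) → TwForm σ N (c ^ l)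
        (rhoPow (cycAlg σ (l ^ (b' + 1)) c).val l)
      (kron L (Fin (l ^ (b' + 1))) l fun _ => cycP L (l ^ (b' + 1)) c) := by
      rintro N rfl; exact h1
    exact h2 _ hpb.symm
  have := TwForm.dvd_module (m' := l ^ a') hc hd' v ν hcoarse hvσ (hνm a' (by omega))
    (by rw [← hpb, ← hpa]; exact hv) (by rw [← hpb]; exact hν) h1' φ
  simpa using this


theorem ff_kummer (κ : Type) [Field κ] [Finite κ] (l b : ℕ) (hl : l.Prime) (hb : 1 ≤ b)
    (z : κ) (hz : IsPrimitiveRoot z (l ^ b)) :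
    ∃ t : κ, t ≠ 0 ∧ Irreducible (Polynomial.X ^ (l ^ b) - Polynomial.C t) := by
  classical
  cases nonempty_fintype κ
  obtain ⟨g, hg⟩ := IsCyclic.exists_generator (α := κˣ)
  set n := l ^ b with hn
  have hn0 : n ≠ 0 := (pow_pos hl.pos b).ne'
  have hn2 : 1 < n := Nat.one_lt_pow (by omega) hl.one_lt
  set q := Fintype.card κ with hq
  have hq1 : 1 < q := Fintype.one_lt_card
  have hcardu : Fintype.card κˣ = q - 1 := Fintype.card_units κ
  have hog : orderOf g = q - 1 := by
    rw [orderOf_eq_card_of_forall_mem_zpowers hg, Nat.card_eq_fintype_card, hcardu]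
  have hndvd : n ∣ q - 1 := by
    have h1 : z ^ (q - 1) = 1 := FiniteField.pow_card_sub_one_eq_one z (hz.ne_zero hn0)
    exact hz.dvd_of_pow_eq_one _ h1
  have hldvd : l ∣ q - 1 := (dvd_pow_self l (by omega)).trans hndvd
  refine ⟨(g : κ), g.ne_zero, ?_⟩
  set f : Polynomial κ := Polynomial.X ^ n - Polynomial.C (g : κ) with hf
  have hfd : f.natDegree = n := Polynomial.natDegree_X_pow_sub_C
  have hfm : f.Monic := Polynomial.monic_X_pow_sub_C _ hn0
  obtain ⟨β, hβ⟩ := IsAlgClosed.exists_aeval_eq_zero (AlgebraicClosure κ) f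
    (by rw [Polynomial.degree_eq_natDegree hfm.ne_zero, hfd]; exact_mod_cast hn0)
  have hβn : β ^ n = algebraMap κ _ (g : κ) := by
    have := hβ
    simp only [hf, map_sub, map_pow, Polynomial.aeval_X, Polynomial.aeval_C] at this
    exact sub_eq_zero.1 this
  have hβ0 : β ≠ 0 := by
    rintro rfl
    rw [zero_pow hn0] at hβn
    exact g.ne_zero ((algebraMap κ (AlgebraicClosure κ)).injective (by rw [← hβn, map_zero]))
  have hIntg : IsIntegral κ β := Algebra.IsIntegral.isIntegral β
  set d := (minpoly κ β).natDegree with hd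
  have hdpos : 0 < d := minpoly.natDegree_pos hIntg
  have hdvd : minpoly κ β ∣ f := minpoly.dvd _ _ hβ
  -- β^(q^d) = β
  have hβq : β ^ (q ^ d) = β := by
    haveI : FiniteDimensional κ (IntermediateField.adjoin κ {β}) :=
      IntermediateField.adjoin.finiteDimensional hIntg
    haveI : Finite (IntermediateField.adjoin κ {β}) := Module.finite_of_finite κ
    cases nonempty_fintype (IntermediateField.adjoin κ {β})
    have hc : Fintype.card (IntermediateField.adjoin κ {β}) = q ^ d := by
      rw [Module.card_eq_pow_finrank (K := κ), IntermediateField.adjoin.finrank hIntg]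
    have := FiniteField.pow_card (⟨β, IntermediateField.mem_adjoin_simple_self κ β⟩ :
      IntermediateField.adjoin κ {β})
    rw [hc] at this
    simpa using congrArg Subtype.val this
  set η := β ^ (q - 1) with hη
  have hS : (q - 1) * ∑ i ∈ Finset.range d, q ^ i + 1 = q ^ d := by
    have := Nat.geomSum_eq (m := q) (by omega) d
    have h2 : (q - 1) * ∑ i ∈ Finset.range d, q ^ i = q ^ d - 1 := by
      have h3 := mul_geom_sum (q - 1 + 1 : ℤ) d
      zify [Nat.one_le_pow d q (by omega), hq1.le]
      simpa using h3
    rw [h2]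
    exact Nat.sub_add_cancel (Nat.one_le_pow d q (by omega))
  have hηS : η ^ (∑ i ∈ Finset.range d, q ^ i) = 1 := by
    rw [hη, ← pow_mul]
    have : β ^ ((q - 1) * ∑ i ∈ Finset.range d, q ^ i) * β = 1 * β := by
      rw [← pow_succ, hS, hβq, one_mul]
    exact mul_right_cancel₀ hβ0 this
  obtain ⟨b', rfl⟩ : ∃ b', b = b' + 1 := ⟨b - 1, by omega⟩
  have hord : orderOf η = n := by
    haveI := Fact.mk hl
    refine orderOf_eq_prime_pow ?_ ?_
    · intro h
      obtain ⟨r, hr⟩ := hldvd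
      have h1 : β ^ (n * r) = 1 := by
        rw [← h, hη, ← pow_mul, hr, hn, pow_succ]
        congr 1; ring
      rw [pow_mul, hβn, ← map_pow] at h1
      have h2 : (g : κ) ^ r = 1 := (algebraMap κ (AlgebraicClosure κ)).injective (by rw [h1, map_one])
      have h3 : g ^ r = 1 := by ext; simpa using h2
      have h4 := orderOf_dvd_of_pow_eq_one h3
      rw [hog] at h4
      have hr0 : 0 < r := by
        rcases Nat.eq_zero_or_pos r with rfl | h; · omega
        · exact h
      have := Nat.le_of_dvd hr0 h4
      have := hl.two_le
      nlinarith
    · show η ^ n = 1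
      rw [hη, ← pow_mul, mul_comm, pow_mul, hβn, ← map_pow,
        FiniteField.pow_card_sub_one_eq_one _ g.ne_zero, map_one]
  have hnS : n ∣ ∑ i ∈ Finset.range d, q ^ i := by
    rw [← hord]; exact orderOf_dvd_of_pow_eq_one hηS
  have hnd : n ∣ d := by
    have h1 : q ≡ 1 [MOD n] := ((Nat.modEq_iff_dvd' hq1.le).2 hndvd).symm
    have h2 : ∑ i ∈ Finset.range d, q ^ i ≡ ∑ i ∈ Finset.range d, 1 [MOD n] := by
      rw [← ZMod.natCast_eq_natCast_iff] at h1 ⊢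
      push_cast
      rw [h1]; simp
    simp only [Finset.sum_const, Finset.card_range, smul_eq_mul, mul_one] at h2
    exact (Nat.modEq_zero_iff_dvd.1 (h2.symm.trans (Nat.modEq_zero_iff_dvd.2 hnS)))
  have : f = minpoly κ β := by
    refine (Polynomial.eq_of_monic_of_dvd_of_natDegree_le (minpoly.monic hIntg) hfm hdvd ?_)
    rw [hfd]; exact Nat.le_of_dvd hdpos hnd
  rw [this]
  exact minpoly.irreducible hIntg


/-- `ρ : A → D` is reduction modulo the regular element `ϖ`. -/
structure RedData {A D : Type} [CommRing A] [CommRing D] (ϖ : A) (ρ : A →+* D) : Prop where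
  nzd : ∀ a, ϖ * a = 0 → a = 0
  ker : ∀ a, ρ a = 0 → ∃ b, a = ϖ * b
  zero : ρ ϖ = 0

theorem RedData.exists_of_map {A D : Type} [CommRing A] [CommRing D] {ϖ : A}
    {ρ : A →+* D} (h : RedData ϖ ρ) (w : Polynomial A) (hw : w.map ρ = 0) :
    ∃ w', w = Polynomial.C ϖ * w' := by
  classical
  have : ∀ i, ∃ b, w.coeff i = ϖ * b := fun i => h.ker _ (by
    rw [← Polynomial.coeff_map, hw, Polynomial.coeff_zero])
  choose b hb using this
  refine ⟨∑ i ∈ w.support, Polynomial.monomial i (b i), ?_⟩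
  conv_lhs => rw [w.as_sum_support]
  rw [Finset.mul_sum]
  refine Finset.sum_congr rfl fun i _ => ?_
  rw [Polynomial.C_mul_monomial, ← hb]

theorem RedData.polynomial {A D : Type} [CommRing A] [CommRing D] {ϖ : A}
    {ρ : A →+* D} (h : RedData ϖ ρ) :
    RedData (Polynomial.C ϖ) (Polynomial.mapRingHom ρ) where
  nzd w hw := by
    ext i
    have := congrArg (fun q => Polynomial.coeff q i) hw
    simp only [Polynomial.coeff_C_mul, Polynomial.coeff_zero] at this
    simpa using h.nzd _ this
  ker w hw := h.exists_of_map w hw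
  zero := by simp [h.zero]

/-- Adjoining a root. -/
theorem RedData.adjoinRoot {A D D' : Type} [CommRing A] [CommRing D] [IsDomain D]
    [CommRing D'] {ϖ : A} {ρ : A →+* D} (h : RedData ϖ ρ)
    (hs : Function.Surjective ρ) (f : Polynomial A) (hf : f.map ρ ≠ 0) (τ : Polynomial D →+* D') (hτ0 : τ (f.map ρ) = 0)
    (hτ : ∀ g, τ g = 0 → ∃ g', g = f.map ρ * g') :
    ∃ ρ' : AdjoinRoot f →+* D', RedData (AdjoinRoot.of f ϖ) ρ' ∧
      ∀ g : Polynomial A, ρ' (AdjoinRoot.mk f g) = τ (g.map ρ) := by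
  let ρ' : AdjoinRoot f →+* D' := Ideal.Quotient.lift _ (τ.comp (Polynomial.mapRingHom ρ)) (by
    intro a ha
    obtain ⟨c, rfl⟩ := Ideal.mem_span_singleton.1 ha
    simp [hτ0])
  have hρ' : ∀ g : Polynomial A, ρ' (AdjoinRoot.mk f g) = τ (g.map ρ) := fun g => rfl
  refine ⟨ρ', ⟨?_, ?_, ?_⟩, hρ'⟩
  · intro a ha
    obtain ⟨u, rfl⟩ := AdjoinRoot.mk_surjective a
    rw [← AdjoinRoot.mk_C, ← map_mul, AdjoinRoot.mk_eq_zero] at ha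
    obtain ⟨w, hw⟩ := ha
    have h1 : f.map ρ * w.map ρ = 0 := by
      rw [← Polynomial.map_mul, ← hw, Polynomial.map_mul, Polynomial.map_C, h.zero]; simp
    have h2 := (mul_eq_zero.1 h1).resolve_left hf
    obtain ⟨w', rfl⟩ := h.exists_of_map w h2
    have h3 : Polynomial.C ϖ * (u - f * w') = 0 := by rw [mul_sub, hw]; ring
    have h4 := h.polynomial.nzd _ h3
    rw [AdjoinRoot.mk_eq_zero]
    exact ⟨w', sub_eq_zero.1 h4⟩
  · intro a ha
    obtain ⟨u, rfl⟩ := AdjoinRoot.mk_surjective a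
    rw [hρ'] at ha
    obtain ⟨g', hg'⟩ := hτ _ ha
    obtain ⟨g, rfl⟩ := Polynomial.map_surjective ρ hs g'
    obtain ⟨w, hw⟩ := h.exists_of_map (u - f * g) (by
      rw [Polynomial.map_sub, Polynomial.map_mul, hg', sub_self])
    refine ⟨AdjoinRoot.mk f w, ?_⟩
    rw [← AdjoinRoot.mk_C, ← map_mul, ← hw, map_sub, map_mul, AdjoinRoot.mk_self, zero_mul,
      sub_zero]
  · rw [← AdjoinRoot.mk_C, hρ', Polynomial.map_C, h.zero]; simp

/-- First layer: `Z + ϖ G`. -/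
theorem RedData.layer1 {A D : Type} [CommRing A] [CommRing D] [IsDomain D] {ϖ : A}
    {ρ : A →+* D} (h : RedData ϖ ρ) (hs : Function.Surjective ρ) (f : Polynomial A)
    (hf : f.map ρ = Polynomial.X) :
    ∃ ρ' : AdjoinRoot f →+* D, RedData (AdjoinRoot.of f ϖ) ρ' ∧ Function.Surjective ρ' ∧
      (∀ a, ρ' (AdjoinRoot.of f a) = ρ a) ∧ ρ' (AdjoinRoot.root f) = 0 := by
  obtain ⟨ρ', h1, h2⟩ := h.adjoinRoot hs f (by rw [hf]; exact Polynomial.X_ne_zero)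
    (Polynomial.evalRingHom 0) (by rw [hf]; simp) (by
      intro g hg
      rw [hf]
      refine Polynomial.X_dvd_iff.2 ?_
      rw [Polynomial.coeff_zero_eq_eval_zero]; exact hg)
  have h3 : ∀ a, ρ' (AdjoinRoot.of f a) = ρ a := by
    intro a; rw [← AdjoinRoot.mk_C, h2]; simp
  refine ⟨ρ', h1, ?_, h3, ?_⟩
  · intro d; obtain ⟨a, rfl⟩ := hs d; exact ⟨_, h3 a⟩
  · rw [← AdjoinRoot.mk_X, h2]; simp

open Polynomial in
/-- The kernel of `κ[T][X] → κ'[T]`. -/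
theorem layer2_ker {κ : Type} [Field κ] (t : κ) (n : ℕ) (hn : n ≠ 0)
    (τ : Polynomial (Polynomial κ) →+* Polynomial (AdjoinRoot (X ^ n - C t : Polynomial κ)))
    (hτ : τ = eval₂RingHom (mapRingHom (AdjoinRoot.of _)) (C (AdjoinRoot.root _)))
    (g : Polynomial (Polynomial κ)) (hg : τ g = 0) :
    ∃ g', g = (X ^ n - C (C t)) * g' := by
  have hmon : (X ^ n - C (C t) : Polynomial (Polynomial κ)).Monic := monic_X_pow_sub_C _ hn
  have h0 : τ (X ^ n - C (C t)) = 0 := by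
    have hr : (AdjoinRoot.root (X ^ n - C t : Polynomial κ)) ^ n = AdjoinRoot.of _ t := by
      have := AdjoinRoot.eval₂_root (X ^ n - C t : Polynomial κ)
      rw [eval₂_sub, eval₂_X_pow, eval₂_C, sub_eq_zero] at this
      exact this
    rw [hτ]
    simp [← C_pow, hr]
  have hdiv := modByMonic_add_div g (X ^ n - C (C t) : Polynomial (Polynomial κ))
  set r := g %ₘ (X ^ n - C (C t)) with hr
  have hrdeg : r.degree < n := by
    have := degree_modByMonic_lt g hmon
    rwa [degree_X_pow_sub_C (Nat.pos_of_ne_zero hn)] at this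
  have hr0 : τ r = 0 := by
    have := congrArg τ hdiv
    rw [map_add, map_mul, h0, zero_mul, add_zero, hg] at this
    exact this
  suffices r = 0 by
    rw [this, zero_add] at hdiv; exact ⟨_, hdiv.symm⟩
  -- swap
  have hco : ∀ j, (∑ i ∈ Finset.range n, C ((r.coeff i).coeff j) * X ^ i : Polynomial κ) = 0 := by
    intro j
    have h1 : AdjoinRoot.mk (X ^ n - C t : Polynomial κ)
        (∑ i ∈ Finset.range n, C ((r.coeff i).coeff j) * X ^ i : Polynomial κ) = 0 := by
      have h2 := congrArg (fun q => coeff q j) hr0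
      rw [hτ] at h2
      simp only [coe_eval₂RingHom, coeff_zero] at h2
      have hnd : r.natDegree < n := by
        rcases eq_or_ne r 0 with h | h
        · rw [h]; simpa using Nat.pos_of_ne_zero hn
        · exact (natDegree_lt_iff_degree_lt h).2 hrdeg
      rw [eval₂_eq_sum_range' _ hnd, finset_sum_coeff] at h2
      rw [map_sum, ← h2]
      refine Finset.sum_congr rfl fun i _ => ?_
      rw [← C_pow, coeff_mul_C, coe_mapRingHom, coeff_map, map_mul, map_pow, AdjoinRoot.mk_C,
        AdjoinRoot.mk_X]
    rw [AdjoinRoot.mk_eq_zero] at h1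
    by_contra hne
    have h3 := degree_le_of_dvd h1 hne
    rw [degree_X_pow_sub_C (Nat.pos_of_ne_zero hn)] at h3
    have h4 : (∑ i ∈ Finset.range n, C ((r.coeff i).coeff j) * X ^ i : Polynomial κ).degree
        < n := by
      refine (degree_sum_le _ _).trans_lt ?_
      rw [Finset.sup_lt_iff (by exact_mod_cast WithBot.bot_lt_coe n)]
      intro i hi
      exact (degree_C_mul_X_pow_le _ _).trans_lt (by exact_mod_cast Finset.mem_range.1 hi)
    exact absurd h4 (not_lt.2 h3)
  ext i j
  rw [coeff_zero, coeff_zero]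
  by_cases hi : i < n
  · have := congrArg (fun q => coeff q i) (hco j)
    simp only [finset_sum_coeff, coeff_C_mul, coeff_X_pow, coeff_zero] at this
    simpa [hi] using this
  · rw [coeff_eq_zero_of_degree_lt (hrdeg.trans_le (by exact_mod_cast not_lt.1 hi)), coeff_zero]

open Polynomial in
/-- Second layer. -/
theorem RedData.layer2 {A κ : Type} [CommRing A] [Field κ] {ϖ : A}
    {ρ : A →+* Polynomial κ} (h : RedData ϖ ρ) (hs : Function.Surjective ρ) (z : A) (t : κ)
    (hz : ρ z = C t) (n : ℕ) (hn : n ≠ 0) :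
    ∃ ρ' : AdjoinRoot (X ^ n - C z : Polynomial A) →+*
        Polynomial (AdjoinRoot (X ^ n - C t : Polynomial κ)),
      RedData (AdjoinRoot.of (X ^ n - C z : Polynomial A) ϖ) ρ' ∧
      (∀ a, ρ' (AdjoinRoot.of _ a) = (ρ a).map (AdjoinRoot.of _)) ∧
      ρ' (AdjoinRoot.root _) = C (AdjoinRoot.root _) := by
  have hmap : (X ^ n - C z : Polynomial A).map ρ = X ^ n - C (C t) := by
    simp [hz]
  have h0 : (eval₂RingHom (mapRingHom (AdjoinRoot.of (X ^ n - C t : Polynomial κ)))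
      (C (AdjoinRoot.root (X ^ n - C t : Polynomial κ)))) (X ^ n - C (C t)) = 0 := by
    have hr : (AdjoinRoot.root (X ^ n - C t : Polynomial κ)) ^ n = AdjoinRoot.of _ t := by
      have := AdjoinRoot.eval₂_root (X ^ n - C t : Polynomial κ)
      rw [eval₂_sub, eval₂_X_pow, eval₂_C, sub_eq_zero] at this
      exact this
    simp [← C_pow, hr]
  obtain ⟨ρ', h1, h2⟩ := h.adjoinRoot hs (X ^ n - C z : Polynomial A)
    (by rw [hmap]; exact (monic_X_pow_sub_C _ hn).ne_zero)
    (eval₂RingHom (mapRingHom (AdjoinRoot.of (X ^ n - C t : Polynomial κ)))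
      (C (AdjoinRoot.root (X ^ n - C t : Polynomial κ))))
    (by rw [hmap]; exact h0) (by rw [hmap]; exact layer2_ker t n hn _ rfl)
  refine ⟨ρ', h1, ?_, ?_⟩
  · intro a; rw [← AdjoinRoot.mk_C, h2]; simp
  · rw [← AdjoinRoot.mk_X, h2]; simp


/-- The value group. -/
abbrev LexZ : Type := WithZero (Multiplicative (ℤ ×ₗ ℤ))

/-- An order function on a domain. -/
structure OrdFun {D : Type} [CommRing D] (o : D → ℤ) : Prop where
  one : o 1 = 0
  mul : ∀ x y, x ≠ 0 → y ≠ 0 → o (x * y) = o x + o y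
  add : ∀ x y, x ≠ 0 → y ≠ 0 → x + y ≠ 0 → min (o x) (o y) ≤ o (x + y)

/-- element of LexZ -/
def lexv (i j : ℤ) : LexZ := ((Multiplicative.ofAdd (toLex (-i, -j)) : Multiplicative (ℤ ×ₗ ℤ)) : LexZ)

theorem lexv_ne_zero (i j : ℤ) : lexv i j ≠ 0 := WithZero.coe_ne_zero

theorem lexv_zero : lexv 0 0 = 1 := rfl

theorem lexv_mul (i j i' j' : ℤ) : lexv i j * lexv i' j' = lexv (i + i') (j + j') := by
  unfold lexv
  rw [← WithZero.coe_mul, ← ofAdd_add]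
  congr 2
  show toLex (-i + -i', -j + -j') = toLex _
  rw [neg_add, neg_add]

theorem lexv_inj {i j i' j' : ℤ} : lexv i j = lexv i' j' ↔ i = i' ∧ j = j' := by
  unfold lexv
  rw [WithZero.coe_inj, Multiplicative.ofAdd.injective.eq_iff, toLex_inj, Prod.mk.injEq]
  simp

theorem lexv_le {i j i' j' : ℤ} : lexv i j ≤ lexv i' j' ↔ i' < i ∨ (i' = i ∧ j' ≤ j) := by
  unfold lexv
  rw [WithZero.coe_le_coe, Multiplicative.ofAdd_le, Prod.Lex.toLex_le_toLex]
  simp [eq_comm]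

theorem lexv_lt {i j i' j' : ℤ} : lexv i j < lexv i' j' ↔ i' < i ∨ (i' = i ∧ j' < j) := by
  unfold lexv
  rw [WithZero.coe_lt_coe, Multiplicative.ofAdd_lt, Prod.Lex.toLex_lt_toLex]
  simp [eq_comm]

theorem lexv_pow (i j : ℤ) (k : ℕ) : lexv i j ^ k = lexv (k * i) (k * j) := by
  induction k with
  | zero => simp [lexv_zero]
  | succ k ih => rw [pow_succ, ih, lexv_mul]; congr 1 <;> push_cast <;> ring

theorem lexv_exists (x : LexZ) (hx : x ≠ 0) : ∃ i j, x = lexv i j := by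
  obtain ⟨y, rfl⟩ := WithZero.ne_zero_iff_exists.1 hx
  refine ⟨-(ofLex (Multiplicative.toAdd y)).1, -(ofLex (Multiplicative.toAdd y)).2, ?_⟩
  unfold lexv
  simp only [neg_neg]
  rfl

section
variable {A D : Type} [CommRing A] [CommRing D] [IsDomain D] {ϖ : A} {ρ : A →+* D}

/-- `a` has a finite order. -/
def Fin' (ϖ : A) (ρ : A →+* D) (a : A) : Prop := ∃ (j : ℕ) (u : A), a = ϖ ^ j * u ∧ ρ u ≠ 0

open Classical in
/-- The valuation function. -/
noncomputable def valFun (ϖ : A) (ρ : A →+* D) (o : D → ℤ) (a : A) : LexZ :=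
  if h : Fin' ϖ ρ a then lexv (h.choose : ℤ) (o (ρ h.choose_spec.choose)) else 0

theorem RedData.nzd_pow (h : RedData ϖ ρ) (j : ℕ) (a : A) (ha : ϖ ^ j * a = 0) : a = 0 := by
  induction j with
  | zero => simpa using ha
  | succ j ih => exact ih (h.nzd _ (by rw [← mul_assoc, ← pow_succ']; exact ha))

theorem RedData.uniq_aux (h : RedData ϖ ρ) {j j' : ℕ} {u u' : A} (hle : j ≤ j')
    (he : ϖ ^ j * u = ϖ ^ j' * u') (hu : ρ u ≠ 0) : j = j' ∧ u = u' := by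
  obtain ⟨d, rfl⟩ := Nat.exists_eq_add_of_le hle
  have h1 : u = ϖ ^ d * u' := by
    have := h.nzd_pow j (u - ϖ ^ d * u') (by rw [mul_sub, he]; ring)
    exact sub_eq_zero.1 this
  rcases Nat.eq_zero_or_pos d with rfl | hd
  · simpa using h1
  · exfalso; apply hu
    rw [h1, map_mul, map_pow, h.zero, zero_pow hd.ne', zero_mul]

theorem RedData.uniq (h : RedData ϖ ρ) {j j' : ℕ} {u u' : A}
    (he : ϖ ^ j * u = ϖ ^ j' * u') (hu : ρ u ≠ 0) (hu' : ρ u' ≠ 0) : j = j' ∧ u = u' := by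
  rcases le_total j j' with hle | hle
  · exact h.uniq_aux hle he hu
  · obtain ⟨h1, h2⟩ := h.uniq_aux hle he.symm hu'
    exact ⟨h1.symm, h2.symm⟩

theorem RedData.valFun_eq (h : RedData ϖ ρ) (o : D → ℤ) (j : ℕ) (u : A) (hu : ρ u ≠ 0) :
    valFun ϖ ρ o (ϖ ^ j * u) = lexv j (o (ρ u)) := by
  have hf : Fin' ϖ ρ (ϖ ^ j * u) := ⟨j, u, rfl, hu⟩
  unfold valFun
  rw [dif_pos hf]
  obtain ⟨h1, h2⟩ := h.uniq hf.choose_spec.choose_spec.1 hu hf.choose_spec.choose_spec.2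
  exact congrArg₂ lexv (congrArg Nat.cast h1.symm) (congrArg (fun w => o (ρ w)) h2.symm)

theorem valFun_not (o : D → ℤ) (a : A) (ha : ¬ Fin' ϖ ρ a) : valFun ϖ ρ o a = 0 := by
  unfold valFun; rw [dif_neg ha]

theorem RedData.not_fin (h : RedData ϖ ρ) {a : A} (ha : ¬ Fin' ϖ ρ a) (j : ℕ) :
    ∃ b, a = ϖ ^ j * b ∧ ¬ Fin' ϖ ρ b := by
  induction j with
  | zero => exact ⟨a, by simp, ha⟩
  | succ j ih =>
    obtain ⟨b, rfl, hb⟩ := ih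
    have : ρ b = 0 := by
      by_contra hne
      exact hb ⟨0, b, by simp, hne⟩
    obtain ⟨c, rfl⟩ := h.ker b this
    refine ⟨c, by ring, ?_⟩
    rintro ⟨i, u, rfl, hu⟩
    exact hb ⟨i + 1, u, by ring, hu⟩

theorem RedData.not_fin_mul (h : RedData ϖ ρ) {a : A} (ha : ¬ Fin' ϖ ρ a) (c : A) :
    ¬ Fin' ϖ ρ (a * c) := by
  rintro ⟨j, u, hu, hne⟩
  obtain ⟨b, rfl, hb⟩ := h.not_fin ha (j + 1)
  apply hne
  have : u = ϖ * (b * c) := by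
    have := h.nzd_pow j (u - ϖ * (b * c)) (by rw [mul_sub, ← hu]; ring)
    exact sub_eq_zero.1 this
  rw [this, map_mul, h.zero, zero_mul]

theorem RedData.valFun_add_not (h : RedData ϖ ρ) (o : D → ℤ) {a : A} (ha : ¬ Fin' ϖ ρ a)
    (x : A) : valFun ϖ ρ o (x + a) = valFun ϖ ρ o x := by
  by_cases hx : Fin' ϖ ρ x
  · obtain ⟨j, u, rfl, hu⟩ := hx
    obtain ⟨b, rfl, hb⟩ := h.not_fin ha (j + 1)
    have e : ϖ ^ j * u + ϖ ^ (j + 1) * b = ϖ ^ j * (u + ϖ * b) := by ring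
    have e2 : ρ (u + ϖ * b) = ρ u := by rw [map_add, map_mul, h.zero, zero_mul, add_zero]
    rw [e, h.valFun_eq o j u hu, h.valFun_eq o j _ (by rw [e2]; exact hu), e2]
  · rw [valFun_not o x hx, valFun_not]
    rintro ⟨j, u, hju, hu⟩
    obtain ⟨b, rfl, hb⟩ := h.not_fin ha (j + 1)
    obtain ⟨c, rfl, hc⟩ := h.not_fin hx (j + 1)
    apply hu
    have : u = ϖ * (c + b) := by
      have := h.nzd_pow j (u - ϖ * (c + b)) (by rw [mul_sub, ← hju]; ring)
      exact sub_eq_zero.1 this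
    rw [this, map_mul, h.zero, zero_mul]

theorem RedData.valFun_add_aux (h : RedData ϖ ρ) {o : D → ℤ} (ho : OrdFun o) (j j' : ℕ)
    (u u' : A) (hu : ρ u ≠ 0) (hu' : ρ u' ≠ 0) (hle : j ≤ j') :
    valFun ϖ ρ o (ϖ ^ j * u + ϖ ^ j' * u') ≤
      max (valFun ϖ ρ o (ϖ ^ j * u)) (valFun ϖ ρ o (ϖ ^ j' * u')) := by
  obtain ⟨d, rfl⟩ := Nat.exists_eq_add_of_le hle
  have e : ϖ ^ j * u + ϖ ^ (j + d) * u' = ϖ ^ j * (u + ϖ ^ d * u') := by ring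
  rw [e]
  rcases Nat.eq_zero_or_pos d with rfl | hd
  · simp only [pow_zero, one_mul, add_zero]
    by_cases hf : Fin' ϖ ρ (u + u')
    · obtain ⟨i, w, hw, hw0⟩ := hf
      rw [hw]
      have e3 : ϖ ^ j * (ϖ ^ i * w) = ϖ ^ (j + i) * w := by ring
      rw [e3, h.valFun_eq o _ _ hw0, h.valFun_eq o _ _ hu, h.valFun_eq o _ _ hu', le_max_iff,
        lexv_le, lexv_le]
      rcases Nat.eq_zero_or_pos i with rfl | hi
      · have e4 : ρ w = ρ u + ρ u' := by rw [← map_add, hw]; simp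
        have := ho.add (ρ u) (ρ u') hu hu' (by rw [← e4]; exact hw0)
        rw [← e4, min_le_iff] at this
        rcases this with h1 | h1
        · left; right; exact ⟨by simp, h1⟩
        · right; right; exact ⟨by simp, h1⟩
      · left; left; push_cast; omega
    · rw [valFun_not]
      · exact zero_le
      · rw [mul_comm]
        rintro ⟨i, w, hw, hw0⟩
        exact absurd ⟨i, w, hw, hw0⟩ (h.not_fin_mul hf _)
  · have e2 : ρ (u + ϖ ^ d * u') = ρ u := by
      rw [map_add, map_mul, map_pow, h.zero, zero_pow hd.ne', zero_mul, add_zero]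
    rw [h.valFun_eq o j _ (by rw [e2]; exact hu), e2, h.valFun_eq o j _ hu]
    exact le_max_left _ _

/-- The valuation. -/
noncomputable def RedData.val (h : RedData ϖ ρ) {o : D → ℤ} (ho : OrdFun o) :
    Valuation A LexZ where
  toFun := valFun ϖ ρ o
  map_zero' := by
    apply valFun_not
    rintro ⟨j, u, hj, hu⟩
    apply hu
    rw [h.nzd_pow j u hj.symm, map_zero]
  map_one' := by
    have := h.valFun_eq o 0 1 (by simp)
    simpa [ho.one, lexv_zero] using this
  map_mul' x y := by
    by_cases hx : Fin' ϖ ρ x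
    · by_cases hy : Fin' ϖ ρ y
      · obtain ⟨j, u, rfl, hu⟩ := hx
        obtain ⟨j', u', rfl, hu'⟩ := hy
        have e : ϖ ^ j * u * (ϖ ^ j' * u') = ϖ ^ (j + j') * (u * u') := by ring
        rw [e, h.valFun_eq o _ _ hu, h.valFun_eq o _ _ hu', h.valFun_eq o _ _
          (by rw [map_mul]; exact mul_ne_zero hu hu'), lexv_mul, map_mul, ho.mul _ _ hu hu']
        push_cast; rfl
      · rw [valFun_not o y hy, mul_zero, mul_comm, valFun_not]
        exact h.not_fin_mul hy _
    · rw [valFun_not o x hx, zero_mul, valFun_not]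
      exact h.not_fin_mul hx _
  map_add_le_max' x y := by
    by_cases hx : Fin' ϖ ρ x
    · by_cases hy : Fin' ϖ ρ y
      · obtain ⟨j, u, rfl, hu⟩ := hx
        obtain ⟨j', u', rfl, hu'⟩ := hy
        rcases le_total j j' with hle | hle
        · exact h.valFun_add_aux ho _ _ _ _ hu hu' hle
        · rw [add_comm, max_comm]
          exact h.valFun_add_aux ho _ _ _ _ hu' hu hle
      · rw [h.valFun_add_not o hy]; exact le_max_left _ _
    · rw [add_comm, h.valFun_add_not o hx]; exact le_max_right _ _

theorem RedData.val_eq (h : RedData ϖ ρ) {o : D → ℤ} (ho : OrdFun o) (j : ℕ) (u : A)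
    (hu : ρ u ≠ 0) : h.val ho (ϖ ^ j * u) = lexv j (o (ρ u)) := h.valFun_eq o j u hu

theorem RedData.val_zero_iff (h : RedData ϖ ρ) {o : D → ℤ} (ho : OrdFun o) (a : A) :
    h.val ho a = 0 ↔ ¬ Fin' ϖ ρ a := by
  constructor
  · rintro h1 ⟨j, u, rfl, hu⟩
    rw [h.val_eq ho j u hu] at h1
    exact lexv_ne_zero _ _ h1
  · exact valFun_not o a

end


theorem OrdFun.zero {D : Type} [CommRing D] : OrdFun (fun _ : D => (0 : ℤ)) :=
  ⟨rfl, fun _ _ _ _ => by simp, fun _ _ _ _ _ => by simp⟩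

set_option maxHeartbeats 1000000 in
/-- The field of fractions of the separated quotient. -/
theorem RedData.exists_field {A D : Type} [CommRing A] [CommRing D] [IsDomain D] {ϖ : A}
    {ρ : A →+* D} (h : RedData ϖ ρ) {o : D → ℤ} (ho : OrdFun o) (σA : A →+* A)
    (hσϖ : σA ϖ = ϖ) (τ : D →+* D) (hτ : Function.Injective τ)
    (hστ : ∀ a, ρ (σA a) = τ (ρ a)) :
    ∃ (Ω : Type) (_ : Field Ω) (ψ : A →+* Ω) (σ : Ω →+* Ω) (v ν : Valuation Ω LexZ),
      (∀ a, σ (ψ a) = ψ (σA a)) ∧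
      (∀ (j : ℕ) u, ρ u ≠ 0 → v (ψ (ϖ ^ j * u)) = lexv j 0) ∧
      (∀ (j : ℕ) u, ρ u ≠ 0 → ν (ψ (ϖ ^ j * u)) = lexv j (o (ρ u))) ∧
      (∀ x, v (σ x) = v x) ∧
      (∀ k, (∀ d, d ≠ 0 → o (τ^[k] d) = o d) → ∀ x, ν (σ^[k] x) = ν x) ∧
      (∀ x y, v x < v y → ν x < ν y) ∧ (∀ a, ψ a = 0 → ρ a = 0) ∧ ψ ϖ ≠ 0 ∧
      (∀ x, x ≠ 0 → ∃ i : ℤ, v x = lexv i 0) := by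
  set v0 := h.val (OrdFun.zero (D := D)) with hv0
  set ν0 := h.val ho with hν0
  set I := v0.supp with hI
  have hmem : ∀ a, a ∈ I ↔ ¬ Fin' ϖ ρ a := fun a => by
    rw [hI, Valuation.mem_supp_iff, h.val_zero_iff]
  have hIν : I ≤ ν0.supp := by
    intro a ha
    rw [Valuation.mem_supp_iff, h.val_zero_iff]; exact (hmem a).1 ha
  haveI : I.IsPrime := inferInstance
  have hσfin : ∀ a, Fin' ϖ ρ a → Fin' ϖ ρ (σA a) := by
    rintro a ⟨j, u, rfl, hu⟩
    refine ⟨j, σA u, by rw [map_mul, map_pow, hσϖ], ?_⟩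
    rw [hστ]; exact (map_ne_zero_iff _ hτ).2 hu
  have hσfin' : ∀ a, ¬ Fin' ϖ ρ a → ¬ Fin' ϖ ρ (σA a) := by
    rintro a ha ⟨j, u, hju, hu⟩
    obtain ⟨b, rfl, hb⟩ := h.not_fin ha (j + 1)
    apply hu
    have : u = ϖ * σA b := by
      have := h.nzd_pow j (u - ϖ * σA b) (by
        rw [mul_sub, ← hju, map_mul, map_pow, hσϖ]; ring)
      exact sub_eq_zero.1 this
    rw [this, map_mul, h.zero, zero_mul]
  let Q := A ⧸ I
  let σQ : Q →+* Q := Ideal.quotientMap I σA (fun a ha => (hmem _).2 (hσfin' a ((hmem a).1 ha)))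
  have hσQ : ∀ a, σQ (Ideal.Quotient.mk I a) = Ideal.Quotient.mk I (σA a) := fun a => rfl
  have hσQinj : Function.Injective σQ := by
    rw [injective_iff_map_eq_zero]
    intro a
    obtain ⟨a, rfl⟩ := Ideal.Quotient.mk_surjective a
    rw [hσQ, Ideal.Quotient.eq_zero_iff_mem, Ideal.Quotient.eq_zero_iff_mem, hmem, hmem]
    exact fun h1 h2 => h1 (hσfin a h2)
  let Ω := FractionRing Q
  let ψ : A →+* Ω := (algebraMap Q Ω).comp (Ideal.Quotient.mk I)
  have hψ0 : ∀ a, ψ a = 0 ↔ ¬ Fin' ϖ ρ a := by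
    intro a
    show algebraMap Q Ω (Ideal.Quotient.mk I a) = 0 ↔ _
    rw [map_eq_zero_iff _ (IsFractionRing.injective Q Ω), Ideal.Quotient.eq_zero_iff_mem, hmem]
  let σ : Ω →+* Ω := IsFractionRing.lift (A := Q) (K := Ω) (g := (algebraMap Q Ω).comp σQ)
    ((IsFractionRing.injective Q Ω).comp hσQinj)
  have hσψ : ∀ a, σ (ψ a) = ψ (σA a) := by
    intro a
    show σ (algebraMap Q Ω (Ideal.Quotient.mk I a)) = _
    rw [IsFractionRing.lift_algebraMap]
    rfl
  have hext : ∀ w0 : Valuation A LexZ, (∀ a, w0 a = 0 ↔ ¬ Fin' ϖ ρ a) →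
      ∃ w : Valuation Ω LexZ, ∀ a, w (ψ a) = w0 a := by
    intro w0 hw0
    have hle : I ≤ w0.supp := fun a ha => by
      rw [Valuation.mem_supp_iff, hw0]; exact (hmem a).1 ha
    have hS : nonZeroDivisors Q ≤ (w0.onQuot hle).supp.primeCompl := by
      intro s hs
      obtain ⟨s, rfl⟩ := Ideal.Quotient.mk_surjective s
      intro hm
      have h1 : w0 s = 0 := hm
      have h2 : Ideal.Quotient.mk I s = 0 := by
        rw [Ideal.Quotient.eq_zero_iff_mem, hmem]; exact (hw0 s).1 h1
      exact nonZeroDivisors.ne_zero hs h2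
    refine ⟨(w0.onQuot hle).extendToLocalization hS Ω, fun a => ?_⟩
    show (w0.onQuot hle).extendToLocalization hS Ω (algebraMap Q Ω (Ideal.Quotient.mk I a)) = _
    rw [Valuation.extendToLocalization_apply_map_apply]
    rfl
  obtain ⟨v, hv⟩ := hext v0 (fun a => h.val_zero_iff _ a)
  obtain ⟨ν, hν⟩ := hext ν0 (fun a => h.val_zero_iff _ a)
  have hfrac : ∀ x : Ω, ∃ a s, Fin' ϖ ρ s ∧ x = ψ a / ψ s := by
    intro x
    obtain ⟨a, s, hs, rfl⟩ := IsFractionRing.div_surjective (A := Q) x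
    obtain ⟨a, rfl⟩ := Ideal.Quotient.mk_surjective a
    obtain ⟨s, rfl⟩ := Ideal.Quotient.mk_surjective s
    refine ⟨a, s, ?_, rfl⟩
    by_contra hne
    have h2 : Ideal.Quotient.mk I s = 0 := by
      rw [Ideal.Quotient.eq_zero_iff_mem, hmem]; exact hne
    exact nonZeroDivisors.ne_zero hs h2
  have hvA : ∀ (j : ℕ) u, ρ u ≠ 0 → v (ψ (ϖ ^ j * u)) = lexv j 0 := fun j u hu => by
    rw [hv]; exact h.val_eq OrdFun.zero j u hu
  have hνA : ∀ (j : ℕ) u, ρ u ≠ 0 → ν (ψ (ϖ ^ j * u)) = lexv j (o (ρ u)) := fun j u hu => by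
    rw [hν]; exact h.val_eq ho j u hu
  have hvσA : ∀ a, v (ψ (σA a)) = v (ψ a) := by
    intro a
    by_cases ha : Fin' ϖ ρ a
    · obtain ⟨j, u, rfl, hu⟩ := ha
      rw [hvA j u hu, map_mul, map_pow, hσϖ, hvA]
      rw [hστ]; exact (map_ne_zero_iff _ hτ).2 hu
    · rw [(hψ0 a).2 ha, (hψ0 _).2 (hσfin' a ha)]
  have hψϖ : ψ ϖ ≠ 0 := by
    rw [Ne, hψ0, not_not]; exact ⟨1, 1, by simp, by simp⟩
  have hvone : ∀ a, Fin' ϖ ρ a → ∃ i : ℤ, v (ψ a) = lexv i 0 := by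
    rintro a ⟨j, u, rfl, hu⟩; exact ⟨j, hvA j u hu⟩
  refine ⟨Ω, inferInstance, ψ, σ, v, ν, hσψ, hvA, hνA, ?_, ?_, ?_, ?_, hψϖ, ?_⟩
  · intro x
    obtain ⟨a, s, -, rfl⟩ := hfrac x
    rw [map_div₀ σ, map_div₀ v, map_div₀ v, hσψ, hσψ, hvσA, hvσA]
  · intro k hk
    have hit : ∀ k a, σ^[k] (ψ a) = ψ (σA^[k] a) := by
      intro k
      induction k with
      | zero => intro a; rfl
      | succ k ih => intro a; rw [Function.iterate_succ_apply, Function.iterate_succ_apply, hσψ, ih]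
    have hitρ : ∀ k a, ρ (σA^[k] a) = τ^[k] (ρ a) := by
      intro k
      induction k with
      | zero => intro a; rfl
      | succ k ih => intro a; rw [Function.iterate_succ_apply, Function.iterate_succ_apply, ih, hστ]
    have hitm : ∀ k j u, σA^[k] (ϖ ^ j * u) = ϖ ^ j * σA^[k] u := by
      intro k
      induction k with
      | zero => intro j u; rfl
      | succ k ih =>
        intro j u
        rw [Function.iterate_succ_apply, Function.iterate_succ_apply, map_mul, map_pow, hσϖ, ih]
    have hitn : ∀ k d, d ≠ 0 → τ^[k] d ≠ 0 := by
      intro k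
      induction k with
      | zero => intro d hd; exact hd
      | succ k ih =>
        intro d hd; rw [Function.iterate_succ_apply]; exact ih _ ((map_ne_zero_iff _ hτ).2 hd)
    have hitf : ∀ k a, ¬ Fin' ϖ ρ a → ¬ Fin' ϖ ρ (σA^[k] a) := by
      intro k
      induction k with
      | zero => intro d hd; exact hd
      | succ k ih =>
        intro d hd; rw [Function.iterate_succ_apply]; exact ih _ (hσfin' _ hd)
    have hA : ∀ a, ν (ψ (σA^[k] a)) = ν (ψ a) := by
      intro a
      by_cases ha : Fin' ϖ ρ a
      · obtain ⟨j, u, rfl, hu⟩ := ha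
        rw [hνA j u hu, hitm, hνA j _ (by rw [hitρ]; exact hitn k _ hu), hitρ, hk _ hu]
      · rw [(hψ0 a).2 ha, (hψ0 _).2 (hitf k a ha)]
    intro x
    obtain ⟨a, s, -, rfl⟩ := hfrac x
    have : σ^[k] (ψ a / ψ s) = σ^[k] (ψ a) / σ^[k] (ψ s) := by
      have : ∀ (k : ℕ) (x y : Ω), σ^[k] (x / y) = σ^[k] x / σ^[k] y := by
        intro k
        induction k with
        | zero => intro x y; rfl
        | succ k ih =>
          intro x y
          simp only [Function.iterate_succ_apply]
          rw [map_div₀, ih]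
      exact this k _ _
    rw [this, hit, hit, map_div₀ ν, map_div₀ ν, hA, hA]
  · have key : ∀ a b, v (ψ a) < v (ψ b) → ν (ψ a) < ν (ψ b) := by
      intro a b hab
      have hb : Fin' ϖ ρ b := by
        by_contra hb
        rw [(hψ0 b).2 hb, map_zero] at hab
        exact not_lt_zero hab
      obtain ⟨j, u, rfl, hu⟩ := hb
      by_cases ha : Fin' ϖ ρ a
      · obtain ⟨i, w, rfl, hw⟩ := ha
        rw [hvA _ _ hu, hvA _ _ hw, lexv_lt] at hab
        rw [hνA _ _ hu, hνA _ _ hw, lexv_lt]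
        left
        rcases hab with h1 | ⟨_, h2⟩
        · exact h1
        · exact absurd h2 (lt_irrefl _)
      · rw [(hψ0 a).2 ha, map_zero, hνA _ _ hu]
        exact zero_lt_iff.2 (lexv_ne_zero _ _)
    intro x y hxy
    obtain ⟨a, s, hs, rfl⟩ := hfrac x
    obtain ⟨b, r, hr, rfl⟩ := hfrac y
    have hs0 : ψ s ≠ 0 := fun h0 => (hψ0 s).1 h0 hs
    have hr0 : ψ r ≠ 0 := fun h0 => (hψ0 r).1 h0 hr
    have e1 : ∀ w : Valuation Ω LexZ, w (ψ a / ψ s) < w (ψ b / ψ r) ↔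
        w (ψ (a * r)) < w (ψ (b * s)) := by
      intro w
      rw [map_div₀, map_div₀, div_lt_div_iff₀ (zero_lt_iff.2 ((Valuation.ne_zero_iff w).2 hs0))
        (zero_lt_iff.2 ((Valuation.ne_zero_iff w).2 hr0)), map_mul, map_mul, map_mul, map_mul]
    rw [e1] at hxy ⊢
    exact key _ _ hxy
  · intro a ha
    by_contra hne
    exact (hψ0 a).1 ha ⟨0, a, by simp, hne⟩
  · intro x hx
    obtain ⟨a, s, hs, rfl⟩ := hfrac x
    have ha : Fin' ϖ ρ a := by
      by_contra hne
      rw [(hψ0 a).2 hne, zero_div] at hx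
      exact hx rfl
    obtain ⟨i, hi⟩ := hvone a ha
    obtain ⟨j, hj⟩ := hvone s hs
    refine ⟨i - j, ?_⟩
    rw [map_div₀, hi, hj, div_eq_iff (lexv_ne_zero _ _), lexv_mul]
    congr 1 <;> ring


section
variable {F K : Type} [Field F] [Field K] [Algebra F K] [FiniteDimensional F K]

/-- products of conjugates -/
noncomputable def Pz (t : K) (f : (K ≃ₐ[F] K) → ℤ) : K := ∏ g : K ≃ₐ[F] K, (g t) ^ (f g)

theorem Pz_add (t : K) (ht : t ≠ 0) (f g : (K ≃ₐ[F] K) → ℤ) :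
    Pz t (f + g) = Pz t f * Pz t g := by
  unfold Pz
  rw [← Finset.prod_mul_distrib]
  refine Finset.prod_congr rfl fun i _ => ?_
  rw [Pi.add_apply, zpow_add₀ (by simpa using ht)]

theorem Pz_smul (t : K) (f : (K ≃ₐ[F] K) → ℤ) (s : ℤ) :
    Pz t (fun g => s * f g) = Pz t f ^ s := by
  unfold Pz
  rw [← Finset.prod_zpow]
  refine Finset.prod_congr rfl fun i _ => ?_
  show i t ^ (s * f i) = _
  rw [mul_comm, zpow_mul]

theorem Pz_ne_zero (t : K) (ht : t ≠ 0) (f : (K ≃ₐ[F] K) → ℤ) : Pz t f ≠ 0 :=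
  Finset.prod_ne_zero_iff.2 fun g _ => zpow_ne_zero _ (by simpa using ht)

theorem Pz_map (t : K) (f : (K ≃ₐ[F] K) → ℤ) (d : K ≃ₐ[F] K) :
    d (Pz t f) = Pz t (fun g => f (d⁻¹ * g)) := by
  unfold Pz
  rw [map_prod]
  refine Fintype.prod_equiv (Equiv.mulLeft d) _ _ fun g => ?_
  simp [map_zpow₀]

theorem kummer_descent [IsGalois F K] {N : Type} [Field N] [Algebra K N] [Algebra F N]
    [IsScalarTower F K N] (n : ℕ) (hn : 0 < n) (ζ : K) (hζ : IsPrimitiveRoot ζ n)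
    (χ : (K ≃ₐ[F] K) → ℕ) (hχ : ∀ g, g ζ = ζ ^ χ g) (a : (K ≃ₐ[F] K) → ℤ)
    (ha : ∀ d g, (n : ℤ) ∣ a (d⁻¹ * g) - χ d * a g) (t : K) (ht : t ≠ 0) (β : N)
    (hβ : β ^ n = algebraMap K N (Pz t a)) (hdim : Module.finrank K N = n)
    (hlift : ∀ (g : K →+* N) (b : N), b ^ n = g (Pz t a) →
      ∃ G : N →+* N, (∀ c, G (algebraMap K N c) = g c) ∧ G β = b)
    (hext : ∀ G G' : N →+* N, (∀ c, G (algebraMap K N c) = G' (algebraMap K N c)) →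
      G β = G' β → G = G') :
    ∃ (σ : N ≃ₐ[F] N) (Δ : (K ≃ₐ[F] K) →* (N ≃ₐ[F] N)),
      σ β = algebraMap K N ζ * β ∧ (∀ c, σ (algebraMap K N c) = algebraMap K N c) ∧
      (∀ d c, Δ d (algebraMap K N c) = algebraMap K N (d c)) ∧
      (∀ d x, σ (Δ d x) = Δ d (σ x)) ∧
      (∀ x, σ x = x → (∀ d, Δ d x = x) → ∃ y : F, algebraMap F N y = x) ∧ σ ^ n = 1 := by
  classical
  have hβ0 : β ≠ 0 := by
    rintro rfl
    rw [zero_pow hn.ne'] at hβ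
    exact Pz_ne_zero t ht a ((algebraMap K N).injective (by rw [← hβ, map_zero]))
  choose w hw using ha
  -- the automorphism sigma
  obtain ⟨s, hs1, hs2⟩ := hlift (algebraMap K N) (algebraMap K N ζ * β) (by
    rw [mul_pow, hβ, ← map_pow, hζ.pow_eq_one, map_one, one_mul])
  have hspow : ∀ i, s^[i] β = algebraMap K N ζ ^ i * β := by
    intro i
    induction i with
    | zero => simp
    | succ i ih =>
      rw [Function.iterate_succ_apply', ih, map_mul, map_pow, hs1, hs2, pow_succ]; ring
  have hsn : s ^ n = 1 := by
    apply hext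
    · intro c
      have : ∀ i, (s ^ i) (algebraMap K N c) = algebraMap K N c := by
        intro i
        induction i with
        | zero => rfl
        | succ i ih => rw [pow_succ', RingHom.mul_def, RingHom.comp_apply, ih, hs1]
      rw [this]; rfl
    · have : ∀ i, (s ^ i) β = algebraMap K N ζ ^ i * β := by
        intro i
        induction i with
        | zero => simp
        | succ i ih =>
          rw [pow_succ', RingHom.mul_def, RingHom.comp_apply, ih, map_mul, map_pow, hs1, hs2,
            pow_succ]
          ring
      rw [this, ← map_pow, hζ.pow_eq_one, map_one, one_mul]; rfl
  have hsn1 : ∀ x, s ((s ^ (n - 1)) x) = x := by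
    intro x
    have : s * s ^ (n - 1) = 1 := by rw [← pow_succ', Nat.sub_add_cancel hn, hsn]
    exact DFunLike.congr_fun this x
  have hsn2 : ∀ x, (s ^ (n - 1)) (s x) = x := by
    intro x
    have : s ^ (n - 1) * s = 1 := by rw [← pow_succ, Nat.sub_add_cancel hn, hsn]
    exact DFunLike.congr_fun this x
  have hsF : ∀ y : F, s (algebraMap F N y) = algebraMap F N y := by
    intro y; rw [IsScalarTower.algebraMap_apply F K N, hs1]
  let σ : N ≃ₐ[F] N := AlgEquiv.ofRingEquiv (f := RingEquiv.ofRingHom s (s ^ (n - 1))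
    (RingHom.ext hsn1) (RingHom.ext hsn2)) hsF
  have hσs : ∀ x, σ x = s x := fun x => rfl
  -- the lifts
  have hb : ∀ d : K ≃ₐ[F] K, (β ^ χ d * algebraMap K N (Pz t (w d))) ^ n
      = ((algebraMap K N).comp (d : K →+* K)) (Pz t a) := by
    intro d
    show _ = algebraMap K N (d (Pz t a))
    rw [mul_pow, ← pow_mul, mul_comm (χ d), pow_mul, hβ, ← map_pow, ← map_pow, ← map_mul, Pz_map,
      ← zpow_natCast, ← zpow_natCast, ← Pz_smul, ← Pz_smul, ← Pz_add t ht]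
    congr 2
    funext g
    have := hw d g
    simp only [Pi.add_apply]
    linarith
  choose δ hδ1 hδ2 using fun d => hlift _ _ (hb d)
  have hδ1' : ∀ d c, δ d (algebraMap K N c) = algebraMap K N (d c) := hδ1
  have hmul : ∀ d e, (δ d).comp (δ e) = δ (d * e) := by
    intro d e
    apply hext
    · intro c
      rw [RingHom.comp_apply, hδ1', hδ1', hδ1']; rfl
    · rw [RingHom.comp_apply, hδ2, hδ2, map_mul, map_pow, hδ2, hδ1', Pz_map]
      have hc : (n : ℤ) ∣ (χ d * χ e : ℕ) - (χ (d * e) : ℕ) := by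
        have h1 : ζ ^ (χ d * χ e) = ζ ^ χ (d * e) := by
          rw [← hχ, AlgEquiv.mul_apply, hχ e, map_pow, hχ, pow_mul]
        have h2 := (hζ.isUnit hn.ne').unit
        have h3 : χ (d * e) ≡ χ d * χ e [MOD n] := by
          have hζ0 : ζ ≠ 0 := hζ.ne_zero hn.ne'
          rw [hζ.eq_orderOf]
          exact ((isOfFinOrder_iff_pow_eq_one.2 ⟨n, hn, hζ.pow_eq_one⟩).pow_eq_pow_iff_modEq.1 h1).symm
        exact (Nat.modEq_iff_dvd.1 h3)
      obtain ⟨r, hr⟩ := hc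
      have e1 : β ^ (χ d * χ e) = β ^ χ (d * e) * algebraMap K N (Pz t fun g => r * a g) := by
        rw [Pz_smul, map_zpow₀, ← hβ, ← zpow_natCast, ← zpow_natCast, ← zpow_natCast,
          ← zpow_mul, ← zpow_add₀ hβ0]
        congr 1; linarith
      rw [mul_pow, ← pow_mul, e1, ← map_pow, ← zpow_natCast (Pz t (w d)), ← Pz_smul,
        mul_assoc, mul_assoc, ← map_mul, ← map_mul, ← Pz_add t ht, ← Pz_add t ht]
      congr 3
      funext g
      have hn' : (n : ℤ) ≠ 0 := by exact_mod_cast hn.ne'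
      apply mul_left_cancel₀ hn'
      simp only [Pi.add_apply]
      have h1 := hw d g
      have h2 := hw e (d⁻¹ * g)
      have h3 := hw (d * e) g
      have h4 : (d * e)⁻¹ * g = e⁻¹ * (d⁻¹ * g) := by group
      rw [h4] at h3
      push_cast at hr
      rw [mul_add, mul_add, ← h3, ← h2]
      have h5 : (n : ℤ) * (χ e * w d g) = χ e * (a (d⁻¹ * g) - χ d * a g) := by rw [h1]; ring
      have h6 : (n : ℤ) * (r * a g) = (χ d * χ e - χ (d * e)) * a g := by rw [hr]; ring
      rw [h5, h6]; ring
  have hone : δ 1 = RingHom.id N := by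
    ext x
    apply (δ 1).injective
    have := DFunLike.congr_fun (hmul 1 1) x
    simpa using this
  have hδF : ∀ d (y : F), δ d (algebraMap F N y) = algebraMap F N y := by
    intro d y; rw [IsScalarTower.algebraMap_apply F K N, hδ1', AlgEquiv.commutes]
  let Δ : (K ≃ₐ[F] K) →* (N ≃ₐ[F] N) :=
    { toFun := fun d => AlgEquiv.ofRingEquiv (f := RingEquiv.ofRingHom (δ d) (δ d⁻¹)
        (by rw [hmul, mul_inv_cancel, hone]) (by rw [hmul, inv_mul_cancel, hone])) (hδF d)
      map_one' := by
        ext x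
        show δ 1 x = x
        rw [hone]; rfl
      map_mul' := fun d e => by
        ext x
        show δ (d * e) x = δ d (δ e x)
        rw [← hmul]; rfl }
  have hΔ : ∀ d x, Δ d x = δ d x := fun d x => rfl
  refine ⟨σ, Δ, hs2, hs1, hδ1', ?_, ?_, ?_⟩
  · intro d x
    have : s.comp (δ d) = (δ d).comp s := by
      apply hext
      · intro c; simp only [RingHom.comp_apply, hδ1', hs1]
      · simp only [RingHom.comp_apply, hδ2, hs2, map_mul, map_pow, hs1, hδ1', hχ, mul_pow]
        ring
    exact DFunLike.congr_fun this x
  · intro x hx hd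
    haveI : FiniteDimensional K N := Module.finite_of_finrank_pos (by rw [hdim]; exact hn)
    let σK : N ≃ₐ[K] N := AlgEquiv.ofRingEquiv (f := σ.toRingEquiv) hs1
    have hσK : ∀ i x, (σK ^ i) x = s^[i] x := by
      intro i
      induction i with
      | zero => intro x; rfl
      | succ i ih => intro x; rw [pow_succ, AlgEquiv.mul_apply, ih, Function.iterate_succ_apply]; rfl
    have hord : orderOf σK = n := by
      rw [orderOf_eq_iff hn]
      constructor
      · ext x
        rw [hσK]
        have := DFunLike.congr_fun hsn x
        rwa [RingHom.coe_pow] at this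
      · intro i hi hi0 h1
        have h2 : (σK ^ i) β = β := by rw [h1]; rfl
        rw [hσK, hspow] at h2
        have h3 : algebraMap K N ζ ^ i = 1 := mul_right_cancel₀ hβ0 (by rw [h2, one_mul])
        rw [← map_pow] at h3
        have h4 : ζ ^ i = 1 := (algebraMap K N).injective (by rw [h3, map_one])
        exact absurd (Nat.le_of_dvd hi0 (hζ.dvd_of_pow_eq_one i h4)) (by omega)
    have hcard := IntermediateField.finrank_fixedField_eq_card (F := K) (E := N)
      (Subgroup.zpowers σK)
    rw [Nat.card_zpowers, hord] at hcard
    have hmulr := Module.finrank_mul_finrank K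
      (IntermediateField.fixedField (Subgroup.zpowers σK)) N
    rw [hcard, hdim] at hmulr
    have hone' : Module.finrank K (IntermediateField.fixedField (Subgroup.zpowers σK)) = 1 :=
      Nat.eq_of_mul_eq_mul_right hn (by rw [hmulr, one_mul])
    rw [IntermediateField.finrank_eq_one_iff] at hone'
    have hxm : x ∈ IntermediateField.fixedField (Subgroup.zpowers σK) := by
      rw [IntermediateField.mem_fixedField_iff]
      intro f hf
      obtain ⟨i, rfl⟩ := (Subgroup.mem_zpowers_iff).1 hf
      have h1 : σK ∈ MulAction.stabilizer (N ≃ₐ[K] N) x := hx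
      exact (MulAction.stabilizer (N ≃ₐ[K] N) x).zpow_mem h1 i
    rw [hone', IntermediateField.mem_bot] at hxm
    obtain ⟨c, rfl⟩ := hxm
    have hc : ∀ d : K ≃ₐ[F] K, d c = c := by
      intro d
      have := hd d
      rw [hΔ, hδ1'] at this
      exact (algebraMap K N).injective this
    obtain ⟨y, rfl⟩ := (IsGalois.mem_range_algebraMap_iff_fixed (F := F) c).2 hc
    exact ⟨y, IsScalarTower.algebraMap_apply F K N y⟩
  · ext x
    have h1 : ∀ i x, (σ ^ i) x = s^[i] x := by
      intro i
      induction i with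
      | zero => intro x; rfl
      | succ i ih => intro x; rw [pow_succ, AlgEquiv.mul_apply, ih, Function.iterate_succ_apply]; rfl
    rw [h1]
    have := DFunLike.congr_fun hsn x
    rwa [RingHom.coe_pow] at this

end

/-- Fixed field of commuting group. -/
theorem cyc_of_fixed {F N G : Type} [Field F] [Field N] [Algebra F N] [Group G]
    [FiniteDimensional F N] (n : ℕ) (hn : 0 < n) (σ : N ≃ₐ[F] N) (Δ : G →* (N ≃ₐ[F] N))
    (hcomm : ∀ d x, σ (Δ d x) = Δ d (σ x)) (hσn : σ ^ n = 1)
    (hfix : ∀ x, σ x = x → (∀ d, Δ d x = x) → ∃ y : F, algebraMap F N y = x)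
    (lam : N) (hlam : ∀ d, Δ d lam = lam) (hlam2 : ∀ i, 0 < i → i < n → (σ ^ i) lam ≠ lam) :
    ∃ (L : IntermediateField F N) (s : L ≃ₐ[F] L), CycData F L s n ∧
      (∀ x : L, (s x : N) = σ x) ∧ (∀ x, x ∈ L ↔ ∀ d, Δ d x = x) := by
  let L : IntermediateField F N := IntermediateField.fixedField Δ.range
  have hL : ∀ x, x ∈ L ↔ ∀ d, Δ d x = x := by
    intro x
    rw [IntermediateField.mem_fixedField_iff]
    constructor
    · intro h d; exact h _ ⟨d, rfl⟩
    · rintro h _ ⟨d, rfl⟩; exact h d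
  have hσL : ∀ x, x ∈ L → σ x ∈ L := by
    intro x hx
    rw [hL] at hx ⊢
    intro d; rw [← hcomm, hx]
  let s0 : L →ₐ[F] L := (σ.toAlgHom.comp L.val).codRestrict L.toSubalgebra (fun x => hσL x x.2)
  have hs0 : ∀ x : L, (s0 x : N) = σ x := fun x => rfl
  let s : L ≃ₐ[F] L := AlgEquiv.ofBijective s0 (Algebra.IsAlgebraic.algHom_bijective s0)
  have hs : ∀ x : L, (s x : N) = σ x := fun x => rfl
  have hsp : ∀ i (x : L), ((s ^ i) x : N) = (σ ^ i) x := by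
    intro i
    induction i with
    | zero => intro x; rfl
    | succ i ih => intro x; rw [pow_succ', pow_succ', AlgEquiv.mul_apply, AlgEquiv.mul_apply, hs, ih]
  have hpow : s ^ n = 1 := by
    ext x; rw [hsp, hσn]; rfl
  have hne : ∀ i, 0 < i → i < n → s ^ i ≠ 1 := by
    intro i h0 hi h1
    apply hlam2 i h0 hi
    have := congrArg (fun f : L ≃ₐ[F] L => ((f ⟨lam, (hL lam).2 hlam⟩ : L) : N)) h1
    exact (hsp i ⟨lam, (hL lam).2 hlam⟩).symm.trans this
  have hfx : ∀ x : L, s x = x → ∃ y : F, algebraMap F L y = x := by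
    intro x hx
    obtain ⟨y, hy⟩ := hfix x (by rw [← hs, hx]) ((hL x).1 x.2)
    exact ⟨y, Subtype.ext hy⟩
  refine ⟨L, s, ⟨hn, hpow, hne, hfx, ?_⟩, hs, hL⟩
  have hord : orderOf s = n := by
    rw [orderOf_eq_iff hn]
    exact ⟨hpow, fun i hi h0 => hne i h0 hi⟩
  have hcard := IntermediateField.finrank_fixedField_eq_card (F := F) (E := L)
    (Subgroup.zpowers s)
  rw [Nat.card_zpowers, hord] at hcard
  have hbot : IntermediateField.fixedField (Subgroup.zpowers s) = ⊥ := by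
    rw [eq_bot_iff]
    intro x hx
    rw [IntermediateField.mem_fixedField_iff] at hx
    obtain ⟨y, hy⟩ := hfx x (hx s (Subgroup.mem_zpowers s))
    exact IntermediateField.mem_bot.2 ⟨y, hy⟩
  have hmulr := Module.finrank_mul_finrank F
    (IntermediateField.fixedField (Subgroup.zpowers s)) L
  rw [hcard, hbot, IntermediateField.finrank_bot, one_mul] at hmulr
  exact hmulr.symm


open Polynomial in
theorem rootMult_ordFun {κ : Type} [Field κ] (w : κ) :
    OrdFun (fun p : Polynomial κ => (p.rootMultiplicity w : ℤ)) where
  one := by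
    have : (1 : Polynomial κ).rootMultiplicity w = 0 := by
      rw [← C_1, rootMultiplicity_C]
    simp [this]
  mul := fun x y hx hy => by
    rw [rootMultiplicity_mul (mul_ne_zero hx hy)]; push_cast; rfl
  add := fun x y hx hy hxy => by
    have := rootMultiplicity_add w (p := x) (q := y) hxy
    exact_mod_cast this

/-- Output of the second layer. -/
structure Lay2 {A κ : Type} [CommRing A] [Field κ] (ϖ : A) (ρ : A →+* Polynomial κ)
    (n m e : ℕ) (zA ζA : A) (Ω : Type) [Field Ω] (ψ : A →+* Ω) (β : Ω) (σ : Ω →+* Ω)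
    (v ν : Valuation Ω LexZ) : Prop where
  σψ : ∀ a, σ (ψ a) = ψ a
  σβ : σ β = ψ ζA * β
  βn : β ^ n = ψ zA
  vψ : ∀ a, ρ a ≠ 0 → v (ψ a) = 1
  vϖ : v (ψ ϖ) = lexv 1 0
  νϖ : ν (ψ ϖ) = lexv 1 0
  νψ : ∀ a s, ρ a = Polynomial.C s → s ≠ 0 → ν (ψ a) = 1
  vT : ∀ T w s, ρ T = Polynomial.X → ρ w = Polynomial.C s → v (ψ T - ψ w * β ^ m) = 1
  νT : ∀ T w, ρ T = Polynomial.X → ρ w = 1 → ν (ψ T - ψ w * β ^ m) = lexv 0 1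
  νT' : ∀ T w s, ρ T = Polynomial.X → ρ w = Polynomial.C s → s ≠ 1 →
    ν (ψ T - ψ w * β ^ m) = 1
  vσ : ∀ x, v (σ x) = v x
  νσ : ∀ x, ν (σ^[e] x) = ν x
  coarse : ∀ x y, v x < v y → ν x < ν y
  ker : ∀ a, ψ a = 0 → ρ a = 0
  vex : ∀ x, x ≠ 0 → ∃ i : ℤ, v x = lexv i 0

open Polynomial in
theorem exists_lay2 {A κ : Type} [CommRing A] [Field κ] {ϖ : A} {ρ : A →+* Polynomial κ}
    (h : RedData ϖ ρ) (hs : Function.Surjective ρ) (n m e : ℕ) (hn : 0 < n) (hnem : n = e * m)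
    (zA ζA : A) (t ζ : κ) (hz : ρ zA = C t) (hζA : ρ ζA = C ζ) (hζn : ζA ^ n = 1)
    (hζ : IsPrimitiveRoot ζ n)
    (ht : t ≠ 0) (hirr : Irreducible (X ^ n - C t)) :
    ∃ (Ω : Type) (_ : Field Ω) (ψ : A →+* Ω) (β : Ω) (σ : Ω →+* Ω) (v ν : Valuation Ω LexZ),
      Lay2 ϖ ρ n m e zA ζA Ω ψ β σ v ν := by
  classical
  obtain ⟨ρ', hr, hr1, hr2⟩ := h.layer2 hs zA t hz n hn.ne'
  haveI : Fact (Irreducible (X ^ n - C t)) := ⟨hirr⟩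
  set κ' := AdjoinRoot (X ^ n - C t : Polynomial κ) with hκ'
  set A2 := AdjoinRoot (X ^ n - C zA : Polynomial A) with hA2
  let bb : κ' := AdjoinRoot.root _
  have hbb : bb ^ n = AdjoinRoot.of _ t := by
    have := AdjoinRoot.eval₂_root (X ^ n - C t)
    simpa [sub_eq_zero] using this
  have hbA : (AdjoinRoot.root _ : A2) ^ n = AdjoinRoot.of _ zA := by
    have := AdjoinRoot.eval₂_root (X ^ n - C zA)
    simpa [sub_eq_zero] using this
  have hbb0 : bb ≠ 0 := by
    intro h0
    rw [h0, zero_pow hn.ne'] at hbb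
    exact ht ((AdjoinRoot.of (X ^ n - C t)).injective (by rw [← hbb, map_zero]))
  let σA : A2 →+* A2 := AdjoinRoot.lift (AdjoinRoot.of _)
    (AdjoinRoot.of _ ζA * AdjoinRoot.root _) (by
      simp only [eval₂_sub, eval₂_X_pow, eval₂_C]
      rw [mul_pow, ← map_pow, hζn, map_one, one_mul, hbA, sub_self])
  let σk : κ' →+* κ' := AdjoinRoot.lift (AdjoinRoot.of _)
    (AdjoinRoot.of _ ζ * AdjoinRoot.root _) (by
      simp only [eval₂_sub, eval₂_X_pow, eval₂_C]
      rw [mul_pow, ← map_pow, hζ.pow_eq_one, map_one, one_mul]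
      exact sub_eq_zero.2 hbb)
  have hσA1 : ∀ a, σA (AdjoinRoot.of _ a) = AdjoinRoot.of _ a := fun a => AdjoinRoot.lift_of _
  have hσA2 : σA (AdjoinRoot.root _) = AdjoinRoot.of _ ζA * AdjoinRoot.root _ :=
    AdjoinRoot.lift_root _
  have hσk1 : ∀ a, σk (AdjoinRoot.of _ a) = AdjoinRoot.of _ a := fun a => AdjoinRoot.lift_of _
  have hσk2 : σk bb = AdjoinRoot.of _ ζ * bb := AdjoinRoot.lift_root _
  have hσki : ∀ i, σk^[i] bb = AdjoinRoot.of _ ζ ^ i * bb := by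
    intro i
    induction i with
    | zero => simp
    | succ i ih =>
      rw [Function.iterate_succ_apply', ih, map_mul, map_pow, hσk1, hσk2]; ring
  let o : Polynomial κ' → ℤ := fun p => (p.rootMultiplicity (bb ^ m) : ℤ)
  have ho : OrdFun o := rootMult_ordFun _
  have hτ : ∀ a, ρ' (σA a) = mapRingHom σk (ρ' a) := by
    have : ρ'.comp σA = (mapRingHom σk).comp ρ' := by
      refine AdjoinRoot.ringHom_ext ?_ ?_
      · refine RingHom.ext fun a => ?_
        simp only [RingHom.comp_apply]
        rw [hσA1, hr1, coe_mapRingHom, Polynomial.map_map]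
        congr 1
        exact RingHom.ext fun a => (hσk1 a).symm
      · simp only [RingHom.comp_apply]
        rw [hσA2, map_mul, hr1, hr2, hζA, coe_mapRingHom, map_C, map_C, ← C_mul]
        exact congrArg C hσk2.symm
    exact fun a => DFunLike.congr_fun this a
  obtain ⟨Ω, _, ψ, σ, v, ν, h1, h2, h3, h4, h5, h6, h7, h8, h9⟩ := hr.exists_field ho σA
    (hσA1 ϖ) (mapRingHom σk) (map_injective _ σk.injective) hτ
  have hmapinj : Function.Injective (AdjoinRoot.of (X ^ n - C t)) := RingHom.injective _
  have hv0 : ∀ u, ρ' u ≠ 0 → v (ψ u) = 1 := fun u hu => by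
    have := h2 0 u hu
    simpa [lexv_zero] using this
  have hν0 : ∀ u, ρ' u ≠ 0 → ν (ψ u) = lexv 0 (o (ρ' u)) := fun u hu => by
    have := h3 0 u hu
    simpa [lexv_zero] using this
  have hoC : ∀ s : κ', o (C s) = 0 := fun s => by
    show ((C s).rootMultiplicity (bb ^ m) : ℤ) = 0
    rw [rootMultiplicity_C]; rfl
  have hρT : ∀ T w s, ρ T = X → ρ w = C s → ρ' (AdjoinRoot.of _ T -
      AdjoinRoot.of _ w * AdjoinRoot.root _ ^ m) = X - C (AdjoinRoot.of _ s * bb ^ m) := by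
    intro T w s hT hw
    rw [map_sub, map_mul, map_pow, hr1, hr1, hr2, hT, hw, map_X, map_C, C_mul, C_pow]
  have hρ1 : ρ' 1 ≠ 0 := by rw [map_one]; exact one_ne_zero
  refine ⟨Ω, inferInstance, ψ.comp (AdjoinRoot.of _), ψ (AdjoinRoot.root _), σ, v, ν,
    ?_, ?_, ?_, ?_, ?_, ?_, ?_, ?_, ?_, ?_, h4, ?_, h6, ?_, h9⟩
  · intro a; rw [RingHom.comp_apply, h1, hσA1]
  · rw [h1, hσA2, map_mul]; rfl
  · rw [← map_pow, hbA]; rfl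
  · intro a ha
    refine hv0 _ ?_
    rw [hr1]
    exact (Polynomial.map_ne_zero_iff hmapinj).2 ha
  · have := h2 1 1 hρ1
    simpa using this
  · have := h3 1 1 hρ1
    rw [map_one, ho.one] at this
    simpa using this
  · intro a s ha hs0
    rw [RingHom.comp_apply, hν0, hr1, ha, map_C, hoC, lexv_zero]
    rw [hr1, ha, map_C]
    exact C_ne_zero.2 ((_root_.map_ne_zero _).2 hs0)
  · intro T w s hT hw
    have := hv0 _ (by rw [hρT T w s hT hw]; exact X_sub_C_ne_zero _)
    simpa using this
  · intro T w hT hw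
    have := hν0 _ (by rw [hρT T w 1 hT (by simpa using hw)]; exact X_sub_C_ne_zero _)
    rw [hρT T w 1 hT (by simpa using hw), map_one, one_mul] at this
    have h10 : o (X - C (bb ^ m)) = 1 := by
      show ((X - C (bb ^ m)).rootMultiplicity (bb ^ m) : ℤ) = 1
      rw [rootMultiplicity_X_sub_C_self]; rfl
    rw [h10] at this
    simpa using this
  · intro T w s hT hw hs1
    have := hν0 _ (by rw [hρT T w s hT hw]; exact X_sub_C_ne_zero _)
    rw [hρT T w s hT hw] at this
    have h10 : o (X - C (AdjoinRoot.of _ s * bb ^ m)) = 0 := by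
      show ((X - C (AdjoinRoot.of _ s * bb ^ m)).rootMultiplicity (bb ^ m) : ℤ) = 0
      rw [rootMultiplicity_X_sub_C, if_neg]; · rfl
      intro h11
      apply hs1
      apply hmapinj
      rw [map_one]
      exact mul_right_cancel₀ (pow_ne_zero m hbb0) (by rw [one_mul]; exact h11.symm)
    rw [h10, lexv_zero] at this
    simpa using this
  · refine h5 e ?_
    intro d hd
    have hit : ∀ i, (mapRingHom σk)^[i] d = d.map (σk ^ i) := by
      intro i
      induction i with
      | zero => simp [RingHom.one_def]
      | succ i ih =>
        rw [Function.iterate_succ_apply', ih, coe_mapRingHom, Polynomial.map_map, pow_succ']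
        rfl
    rw [hit]
    have hfix : (σk ^ e) (bb ^ m) = bb ^ m := by
      rw [map_pow, RingHom.coe_pow, hσki, mul_pow, ← pow_mul, ← hnem, ← map_pow,
        hζ.pow_eq_one, map_one, one_mul]
    have := eq_rootMultiplicity_map (p := d) (σk ^ e).injective (bb ^ m)
    rw [hfix] at this
    show ((d.map (σk ^ e)).rootMultiplicity (bb ^ m) : ℤ) = d.rootMultiplicity (bb ^ m)
    rw [← this]
  · intro a ha
    have := h7 _ ha
    rw [hr1] at this
    exact (Polynomial.map_eq_zero_iff hmapinj).1 this


theorem gal_chars (F : Type) [Field F] [CharZero F] (n : ℕ) [NeZero n] (hn : 1 < n) :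
    ∃ χ a : (CyclotomicField n F ≃ₐ[F] CyclotomicField n F) → ℕ,
      (∀ ζ : CyclotomicField n F, IsPrimitiveRoot ζ n → ∀ g, g ζ = ζ ^ χ g) ∧
      (∀ g, χ g ≡ 1 [MOD n] → g = 1) ∧ χ 1 = 1 ∧ a 1 = 1 ∧
      ∀ d g, (n : ℤ) ∣ (a (d⁻¹ * g) : ℤ) - χ d * a g := by
  haveI : Fact (1 < n) := ⟨hn⟩
  have hz := IsCyclotomicExtension.zeta_spec n F (CyclotomicField n F)
  have hinj := hz.autToPow_injective (K := F)
  let c := hz.autToPow F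
  refine ⟨fun g => (c g : ZMod n).val, fun g => ((c g)⁻¹ : (ZMod n)ˣ).1.val, ?_, ?_, ?_, ?_, ?_⟩
  · intro ζ hζ g
    obtain ⟨k, _, rfl⟩ := hz.eq_pow_of_pow_eq_one hζ.pow_eq_one
    rw [map_pow, ← hz.autToPow_spec F g, ← pow_mul, ← pow_mul, mul_comm]
  · intro g hg
    have : (c g : ZMod n) = 1 := by
      have h2 := (ZMod.natCast_eq_natCast_iff _ _ _).2 hg
      rwa [ZMod.natCast_zmod_val, Nat.cast_one] at h2
    apply hinj
    rw [map_one]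
    exact Units.ext this
  · simp only [map_one, Units.val_one]; exact ZMod.val_one n
  · simp only [map_one, inv_one, Units.val_one]; exact ZMod.val_one n
  · intro d g
    rw [← ZMod.intCast_zmod_eq_zero_iff_dvd]
    push_cast
    simp only [ZMod.natCast_val, ZMod.cast_id', id_eq]
    rw [map_mul, map_inv, mul_inv, inv_inv, Units.val_mul, sub_self]

theorem embedK {F Ω : Type} [Field F] [CharZero F] [Field Ω] (n : ℕ) [NeZero n]
    (φ : F →+* Ω) (ω : Ω) (hω : IsPrimitiveRoot ω n) :
    ∃ (f0 : CyclotomicField n F →+* Ω) (ζ : CyclotomicField n F), IsPrimitiveRoot ζ n ∧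
      f0 ζ = ω ∧ ∀ c, f0 (algebraMap F _ c) = φ c := by
  letI := φ.toAlgebra
  have hz := IsCyclotomicExtension.zeta_spec n F (CyclotomicField n F)
  have hsp : ((Polynomial.cyclotomic n F).map (algebraMap F Ω)).Splits := by
    rw [Polynomial.map_cyclotomic]
    have h1 := Polynomial.X_pow_sub_one_splits hω
    refine h1.of_dvd ?_ (Polynomial.cyclotomic.dvd_X_pow_sub_one n Ω)
    exact Polynomial.X_pow_sub_C_ne_zero (NeZero.pos n) 1
  let f : CyclotomicField n F →ₐ[F] Ω := Polynomial.SplittingField.lift _ hsp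
  have h1 : IsPrimitiveRoot (f (IsCyclotomicExtension.zeta n F (CyclotomicField n F))) n :=
    hz.map_of_injective f.injective
  obtain ⟨k, _, hk⟩ := h1.eq_pow_of_pow_eq_one hω.pow_eq_one
  refine ⟨f, IsCyclotomicExtension.zeta n F (CyclotomicField n F) ^ k, ?_, ?_, ?_⟩
  · refine IsPrimitiveRoot.of_map_of_injective (f := f) ?_ f.injective
    rw [map_pow, hk]; exact hω
  · show f _ = _
    rw [map_pow, hk]
  · intro c; exact f.commutes c

open Polynomial in
theorem kummer_irr {K Ω : Type} [Field K] [Field Ω] (f0 : K →+* Ω) (n : ℕ) (hn : 0 < n) (ζ : K)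
    (hζ : IsPrimitiveRoot ζ n) (z : K) (β : Ω) (hβ0 : β ≠ 0) (hβ : β ^ n = f0 z)
    (σ : Ω →+* Ω) (hσ : ∀ c, σ (f0 c) = f0 c) (hσβ : σ β = f0 ζ * β) :
    Irreducible (X ^ n - C z : Polynomial K) := by
  classical
  letI := f0.toAlgebra
  have hal : ∀ c, algebraMap K Ω c = f0 c := fun c => rfl
  have hmon : (X ^ n - C z : Polynomial K).Monic := monic_X_pow_sub_C z hn.ne'
  have hroot : aeval β (X ^ n - C z : Polynomial K) = 0 := by
    simp [hal, hβ]
  have hIntg : IsIntegral K β := ⟨_, hmon, hroot⟩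
  have hdvd := minpoly.dvd K β hroot
  have hit : ∀ i, σ^[i] β = f0 ζ ^ i * β := by
    intro i
    induction i with
    | zero => simp
    | succ i ih => rw [Function.iterate_succ_apply', ih, map_mul, map_pow, hσ, hσβ]; ring
  have hr : ∀ i, aeval (f0 ζ ^ i * β) (minpoly K β) = 0 := by
    intro i
    rw [← hit]
    induction i with
    | zero => exact minpoly.aeval K β
    | succ i ih =>
      rw [Function.iterate_succ_apply']
      let σK : Ω →ₐ[K] Ω := { σ with commutes' := hσ }
      have : aeval (σK (σ^[i] β)) (minpoly K β) = 0 := by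
        rw [aeval_algHom_apply, ih, map_zero]
      exact this
  have hdeg : n ≤ (minpoly K β).natDegree := by
    have hz := (hζ.map_of_injective f0.injective)
    have hinj : Set.InjOn (fun i : ℕ => f0 ζ ^ i * β) (Finset.range n : Set ℕ) := by
      intro i hi j hj hij
      exact hz.pow_inj (by simpa using hi) (by simpa using hj) (mul_right_cancel₀ hβ0 hij)
    have hc := Finset.card_image_of_injOn hinj
    rw [Finset.card_range] at hc
    rw [← hc, ← natDegree_map f0]
    refine le_trans (Finset.card_le_card (t := ((minpoly K β).map f0).roots.toFinset) ?_)
      ((Multiset.toFinset_card_le _).trans (card_roots' _))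
    intro y hy
    obtain ⟨i, _, rfl⟩ := Finset.mem_image.1 hy
    rw [Multiset.mem_toFinset, mem_roots, IsRoot, eval_map]
    · exact hr i
    · exact (Polynomial.map_ne_zero_iff f0.injective).2 (minpoly.ne_zero hIntg)
  have heq : minpoly K β = X ^ n - C z := by
    refine Eq.symm (eq_of_monic_of_dvd_of_natDegree_le (minpoly.monic hIntg) hmon hdvd ?_)
    rw [natDegree_X_pow_sub_C]; exact hdeg
  rw [← heq]
  exact minpoly.irreducible hIntg

theorem trace_val {Ω G : Type} [Field Ω] [Fintype G] [Group G] (v ν : Valuation Ω LexZ)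
    (hc : ∀ x y, v x < v y → ν x < ν y) (f : G → Ω) (h1 : v (f 1) = 1)
    (h2 : ∀ d, d ≠ 1 → v (f d) < 1) : v (∑ d, f d) = 1 ∧ ν (∑ d, f d) = ν (f 1) := by
  classical
  rw [← Finset.add_sum_erase _ _ (Finset.mem_univ (1 : G))]
  have h3 : v (∑ d ∈ Finset.univ.erase 1, f d) < v (f 1) := by
    rw [h1]
    refine Valuation.map_sum_lt v one_ne_zero ?_
    intro d hd
    exact h2 d (Finset.ne_of_mem_erase hd)
  exact ⟨(Valuation.map_add_eq_of_lt_left v h3).trans h1,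
    Valuation.map_add_eq_of_lt_left ν (hc _ _ h3)⟩


/-- The local model data. -/
structure Iface (F : Type) [Field F] (n : ℕ) {A κ : Type} [CommRing A] [Field κ] (ϖ : A)
    (ρ : A →+* Polynomial κ) (ζA : A) (ζk : κ) (xA : A) (c0 M : ℕ) (TA u : A) (fx fπ : F)
    (sF : κ → F) (sA : κ → A) : Prop where
  red : RedData ϖ ρ
  surj : Function.Surjective ρ
  ζn : ζA ^ n = 1
  ρζ : ρ ζA = Polynomial.C ζk
  prim : IsPrimitiveRoot ζk n
  xeq : xA = ζA + (c0 : A) + ϖ ^ M * TA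
  ρT : ρ TA = Polynomial.X
  ρx : ρ xA = Polynomial.C ζk
  ρu : ρ u = 1
  ρs : ∀ s, ρ (sA s) = Polynomial.C s
  emb : ∀ (Ω : Type) [Field Ω] (ψ : A →+* Ω), ψ ϖ ≠ 0 → (∀ a, ψ a = 0 → ρ a = 0) →
    ∃ φ : F →+* Ω, φ fx = ψ xA ∧ φ fπ = ψ (ϖ * u) ∧ (∀ s, φ (sF s) = ψ (sA s)) ∧
      ∀ σ : Ω →+* Ω, (∀ a, σ (ψ a) = ψ a) → ∀ f, σ (φ f) = φ f

section
variable {G : Type} [Group G] [Fintype G] [DecidableEq G]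

/-- the product over nontrivial elements -/
noncomputable def EA {R : Type} [CommRing R] (χ : G → ℕ) (x ζ : R) (g : G) : R :=
  ∏ h ∈ Finset.univ.erase (1 : G), (x - ζ ^ χ (g * h))

theorem EA_map {R S : Type} [CommRing R] [CommRing S] (f : R →+* S) (χ : G → ℕ) (x ζ : R) (g : G) :
    f (EA χ x ζ g) = EA χ (f x) (f ζ) g := by
  unfold EA
  rw [map_prod]
  refine Finset.prod_congr rfl fun h _ => ?_
  rw [map_sub, map_pow]

theorem EA_zero {R : Type} [CommRing R] (χ : G → ℕ) (hχ : χ 1 = 1) (x : R) (g : G) (hg : g ≠ 1) :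
    EA χ x x g = 0 := by
  unfold EA
  refine Finset.prod_eq_zero (i := g⁻¹) ?_ ?_
  · simpa using hg
  · rw [mul_inv_cancel, hχ, pow_one, sub_self]

theorem EA_ne {κ : Type} [Field κ] (χ : G → ℕ) (n : ℕ) (hn : 0 < n)
    (hχ : ∀ g, χ g ≡ 1 [MOD n] → g = 1)
    (ζ : κ) (hζ : IsPrimitiveRoot ζ n) : EA χ ζ ζ 1 ≠ 0 := by
  unfold EA
  refine Finset.prod_ne_zero_iff.2 fun h hh h0 => ?_
  rw [one_mul, sub_eq_zero] at h0
  apply Finset.ne_of_mem_erase hh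
  apply hχ
  have h1 : ζ ^ χ h = ζ ^ 1 := by rw [← h0, pow_one]
  rw [hζ.eq_orderOf]
  exact ((isOfFinOrder_iff_pow_eq_one.2 ⟨n, hn, hζ.pow_eq_one⟩).pow_eq_pow_iff_modEq.1 h1)

end

theorem lexz_pow_one (x : LexZ) (n : ℕ) (hn : n ≠ 0) (h : x ^ n = 1) : x = 1 := by
  have hx : x ≠ 0 := by
    rintro rfl
    rw [zero_pow hn] at h
    exact zero_ne_one h
  obtain ⟨i, j, rfl⟩ := lexv_exists x hx
  rw [lexv_pow, ← lexv_zero, lexv_inj] at h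
  have hn' : (n : ℤ) ≠ 0 := by exact_mod_cast hn
  rw [(mul_eq_zero.1 h.1).resolve_left hn', (mul_eq_zero.1 h.2).resolve_left hn', lexv_zero]

theorem lay2_le {A κ : Type} [CommRing A] [Field κ] {ϖ : A} {ρ : A →+* Polynomial κ}
    (h : RedData ϖ ρ) {n m e : ℕ} {zA ζA : A} {Ω : Type} [Field Ω] {ψ : A →+* Ω} {β : Ω}
    {σ : Ω →+* Ω} {v ν : Valuation Ω LexZ} (H : Lay2 ϖ ρ n m e zA ζA Ω ψ β σ v ν) (a : A) :
    v (ψ a) ≤ 1 := by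
  by_cases ha : ρ a = 0
  · have h1 : v (ψ (1 + a)) = 1 := H.vψ _ (by rw [map_add, ha, map_one, add_zero]; exact one_ne_zero)
    have h2 : ψ a = ψ (1 + a) - 1 := by rw [map_add, map_one]; ring
    rw [h2]
    exact (Valuation.map_sub v _ _).trans (by rw [h1, map_one, max_self])
  · exact (H.vψ a ha).le

theorem lay2_lt {A κ : Type} [CommRing A] [Field κ] {ϖ : A} {ρ : A →+* Polynomial κ}
    (h : RedData ϖ ρ) {n m e : ℕ} {zA ζA : A} {Ω : Type} [Field Ω] {ψ : A →+* Ω} {β : Ω}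
    {σ : Ω →+* Ω} {v ν : Valuation Ω LexZ} (H : Lay2 ϖ ρ n m e zA ζA Ω ψ β σ v ν) (a : A)
    (ha : ρ a = 0) :
    v (ψ a) ≤ lexv 1 0 := by
  obtain ⟨b, rfl⟩ := h.ker a ha
  rw [map_mul, map_mul, H.vϖ]
  exact mul_le_of_le_one_right' (lay2_le h H b)

theorem second_half {F K : Type} [Field F] [Field K] [Algebra F K] [FiniteDimensional F K]
    [IsGalois F K] (n m e : ℕ) (hn : 0 < n) (hnem : n = e * m) (ζ : K) (hζ : IsPrimitiveRoot ζ n)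
    (χ : (K ≃ₐ[F] K) → ℕ) (hχ : ∀ g, g ζ = ζ ^ χ g) (α : (K ≃ₐ[F] K) → ℤ)
    (hα : ∀ d g, (n : ℤ) ∣ α (d⁻¹ * g) - χ d * α g)
    {A κ : Type} [CommRing A] [Field κ] {ϖ : A} {ρ : A →+* Polynomial κ}
    (hred : RedData ϖ ρ) {zA ζA : A} {Ω : Type} [Field Ω] {ψ : A →+* Ω} {β : Ω}
    {σΩ : Ω →+* Ω} {v ν : Valuation Ω LexZ} (H : Lay2 ϖ ρ n m e zA ζA Ω ψ β σΩ v ν)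
    (f0 : K →+* Ω) (hf0ζ : f0 ζ = ψ ζA) (hσf0 : ∀ c, σΩ (f0 c) = f0 c)
    (tK : K) (htK : tK ≠ 0) (hvP : ∀ w : (K ≃ₐ[F] K) → ℤ, v (f0 (Pz tK w)) = 1)
    (hβv : v β = 1) (hβn : β ^ n = f0 (Pz tK α))
    (hKirr : Irreducible (Polynomial.X ^ n - Polynomial.C (Pz tK α)))
    (E : K) (E' : (K ≃ₐ[F] K) → A) (hfE : ∀ g : K ≃ₐ[F] K, f0 (g E) = ψ (E' g))
    (hρE1 : ∀ g, g ≠ 1 → ρ (E' g) = 0) (η : κ) (hη : η ≠ 0) (hρE : ρ (E' 1) = Polynomial.C η)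
    (ζk : κ) (hρζ : ρ ζA = Polynomial.C ζk) (hζk : IsPrimitiveRoot ζk n)
    (xA : A) (c0 M : ℕ) (TA u : A) (fx fπ : F)
    (hfx : f0 (algebraMap F K fx) = ψ xA) (hfπ : f0 (algebraMap F K fπ) = ψ (ϖ * u))
    (hx : xA = ζA + (c0 : A) + ϖ ^ M * TA) (hρT : ρ TA = Polynomial.X) (hρu : ρ u = 1) :
    ∃ (L : Type) (_ : Field L) (_ : Algebra F L) (σ : L ≃ₐ[F] L) (v ν : Valuation L LexZ)
      (c : F) (hh : L), CycData F L σ n ∧ (∀ x y, v x < v y → ν x < ν y) ∧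
      (∀ x, v (σ x) = v x) ∧ (∀ x, ν ((σ ^ e) x) = ν x) ∧ c ≠ 0 ∧
      (∀ (g : L) (i : ℕ), v (g ^ n) = v (algebraMap F L c ^ i) → m ∣ i) ∧
      (∀ (g : L) (i : ℕ), ν (g ^ n) = ν (algebraMap F L c ^ i) → n ∣ i) ∧
      (σ ^ e) hh = hh ∧ algebraMap F L c = ∏ i ∈ Finset.range e, (σ ^ i) hh := by
  classical
  have he0 : 0 < e := Nat.pos_of_ne_zero (by rintro rfl; simp at hnem; omega)
  have hvπlt : lexv 1 0 < (1 : LexZ) := by rw [← lexv_zero, lexv_lt]; left; norm_num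
  have hψϖ : ψ ϖ ≠ 0 := by
    intro h0
    have := H.vϖ
    rw [h0, map_zero] at this
    exact lexv_ne_zero _ _ this.symm
  haveI : Fact (Irreducible (Polynomial.X ^ n - Polynomial.C (Pz tK α))) := ⟨hKirr⟩
  let P : Polynomial K := Polynomial.X ^ n - Polynomial.C (Pz tK α)
  have hP : P = Polynomial.X ^ n - Polynomial.C (Pz tK α) := rfl
  haveI : Fact (Irreducible P) := ⟨hKirr⟩
  have hPm : P.Monic := Polynomial.monic_X_pow_sub_C _ hn.ne'
  let N := AdjoinRoot P
  letI : Field N := AdjoinRoot.instField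
  let b0 : N := AdjoinRoot.root P
  have hal : ∀ c, algebraMap K N c = AdjoinRoot.of P c := fun c => rfl
  have hb0 : b0 ^ n = algebraMap K N (Pz tK α) := by
    have := AdjoinRoot.eval₂_root P
    have h2 : b0 ^ n - AdjoinRoot.of P (Pz tK α) = 0 := by
      simpa only [hP, Polynomial.eval₂_sub, Polynomial.eval₂_X_pow, Polynomial.eval₂_C] using this
    exact sub_eq_zero.1 h2
  have hdim : Module.finrank K N = n := by
    have := (AdjoinRoot.powerBasis (K := K) (f := P) hPm.ne_zero).finrank
    rw [AdjoinRoot.powerBasis_dim] at this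
    rw [this, hP, Polynomial.natDegree_X_pow_sub_C]
  haveI : FiniteDimensional K N := Module.finite_of_finrank_pos (by rw [hdim]; exact hn)
  haveI : FiniteDimensional F N := FiniteDimensional.trans F K N
  obtain ⟨σ, Δ, hσb, hσK, hΔK, hcomm, hfix, hσn⟩ := kummer_descent (F := F) (N := N) n hn ζ hζ χ hχ α
    hα tK htK b0 hb0 hdim (by
      intro g b hb
      refine ⟨AdjoinRoot.lift g b ?_, fun c => AdjoinRoot.lift_of _, AdjoinRoot.lift_root _⟩
      simp [hP, hb]) (by
      intro G G' h1 h2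
      exact AdjoinRoot.ringHom_ext (RingHom.ext h1) h2)
  let j : N →+* Ω := AdjoinRoot.lift f0 β (by simp [hP, hβn])
  have hjK : ∀ c, j (algebraMap K N c) = f0 c := fun c => AdjoinRoot.lift_of _
  have hjb : j b0 = β := AdjoinRoot.lift_root _
  have hjσ : ∀ x, j (σ x) = σΩ (j x) := by
    have : j.comp (σ : N →+* N) = σΩ.comp j := by
      refine AdjoinRoot.ringHom_ext (RingHom.ext fun c => ?_) ?_
      · show j (σ (algebraMap K N c)) = σΩ (j (algebraMap K N c))
        rw [hσK, hjK, hσf0]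
      · show j (σ b0) = σΩ (j b0)
        rw [hσb, map_mul, hjK, hjb, hf0ζ, H.σβ]
    exact fun x => DFunLike.congr_fun this x
  have hjσi : ∀ i x, j ((σ ^ i) x) = σΩ^[i] (j x) := by
    intro i
    induction i with
    | zero => intro x; rfl
    | succ i ih =>
      intro x
      rw [pow_succ', AlgEquiv.mul_apply, hjσ, ih, Function.iterate_succ_apply']
  have hσiK : ∀ i c, (σ ^ i) (algebraMap K N c) = algebraMap K N c := by
    intro i
    induction i with
    | zero => intro x; rfl
    | succ i ih => intro x; rw [pow_succ', AlgEquiv.mul_apply, ih, hσK]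
  have hσib : ∀ i, (σ ^ i) b0 = algebraMap K N ζ ^ i * b0 := by
    intro i
    induction i with
    | zero => simp
    | succ i ih =>
      rw [pow_succ', AlgEquiv.mul_apply, ih, map_mul, map_pow, hσK, hσb]; ring
  have hσiΔ : ∀ i d x, (σ ^ i) (Δ d x) = Δ d ((σ ^ i) x) := by
    intro i
    induction i with
    | zero => intro d x; rfl
    | succ i ih =>
      intro d x; rw [pow_succ', AlgEquiv.mul_apply, ih, hcomm, AlgEquiv.mul_apply]
  have hvΔ : ∀ d, v (j (Δ d b0)) = 1 := by
    intro d
    have h1 : v (j (Δ d b0)) ^ n = 1 := by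
      rw [← map_pow, ← map_pow, ← map_pow, hb0, hΔK, hjK, Pz_map, hvP]
    exact lexz_pow_one _ n hn.ne' h1
  have hvE1 : v (f0 E) = 1 := by
    have := hfE 1
    rw [AlgEquiv.one_apply] at this
    rw [this]
    exact H.vψ _ (by rw [hρE]; exact Polynomial.C_ne_zero.2 hη)
  have hvE : ∀ d : K ≃ₐ[F] K, d ≠ 1 → v (f0 (d E)) ≤ lexv 1 0 := by
    intro d hd; rw [hfE]; exact lay2_lt hred H _ (hρE1 d hd)
  have hvζ : ∀ d : K ≃ₐ[F] K, v (f0 (d ζ)) = 1 := by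
    intro d
    have h1 : v (f0 (d ζ)) ^ n = 1 := by
      rw [← map_pow, ← map_pow, ← map_pow, hζ.pow_eq_one, map_one, map_one, map_one]
    exact lexz_pow_one _ n hn.ne' h1
  let Tr : N → N := fun x => ∑ d, Δ d x
  have hTrΔ : ∀ x d, Δ d (Tr x) = Tr x := by
    intro x d
    show Δ d (∑ d', Δ d' x) = ∑ d', Δ d' x
    rw [map_sum]
    refine Fintype.sum_equiv (Equiv.mulLeft d) _ _ fun d' => ?_
    rw [Equiv.coe_mulLeft, map_mul, AlgEquiv.mul_apply]
  have hTrσ : ∀ i x, (σ ^ i) (Tr x) = Tr ((σ ^ i) x) := by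
    intro i x
    show (σ ^ i) (∑ d', Δ d' x) = ∑ d', Δ d' ((σ ^ i) x)
    rw [map_sum]
    exact Finset.sum_congr rfl fun d _ => hσiΔ i d x
  have hTrv : ∀ x, v (j x) = 1 → (∀ d, d ≠ 1 → v (j (Δ d x)) < 1) →
      v (j (Tr x)) = 1 ∧ ν (j (Tr x)) = ν (j x) := by
    intro x h1 h2
    have h3 : j (Tr x) = ∑ d, j (Δ d x) := map_sum j _ _
    rw [h3]
    have h4 : j (Δ 1 x) = j x := by rw [map_one]; rfl
    have := trace_val v ν H.coarse (fun d => j (Δ d x)) (by rw [h4]; exact h1) h2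
    rw [h4] at this
    exact this
  -- lambda
  let lam : N := Tr (algebraMap K N E * b0)
  have hlam : ∀ i, 0 < i → i < n → (σ ^ i) lam ≠ lam := by
    intro i hi0 hin h0
    have h1 : Tr (algebraMap K N (E * (ζ ^ i - 1)) * b0) = (σ ^ i) lam - lam := by
      have hl0 : (σ ^ i) lam = Tr (algebraMap K N E * (algebraMap K N ζ ^ i * b0)) := by
        show (σ ^ i) (Tr (algebraMap K N E * b0)) = _
        rw [hTrσ, map_mul (σ ^ i), hσiK, hσib]
      rw [hl0]
      show ∑ d, Δ d _ = ∑ d, Δ d _ - ∑ d, Δ d _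
      rw [← Finset.sum_sub_distrib]
      refine Finset.sum_congr rfl fun d _ => ?_
      rw [← map_sub]
      congr 1
      rw [map_mul, map_sub, map_pow, map_one]; ring
    have hζi : v (f0 (ζ ^ i - 1)) = 1 := by
      have : f0 (ζ ^ i - 1) = ψ (ζA ^ i - 1) := by
        rw [map_sub, map_pow, hf0ζ, map_one, map_sub, map_pow, map_one]
      rw [this]
      refine H.vψ _ ?_
      rw [map_sub, map_pow, map_one, hρζ, ← Polynomial.C_pow, ← Polynomial.C_1, ← Polynomial.C_sub]
      refine Polynomial.C_ne_zero.2 (sub_ne_zero.2 fun h => ?_)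
      exact absurd (Nat.le_of_dvd hi0 (hζk.dvd_of_pow_eq_one i h)) (by omega)
    have h2 := (hTrv (algebraMap K N (E * (ζ ^ i - 1)) * b0) (by
      rw [map_mul, hjK, map_mul, hjb, map_mul, map_mul, hvE1, hζi, hβv, one_mul, one_mul]) (by
      intro d hd
      rw [map_mul, hΔK, map_mul, hjK, map_mul, map_mul, map_mul, map_mul, hvΔ, mul_one]
      refine lt_of_le_of_lt (mul_le_mul' (hvE d hd) (?_ : _ ≤ (1 : LexZ))) (by rwa [mul_one])
      rw [map_sub, map_pow, map_one, map_sub, map_pow, map_one]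
      refine (Valuation.map_sub v _ _).trans ?_
      rw [map_pow, hvζ, one_pow, map_one, max_self])).1
    rw [h1, h0, sub_self, map_zero, map_zero] at h2
    exact zero_ne_one h2
  obtain ⟨L, s, hcyc, hs, hL⟩ := cyc_of_fixed n hn σ Δ hcomm hσn hfix lam (hTrΔ _) hlam
  -- the element hh
  let μ : K := algebraMap F K fx - ζ - c0
  let Y : ℕ → N := fun i => algebraMap K N (E ^ (M + 1)) *
    (algebraMap K N (μ / algebraMap F K fπ ^ M) - algebraMap K N ζ ^ (i * m) * b0 ^ m)
  have hYσ : ∀ i, (σ ^ i) (Y 0) = Y i := by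
    intro i
    show (σ ^ i) (algebraMap K N (E ^ (M + 1)) *
      (algebraMap K N (μ / algebraMap F K fπ ^ M) - algebraMap K N ζ ^ (0 * m) * b0 ^ m)) = _
    rw [zero_mul, pow_zero, one_mul, map_mul (σ ^ i), map_sub (σ ^ i), map_pow (σ ^ i) b0, hσiK, hσiK, hσib,
      mul_pow, ← pow_mul]
  have hvfπ : v (f0 (algebraMap F K fπ)) = lexv 1 0 := by
    rw [hfπ, map_mul, map_mul, H.vϖ, H.vψ u (by rw [hρu]; exact one_ne_zero), mul_one]
  have hνfπ : ν (f0 (algebraMap F K fπ)) = lexv 1 0 := by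
    rw [hfπ, map_mul, map_mul, H.νϖ, H.νψ u 1 (by rw [hρu, Polynomial.C_1]) one_ne_zero, mul_one]
  have hψu : ψ u ≠ 0 := by
    intro h0
    have := H.ker _ h0
    rw [hρu] at this
    exact one_ne_zero this
  have hjY : ∀ i, j (Y i) = ψ (E' 1) ^ (M + 1) * (ψ TA - ψ (ζA ^ (i * m) * u ^ M) * β ^ m) /
      ψ u ^ M := by
    intro i
    show j (algebraMap K N (E ^ (M + 1)) *
      (algebraMap K N (μ / algebraMap F K fπ ^ M) - algebraMap K N ζ ^ (i * m) * b0 ^ m)) = _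
    have h1 : f0 E = ψ (E' 1) := hfE 1
    have h2 : f0 μ = ψ ϖ ^ M * ψ TA := by
      show f0 (algebraMap F K fx - ζ - c0) = _
      rw [map_sub, map_sub, hfx, hf0ζ, map_natCast, hx]
      simp only [map_add, map_mul, map_pow, map_natCast]
      ring
    simp only [map_mul j, map_sub j, map_pow j, hjK, hjb, map_div₀ f0, h2, map_pow f0, hfπ, h1, hf0ζ,
      map_mul ψ, map_pow ψ]
    field_simp
    ring
  have hζkpow : ∀ i, ρ (ζA ^ (i * m) * u ^ M) = Polynomial.C (ζk ^ (i * m)) := by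
    intro i
    rw [map_mul, map_pow, map_pow, hρu, hρζ, one_pow, mul_one, Polynomial.C_pow]
  have hvu : v (ψ u) = 1 := H.vψ u (by rw [hρu]; exact one_ne_zero)
  have hνu : ν (ψ u) = 1 := H.νψ u 1 (by rw [hρu, Polynomial.C_1]) one_ne_zero
  have hvY : ∀ i, v (j (Y i)) = 1 := by
    intro i
    rw [hjY, map_div₀, map_mul, map_pow, map_pow, hvu, H.vT _ _ _ hρT (hζkpow i),
      H.vψ _ (by rw [hρE]; exact Polynomial.C_ne_zero.2 hη)]
    simp
  have hνY : ∀ i, i < e → ν (j (Y i)) = lexv 0 (if i = 0 then 1 else 0) := by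
    intro i hi
    rw [hjY, map_div₀, map_mul, map_pow, map_pow, hνu, H.νψ _ _ hρE hη]
    split_ifs with h0
    · rw [H.νT _ _ hρT (by rw [hζkpow, h0, zero_mul, pow_zero, Polynomial.C_1])]
      simp
    · rw [H.νT' _ _ _ hρT (hζkpow i), lexv_zero]
      · simp
      · intro h1
        have h2 := hζk.dvd_of_pow_eq_one _ h1
        rw [hnem] at h2
        have hm0 : 0 < m := Nat.pos_of_ne_zero (by rintro rfl; simp at hnem; omega)
        have := Nat.le_of_dvd (by omega) (Nat.dvd_of_mul_dvd_mul_right hm0 h2)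
        omega
  have hvYd : ∀ i d, d ≠ 1 → v (j (Δ d (Y i))) < 1 := by
    intro i d hd
    show v (j (Δ d (algebraMap K N (E ^ (M + 1)) *
      (algebraMap K N (μ / algebraMap F K fπ ^ M) - algebraMap K N ζ ^ (i * m) * b0 ^ m)))) < 1
    have h2 : v (f0 (d μ)) ≤ 1 := by
      have : f0 (d μ) = ψ (xA - ζA ^ χ d - c0) := by
        show f0 (d (algebraMap F K fx - ζ - c0)) = _
        simp only [map_sub, map_natCast, AlgEquiv.commutes, hχ, hfx, map_pow, hf0ζ]
      rw [this]
      exact lay2_le hred H _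
    have h3 := hvE d hd
    have h4 : v (f0 (d E)) < 1 := lt_of_le_of_lt h3 hvπlt
    rw [mul_sub, map_sub, map_sub]
    refine lt_of_le_of_lt (Valuation.map_sub v _ _) (max_lt ?_ ?_)
    · rw [← map_mul, hΔK, hjK, map_mul, map_mul, map_mul, map_pow, map_pow, map_pow, map_div₀,
        map_div₀, map_div₀, map_pow, map_pow, map_pow, AlgEquiv.commutes, hvfπ, pow_succ]
      have hp0 : (0 : LexZ) < lexv 1 0 ^ M := by
        rw [zero_lt_iff]; exact pow_ne_zero _ (lexv_ne_zero _ _)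
      calc v (f0 (d E)) ^ M * v (f0 (d E)) * (v (f0 (d μ)) / lexv 1 0 ^ M)
          ≤ lexv 1 0 ^ M * v (f0 (d E)) * (1 / lexv 1 0 ^ M) := by
            gcongr
        _ = v (f0 (d E)) := by field_simp
        _ < 1 := h4
    · simp only [map_mul (Δ d), map_pow (Δ d), hΔK, map_mul j, map_pow j, hjK, map_mul v, map_pow v,
        hvζ, hvΔ, one_pow, mul_one, map_pow d, map_pow f0]
      exact pow_lt_one₀ zero_le h4 (by omega)
  let hhN : N := algebraMap F N fπ * Tr (Y 0)
  have hσhh : ∀ i, (σ ^ i) hhN = algebraMap F N fπ * Tr (Y i) := by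
    intro i
    show (σ ^ i) (algebraMap F N fπ * Tr (Y 0)) = _
    rw [map_mul, AlgEquiv.commutes, hTrσ, hYσ]
  have hhL : hhN ∈ L := by
    rw [hL]
    intro d
    show Δ d (algebraMap F N fπ * Tr (Y 0)) = _
    rw [map_mul, AlgEquiv.commutes, hTrΔ]
  have hjF : ∀ c, j (algebraMap F N c) = f0 (algebraMap F K c) := by
    intro c; rw [IsScalarTower.algebraMap_apply F K N, hjK]
  have hvhh : ∀ i, v (j ((σ ^ i) hhN)) = lexv 1 0 := by
    intro i
    rw [hσhh, map_mul, map_mul, hjF, hvfπ, (hTrv (Y i) (hvY i) (hvYd i)).1, mul_one]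
  have hνhh : ∀ i, i < e → ν (j ((σ ^ i) hhN)) = lexv 1 (if i = 0 then 1 else 0) := by
    intro i hi
    rw [hσhh, map_mul, map_mul, hjF, hνfπ, (hTrv (Y i) (hvY i) (hvYd i)).2, hνY i hi, lexv_mul]
    simp
  let hh : L := ⟨hhN, hhL⟩
  have hsi : ∀ i (x : L), ((s ^ i) x : N) = (σ ^ i) x := by
    intro i
    induction i with
    | zero => intro x; rfl
    | succ i ih => intro x; rw [pow_succ', pow_succ', AlgEquiv.mul_apply, AlgEquiv.mul_apply, hs, ih]
  have hhe : (s ^ e) hh = hh := by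
    apply Subtype.ext
    rw [hsi, hσhh]
    show _ = algebraMap F N fπ * Tr (Y 0)
    have : Y e = Y 0 := by
      show algebraMap K N (E ^ (M + 1)) * (algebraMap K N (μ / algebraMap F K fπ ^ M) -
        algebraMap K N ζ ^ (e * m) * b0 ^ m) = algebraMap K N (E ^ (M + 1)) *
        (algebraMap K N (μ / algebraMap F K fπ ^ M) - algebraMap K N ζ ^ (0 * m) * b0 ^ m)
      rw [← hnem, ← map_pow (algebraMap K N) ζ, hζ.pow_eq_one, map_one, zero_mul, pow_zero]
    rw [this]
  obtain ⟨c, hc⟩ := hcyc.fix (∏ i ∈ Finset.range e, (s ^ i) hh) (by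
    rw [map_prod]
    have h1 : ∀ i, s ((s ^ i) hh) = (s ^ (i + 1)) hh := by
      intro i; rw [pow_succ', AlgEquiv.mul_apply]
    simp only [h1]
    have h2 := Finset.prod_range_succ' (fun i => (s ^ i) hh) e
    rw [Finset.prod_range_succ, hhe] at h2
    have hh0 : hh ≠ 0 := by
      intro h0
      have := hvhh 0
      have h3 : hhN = 0 := congrArg Subtype.val h0
      rw [h3, map_zero, map_zero, map_zero] at this
      exact lexv_ne_zero _ _ this.symm
    rw [pow_zero, AlgEquiv.one_apply] at h2
    exact (mul_right_cancel₀ hh0 h2).symm)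
  let jL : L →+* Ω := j.comp (algebraMap L N)
  have hjL : ∀ x : L, jL x = j (x : N) := fun x => rfl
  have hjc : jL (algebraMap F L c) = ∏ i ∈ Finset.range e, j ((σ ^ i) hhN) := by
    rw [hc, map_prod]
    refine Finset.prod_congr rfl fun i _ => ?_
    rw [hjL, hsi]
  have hvc : v (jL (algebraMap F L c)) = lexv e 0 := by
    rw [hjc, map_prod, Finset.prod_congr rfl (fun i _ => hvhh i), Finset.prod_const,
      Finset.card_range, lexv_pow]
    simp
  have hνc : ν (jL (algebraMap F L c)) = lexv e 1 := by
    rw [hjc, map_prod]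
    obtain ⟨e', rfl⟩ : ∃ e', e = e' + 1 := ⟨e - 1, by omega⟩
    rw [Finset.prod_range_succ', hνhh 0 he0, if_pos rfl,
      Finset.prod_congr rfl (fun i hi => by
        rw [hνhh (i + 1) (by have := Finset.mem_range.1 hi; omega), if_neg (by omega)]),
      Finset.prod_const, Finset.card_range, lexv_pow, lexv_mul]
    simp
  refine ⟨L, inferInstance, inferInstance, s, v.comap jL, ν.comap jL, c, hh, hcyc,
    fun x y => H.coarse _ _, ?_, ?_, ?_, ?_, ?_, hhe, hc⟩
  · intro x
    rw [Valuation.comap_apply, Valuation.comap_apply, hjL, hs, hjσ, H.vσ]; rfl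
  · intro x
    rw [Valuation.comap_apply, Valuation.comap_apply, hjL, hsi, hjσi, H.νσ]; rfl
  · rintro rfl
    rw [map_zero, map_zero, map_zero] at hvc
    exact lexv_ne_zero _ _ hvc.symm
  · intro g i hgi
    rw [Valuation.comap_apply, Valuation.comap_apply, map_pow, map_pow, map_pow, map_pow, hvc] at hgi
    by_cases hg : jL g = 0
    · rw [hg, map_zero, zero_pow hn.ne'] at hgi
      exact absurd hgi.symm (pow_ne_zero _ (lexv_ne_zero _ _))
    · obtain ⟨k, hk⟩ := H.vex _ hg
      rw [hk, lexv_pow, lexv_pow, lexv_inj] at hgi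
      have h1 : (e : ℤ) * ((m : ℤ) * k) = e * i := by
        have := hgi.1
        rw [hnem] at this
        push_cast at this
        linarith
      have h2 := mul_left_cancel₀ (by exact_mod_cast he0.ne') h1
      exact Int.natCast_dvd_natCast.1 ⟨k, h2.symm⟩
  · intro g i hgi
    rw [Valuation.comap_apply, Valuation.comap_apply, map_pow, map_pow, map_pow, map_pow, hνc] at hgi
    by_cases hg : jL g = 0
    · rw [hg, map_zero, zero_pow hn.ne'] at hgi
      exact absurd hgi.symm (pow_ne_zero _ (lexv_ne_zero _ _))
    · obtain ⟨k, k', hk⟩ := lexv_exists (ν (jL g)) ((Valuation.ne_zero_iff ν).2 hg)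
      rw [hk, lexv_pow, lexv_pow, lexv_inj] at hgi
      have h1 := hgi.2
      rw [mul_one] at h1
      exact Int.natCast_dvd_natCast.1 ⟨k', h1.symm⟩

theorem arith_of_iface {F : Type} [Field F] [CharZero F] (l : ℕ) (hl : l.Prime) (a b : ℕ)
    (ha : 1 ≤ a) (hab : a ≤ b) (hb : b ≤ 2 * a - 1) {A κ : Type} [CommRing A] [Field κ] [Finite κ]
    (ϖ : A) (ρ : A →+* Polynomial κ) (ζA : A) (ζk : κ) (xA : A) (c0 M : ℕ) (TA u : A) (fx fπ : F)
    (sF : κ → F) (sA : κ → A)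
    (I : Iface F (l ^ b) ϖ ρ ζA ζk xA c0 M TA u fx fπ sF sA) :
    ∃ D : CentralDivisionAlgebra F,
      BrauerClassHasOrder F D.carrier (l ^ a) ∧
      Module.finrank F D.carrier = l ^ (2 * b) ∧
      IsIndecomposableDivisionAlgebra F D.carrier := by
  classical
  have hn1 : 1 < l ^ b := Nat.one_lt_pow (by omega) hl.one_lt
  have hn : 0 < l ^ b := by omega
  haveI : NeZero (l ^ b) := ⟨hn.ne'⟩
  obtain ⟨χ, α, hχ, hχinj, hχ1, hα1, hα⟩ := gal_chars F (l ^ b) hn1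
  obtain ⟨t, ht, hirr⟩ := ff_kummer κ l b hl (by omega) ζk I.prim
  obtain ⟨n, hndef⟩ : ∃ n, n = l ^ b := ⟨_, rfl⟩
  obtain ⟨m, hmdef⟩ : ∃ m, m = l ^ a := ⟨_, rfl⟩
  obtain ⟨e, hedef⟩ : ∃ e, e = l ^ (b - a) := ⟨_, rfl⟩
  have hnem : n = e * m := by rw [hndef, hmdef, hedef, ← pow_add]; congr 1; omega
  have he0 : 0 < e := by rw [hedef]; exact pow_pos hl.pos _
  have hm0 : 0 < m := by rw [hmdef]; exact pow_pos hl.pos _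
  have hfin : FiniteDimensional F (CyclotomicField (l ^ b) F) :=
    IsCyclotomicExtension.finiteDimensional {l ^ b} F _
  have hgal : IsGalois F (CyclotomicField (l ^ b) F) := IsCyclotomicExtension.isGalois {l ^ b} F _
  set K := CyclotomicField (l ^ b) F with hK
  -- A-side
  let s : κ := (t - 1) / EA χ ζk ζk 1
  have hη : EA χ ζk ζk 1 ≠ 0 := EA_ne χ (l ^ b) hn hχinj ζk I.prim
  let E' : (K ≃ₐ[F] K) → A := fun g => EA χ xA ζA g
  have hρE : ∀ g, ρ (E' g) = Polynomial.C (EA χ ζk ζk g) := by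
    intro g
    show ρ (EA χ xA ζA g) = _
    rw [EA_map, EA_map, I.ρx, I.ρζ]
  have hρE1 : ∀ g, g ≠ 1 → ρ (E' g) = 0 := by
    intro g hg; rw [hρE, EA_zero χ hχ1 _ _ hg, map_zero]
  let t' : (K ≃ₐ[F] K) → A := fun g => 1 + E' g * sA s
  have ht1 : ρ (t' 1) = Polynomial.C t := by
    show ρ (1 + E' 1 * sA s) = _
    rw [map_add, map_mul, map_one, hρE, I.ρs, ← Polynomial.C_mul, ← Polynomial.C_1,
      ← Polynomial.C_add]
    congr 1
    show 1 + _ * ((t - 1) / _) = t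
    field_simp
    ring
  have ht2 : ∀ g, g ≠ 1 → ρ (t' g) = 1 := by
    intro g hg
    show ρ (1 + E' g * sA s) = _
    rw [map_add, map_mul, map_one, hρE1 g hg, zero_mul, add_zero]
  have hρt : ∀ g, ρ (t' g) ≠ 0 := by
    intro g
    by_cases hg : g = 1
    · rw [hg, ht1]; exact Polynomial.C_ne_zero.2 ht
    · rw [ht2 g hg]; exact one_ne_zero
  let zA : A := ∏ g, t' g ^ α g
  have hρz : ρ zA = Polynomial.C t := by
    show ρ (∏ g, t' g ^ α g) = _
    rw [map_prod, Finset.prod_eq_single (1 : K ≃ₐ[F] K)]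
    · rw [map_pow, hα1, pow_one, ht1]
    · intro g _ hg; rw [map_pow, ht2 g hg, one_pow]
    · intro h; exact absurd (Finset.mem_univ _) h
  obtain ⟨Ω, _, ψ, β, σΩ, v, ν, H⟩ := exists_lay2 I.red I.surj n m e (by rw [hndef]; exact hn) hnem zA ζA t ζk
    hρz I.ρζ (by rw [hndef]; exact I.ζn) (by rw [hndef]; exact I.prim) ht (by rw [hndef]; exact hirr)
  have hvπlt : lexv 1 0 < (1 : LexZ) := by rw [← lexv_zero, lexv_lt]; left; norm_num
  have hψϖ : ψ ϖ ≠ 0 := by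
    intro h0
    have := H.vϖ
    rw [h0, map_zero] at this
    exact lexv_ne_zero _ _ this.symm
  obtain ⟨φ, hφx, hφπ, hφs, hφσ⟩ := I.emb Ω ψ hψϖ H.ker
  have hφσ' := hφσ σΩ H.σψ
  have hωprim : IsPrimitiveRoot (ψ ζA) (l ^ b) := by
    refine ⟨by rw [← map_pow, I.ζn, map_one], ?_⟩
    intro k hk
    apply I.prim.dvd_of_pow_eq_one
    have h1 := H.ker (ζA ^ k - 1) (by rw [map_sub, map_pow, hk, map_one, sub_self])
    rw [map_sub, map_pow, I.ρζ, map_one, ← Polynomial.C_pow, sub_eq_zero, ← Polynomial.C_1] at h1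
    exact Polynomial.C_injective h1
  obtain ⟨f0, ζ, hζ, hf0ζ, hf0φ⟩ := embedK (l ^ b) φ (ψ ζA) hωprim
  -- K-side
  let E : K := ∏ h ∈ Finset.univ.erase (1 : K ≃ₐ[F] K), (algebraMap F K fx - h ζ)
  have hfE : ∀ g : K ≃ₐ[F] K, f0 (g E) = ψ (E' g) := by
    intro g
    show f0 (g (∏ h ∈ Finset.univ.erase (1 : K ≃ₐ[F] K), (algebraMap F K fx - h ζ)))
      = ψ (∏ h ∈ Finset.univ.erase 1, (xA - ζA ^ χ (g * h)))
    rw [map_prod, map_prod, map_prod]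
    refine Finset.prod_congr rfl fun h _ => ?_
    rw [map_sub, map_sub, map_sub, AlgEquiv.commutes, hf0φ, hφx, ← AlgEquiv.mul_apply, hχ ζ hζ,
      map_pow, map_pow, hf0ζ]
  let tK : K := 1 + E * algebraMap F K (sF s)
  have hft : ∀ g : K ≃ₐ[F] K, f0 (g tK) = ψ (t' g) := by
    intro g
    show f0 (g (1 + E * algebraMap F K (sF s))) = ψ (1 + E' g * sA s)
    rw [map_add, map_mul, map_one, map_add, map_mul, map_one, AlgEquiv.commutes, hf0φ, hφs, hfE,
      map_add, map_mul, map_one]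
  have hvt : ∀ g : K ≃ₐ[F] K, v (f0 (g tK)) = 1 := fun g => by rw [hft]; exact H.vψ _ (hρt g)
  have htK : tK ≠ 0 := by
    intro h0
    have := hvt 1
    rw [h0, map_zero, map_zero, map_zero] at this
    exact zero_ne_one this
  have hvP : ∀ w : (K ≃ₐ[F] K) → ℤ, v (f0 (Pz tK w)) = 1 := by
    intro w
    unfold Pz
    rw [map_prod, map_prod]
    refine Finset.prod_eq_one fun g _ => ?_
    rw [map_zpow₀, map_zpow₀, hvt, one_zpow]
  let zK : K := Pz tK (fun g => (α g : ℤ))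
  have hfz : f0 zK = ψ zA := by
    show f0 (∏ g : K ≃ₐ[F] K, (g tK) ^ ((α g : ℤ))) = ψ (∏ g, t' g ^ α g)
    rw [map_prod, map_prod]
    refine Finset.prod_congr rfl fun g _ => ?_
    rw [zpow_natCast, map_pow, hft, map_pow]
  have hβv : v β = 1 := by
    have h1 : v β ^ n = 1 := by rw [← map_pow, H.βn, H.vψ _ (by rw [hρz]; exact Polynomial.C_ne_zero.2 ht)]
    exact lexz_pow_one _ n (by rw [hndef]; exact hn.ne') h1
  have hβ0 : β ≠ 0 := by rintro rfl; rw [map_zero] at hβv; exact zero_ne_one hβv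
  have hβn : β ^ (l ^ b) = f0 zK := by rw [hfz, ← H.βn, hndef]
  have hσf0 : ∀ c, σΩ (f0 c) = f0 c := by
    letI := φ.toAlgebra
    have hfc : ∀ c : F, f0 (algebraMap F K c) = algebraMap F Ω c := hf0φ
    let g1 : K →ₐ[F] Ω := { f0 with commutes' := hf0φ }
    let g2 : K →ₐ[F] Ω := { σΩ.comp f0 with
      commutes' := fun c => by
        show σΩ (f0 (algebraMap F K c)) = _
        rw [hfc]; exact hφσ' c }
    have htop : Algebra.adjoin F {ζ} = (⊤ : Subalgebra F K) :=
      IsCyclotomicExtension.adjoin_primitive_root_eq_top hζ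
    have h12 : g2 = g1 := by
      refine AlgHom.ext_of_adjoin_eq_top htop ?_
      intro y hy
      rw [Set.mem_singleton_iff.1 hy]
      show σΩ (f0 ζ) = f0 ζ
      rw [hf0ζ, H.σψ]
    exact fun c => DFunLike.congr_fun h12 c
  have hKirr : Irreducible (Polynomial.X ^ (l ^ b) - Polynomial.C zK) :=
    kummer_irr f0 (l ^ b) hn ζ hζ zK β hβ0 hβn σΩ hσf0 (by rw [H.σβ, hf0ζ])
  rw [hndef, hmdef, hedef] at H
  obtain ⟨L, _, _, σ, v', ν', c, hh, h1, h2, h3, h4, h5, h6, h7, h8, h9⟩ :=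
    second_half (F := F) (K := K) (l ^ b) (l ^ a) (l ^ (b - a)) hn (by rw [← hndef, ← hmdef, ← hedef, hnem])
      ζ hζ χ (hχ ζ hζ) (fun g => (α g : ℤ)) hα I.red H f0 hf0ζ hσf0 tK htK hvP hβv hβn hKirr
      E E' hfE hρE1 _ hη (hρE 1) ζk I.ρζ I.prim xA c0 M TA u fx fπ (by rw [hf0φ, hφx])
      (by rw [hf0φ, hφπ]) I.xeq I.ρT I.ρu
  exact final_of_arith l hl a b ha hab hb σ h1 v' ν' h2 h3 h4 c h5 h6 h7 hh h8 h9


theorem exists_dvr (p : ℕ) [Fact p.Prime] (k : Type) [Field k] [Algebra ℚ_[p] k]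
    [FiniteDimensional ℚ_[p] k] :
    ∃ (O κ : Type) (_ : CommRing O) (_ : IsDomain O) (_ : Field κ) (_ : Finite κ) (ϖ : O)
      (res : O →+* κ) (ι : ℤ_[p] →+* O) (j : O →+* k),
      RedData ϖ res ∧ Function.Surjective res ∧ Function.Injective j ∧
      (∀ w : ℤ_[p], j (ι w) = algebraMap ℚ_[p] k (w : ℚ_[p])) ∧
      (∀ a : O, a ≠ 0 → ∃ (D : ℕ) (w : O), IsUnit w ∧ a = ϖ ^ D * w) ∧ res (p : O) = 0 ∧
      (∀ z : k, ((algebraMap ℚ_[p] k).comp (algebraMap ℤ_[p] ℚ_[p])).IsIntegralElem z →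
        ∃ o, j o = z) := by
  letI : Algebra ℤ_[p] k := ((algebraMap ℚ_[p] k).comp (algebraMap ℤ_[p] ℚ_[p])).toAlgebra
  haveI : IsScalarTower ℤ_[p] ℚ_[p] k := IsScalarTower.of_algebraMap_eq fun x => rfl
  haveI : CharZero k := charZero_of_injective_algebraMap (algebraMap ℚ_[p] k).injective
  let B := integralClosure ℤ_[p] k
  haveI : IsDedekindDomain B := integralClosure.isDedekindDomain ℤ_[p] ℚ_[p] k
  haveI : Module.Finite ℤ_[p] B := IsIntegralClosure.finite ℤ_[p] ℚ_[p] k B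
  haveI : IsFractionRing B k := integralClosure.isFractionRing_of_finite_extension ℚ_[p] k
  have hinjWB : Function.Injective (algebraMap ℤ_[p] B) := by
    intro a b hab
    have h1 : algebraMap B k (algebraMap ℤ_[p] B a) = algebraMap B k (algebraMap ℤ_[p] B b) := by rw [hab]
    have h2 : algebraMap ℚ_[p] k (algebraMap ℤ_[p] ℚ_[p] a) = algebraMap ℚ_[p] k (algebraMap ℤ_[p] ℚ_[p] b) := h1
    exact IsFractionRing.injective ℤ_[p] ℚ_[p] ((algebraMap ℚ_[p] k).injective h2)
  haveI : FaithfulSMul ℤ_[p] B := (faithfulSMul_iff_algebraMap_injective _ _).2 hinjWB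
  obtain ⟨P, hP, hPc⟩ := Ideal.exists_maximal_ideal_liesOver_of_isIntegral (S := B)
    (IsLocalRing.maximalIdeal ℤ_[p])
  haveI := hP
  haveI := hPc
  have hp0 : IsLocalRing.maximalIdeal ℤ_[p] ≠ ⊥ := IsDiscreteValuationRing.not_a_field _
  have hP0 : P ≠ ⊥ := Ideal.ne_bot_of_liesOver_of_ne_bot hp0 P
  haveI hdvr : IsDiscreteValuationRing (Localization.AtPrime P) :=
    IsLocalization.AtPrime.isDiscreteValuationRing_of_dedekind_domain B hP0 _
  haveI : Finite (ℤ_[p] ⧸ IsLocalRing.maximalIdeal ℤ_[p]) :=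
    Finite.of_equiv (ZMod p) (PadicInt.residueField (p := p)).symm.toEquiv
  haveI : Finite (B ⧸ P) := Module.finite_of_finite (ℤ_[p] ⧸ IsLocalRing.maximalIdeal ℤ_[p])
  haveI : Finite (IsLocalRing.ResidueField (Localization.AtPrime P)) :=
    Finite.of_equiv (B ⧸ P)
      (IsLocalization.AtPrime.equivQuotMaximalIdeal P (Localization.AtPrime P)).toEquiv
  obtain ⟨ϖ, hϖ⟩ := IsDiscreteValuationRing.exists_irreducible (Localization.AtPrime P)
  have hunit : ∀ y : P.primeCompl, IsUnit (algebraMap B k y) := by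
    intro y
    refine IsUnit.mk0 _ ?_
    intro h0
    have : (y : B) = 0 := IsFractionRing.injective B k (by rw [h0, map_zero])
    exact y.2 (by rw [this]; exact P.zero_mem)
  have hjinj : Function.Injective
      (IsLocalization.lift (S := Localization.AtPrime P) (M := P.primeCompl) hunit) := by
    rw [IsLocalization.lift_injective_iff]
    intro x y
    rw [(IsLocalization.injective (Localization.AtPrime P)
      P.primeCompl_le_nonZeroDivisors).eq_iff, (IsFractionRing.injective B k).eq_iff]
  refine ⟨Localization.AtPrime P, IsLocalRing.ResidueField (Localization.AtPrime P), inferInstance,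
    inferInstance, inferInstance, inferInstance, ϖ, IsLocalRing.residue _,
    (algebraMap B (Localization.AtPrime P)).comp (algebraMap ℤ_[p] B),
    IsLocalization.lift (M := P.primeCompl) hunit, ⟨?_, ?_, ?_⟩, IsLocalRing.residue_surjective,
    hjinj, ?_, ?_, ?_, ?_⟩
  · intro a ha
    exact (mul_eq_zero.1 ha).resolve_left hϖ.ne_zero
  · intro a ha
    rw [IsLocalRing.residue_eq_zero_iff, hϖ.maximalIdeal_eq, Ideal.mem_span_singleton] at ha
    exact ha
  · rw [IsLocalRing.residue_eq_zero_iff, hϖ.maximalIdeal_eq]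
    exact Ideal.mem_span_singleton_self _
  · intro w
    rw [RingHom.comp_apply, IsLocalization.lift_eq]
    rfl
  · intro a ha
    obtain ⟨n, u, rfl⟩ := IsDiscreteValuationRing.eq_unit_mul_pow_irreducible ha hϖ
    exact ⟨n, u, u.isUnit, mul_comm _ _⟩
  · rw [IsLocalRing.residue_eq_zero_iff]
    have h1 : (p : ℤ_[p]) ∈ IsLocalRing.maximalIdeal ℤ_[p] := by
      rw [PadicInt.maximalIdeal_eq_span_p]; exact Ideal.mem_span_singleton_self _
    have h2 : algebraMap ℤ_[p] B p ∈ P := by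
      have := hPc.over
      rw [this] at h1
      exact h1
    have h3 := (IsLocalization.AtPrime.to_map_mem_maximal_iff (Localization.AtPrime P) P
      (algebraMap ℤ_[p] B p)).2 h2
    simpa using h3
  · intro z hz
    refine ⟨algebraMap B _ ⟨z, hz⟩, ?_⟩
    rw [IsLocalization.lift_eq]
    rfl


/-- Evaluation `ℤ_p[X] → F` at `x`. -/
noncomputable def evx (p : ℕ) [Fact p.Prime] (F : Type) [Field F] [Algebra ℚ_[p] F] (x : F) :
    Polynomial ℤ_[p] →+* F :=
  Polynomial.eval₂RingHom ((algebraMap ℚ_[p] F).comp (algebraMap ℤ_[p] ℚ_[p])) x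

theorem evx_injective (p : ℕ) [Fact p.Prime] (F : Type) [Field F] [Algebra ℚ_[p] F] (x : F)
    (hx : Transcendental ℚ_[p] x) : Function.Injective (evx p F x) := by
  rw [transcendental_iff_injective] at hx
  intro a b hab
  have h : ∀ c : Polynomial ℤ_[p], evx p F x c = Polynomial.aeval x
      (c.map (algebraMap ℤ_[p] ℚ_[p])) := by
    intro c
    rw [Polynomial.aeval_def, Polynomial.eval₂_map]; rfl
  rw [h, h] at hab
  exact Polynomial.map_injective _ (IsFractionRing.injective ℤ_[p] ℚ_[p]) (hx hab)

theorem exists_alg_setup (p : ℕ) [Fact p.Prime] (F K : Type) [Field F] [Algebra ℚ_[p] F]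
    (hfg : ∃ s : Finset F, IntermediateField.adjoin ℚ_[p] (s : Set F) = ⊤)
    (x : F) (hx : IsTranscendenceBasis ℚ_[p] (fun _ : Fin 1 => x)) [Field K] [Algebra K F]
    (hK : ∀ w : ℤ_[p], ∃ c : K, algebraMap K F c = algebraMap ℚ_[p] F (w : ℚ_[p]))
    (hKx : ∃ c : K, algebraMap K F c = x) : FiniteDimensional K F := by
  have hQ : ∀ w : ℚ_[p], algebraMap ℚ_[p] F w ∈ (algebraMap K F).fieldRange := by
    intro w
    obtain ⟨a, b, hb, rfl⟩ := IsFractionRing.div_surjective (A := ℤ_[p]) w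
    rw [map_div₀]
    refine div_mem ?_ ?_
    · obtain ⟨c, hc⟩ := hK a; exact ⟨c, hc⟩
    · obtain ⟨c, hc⟩ := hK b; exact ⟨c, hc⟩
  have halg : Algebra.IsAlgebraic K F := by
    have h1 := hx.isAlgebraic
    constructor
    intro z
    obtain ⟨q, hq0, hq⟩ := h1.1 z
    have hS : ∀ t : Algebra.adjoin ℚ_[p] (Set.range (fun _ : Fin 1 => x)),
        (t : F) ∈ (algebraMap K F).range := by
      intro t
      refine Algebra.adjoin_induction (p := fun u _ => u ∈ (algebraMap K F).range) ?_ ?_ ?_ ?_ t.2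
      · rintro _ ⟨_, rfl⟩; exact hKx
      · intro r; exact hQ r
      · intro a b _ _ ha hb; exact add_mem ha hb
      · intro a b _ _ ha hb; exact mul_mem ha hb
    let e : K ≃+* (algebraMap K F).range := RingEquiv.ofBijective (algebraMap K F).rangeRestrict
      ⟨fun a b hab => (algebraMap K F).injective (congrArg Subtype.val hab),
        (algebraMap K F).rangeRestrict_surjective⟩
    let τ : Algebra.adjoin ℚ_[p] (Set.range (fun _ : Fin 1 => x)) →+* K :=
      e.symm.toRingHom.comp (RingHom.codRestrict
        (Algebra.adjoin ℚ_[p] (Set.range (fun _ : Fin 1 => x))).val.toRingHom _ hS)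
    have hτ : ∀ t, algebraMap K F (τ t) = (t : F) := by
      intro t
      have : e (τ t) = ⟨(t : F), hS t⟩ := e.apply_symm_apply _
      exact congrArg Subtype.val this
    have hτi : Function.Injective τ := by
      intro a b hab
      apply Subtype.ext
      rw [← hτ a, ← hτ b, hab]
    refine ⟨q.map τ, (Polynomial.map_ne_zero_iff hτi).2 hq0, ?_⟩
    rw [Polynomial.aeval_def, Polynomial.eval₂_map]
    rw [Polynomial.aeval_def] at hq
    have e1 : (algebraMap K F).comp τ = algebraMap
        (Algebra.adjoin ℚ_[p] (Set.range (fun _ : Fin 1 => x))) F := RingHom.ext hτ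
    rw [e1]
    exact hq
  obtain ⟨s, hs⟩ := hfg
  have htop : IntermediateField.adjoin K (s : Set F) = ⊤ := by
    rw [eq_top_iff]
    intro z _
    have hz : z ∈ IntermediateField.adjoin ℚ_[p] (s : Set F) := by rw [hs]; trivial
    refine IntermediateField.adjoin_induction ℚ_[p]
      (p := fun u _ => u ∈ IntermediateField.adjoin K (s : Set F)) ?_ ?_ ?_ ?_ ?_ hz
    · intro u hu; exact IntermediateField.subset_adjoin _ _ hu
    · intro w
      obtain ⟨c, hc⟩ := hQ w
      rw [← hc]; exact IntermediateField.algebraMap_mem _ _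
    · intro a b _ _ ha hb; exact add_mem ha hb
    · intro a _ ha; exact inv_mem ha
    · intro a b _ _ ha hb; exact mul_mem ha hb
  have hfd : FiniteDimensional K (IntermediateField.adjoin K (s : Set F)) :=
    IntermediateField.finiteDimensional_adjoin fun z _ => (halg.1 z).isIntegral
  rw [htop] at hfd
  exact Module.Finite.equiv (IntermediateField.topEquiv (F := K) (E := F)).toLinearEquiv

open Polynomial in
theorem exists_plane_model (p : ℕ) [Fact p.Prime] (F : Type) [Field F] [Algebra ℚ_[p] F]
    (hfg : ∃ s : Finset F, IntermediateField.adjoin ℚ_[p] (s : Set F) = ⊤)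
    (htd : ∃ x : F, IsTranscendenceBasis ℚ_[p] (fun _ : Fin 1 => x)) :
    ∃ (x y : F) (h U V : Polynomial (Polynomial ℤ_[p])) (d : Polynomial ℤ_[p]),
      h.Monic ∧ h.natDegree ≠ 0 ∧ h.eval₂ (evx p F x) y = 0 ∧
      U * h + V * derivative h = C d ∧ d ≠ 0 ∧
      (∀ (Ω : Type) [Field Ω] (g : Polynomial ℤ_[p] →+* Ω), Function.Injective g →
        ∀ yΩ : Ω, h.eval₂ g yΩ = 0 → ∃ φ : F →+* Ω, (∀ r, φ (evx p F x r) = g r) ∧ φ y = yΩ ∧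
          ∀ σ : Ω →+* Ω, (∀ r, σ (g r) = g r) → σ yΩ = yΩ → ∀ f, σ (φ f) = φ f) := by
  obtain ⟨x, hx⟩ := htd
  have hxt : Transcendental ℚ_[p] x := by
    have := hx.1
    rwa [algebraicIndependent_unique_type_iff] at this
  have hinj := evx_injective p F x hxt
  letI : Algebra (Polynomial ℤ_[p]) F := (evx p F x).toAlgebra
  let K := FractionRing (Polynomial ℤ_[p])
  letI : Algebra K F := (IsFractionRing.lift hinj : K →+* F).toAlgebra
  haveI : IsScalarTower (Polynomial ℤ_[p]) K F := IsScalarTower.of_algebraMap_eq fun r =>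
    (IsFractionRing.lift_algebraMap hinj r).symm
  haveI : FiniteDimensional K F := by
    refine exists_alg_setup p F K hfg x hx ?_ ?_
    · intro w
      refine ⟨algebraMap (Polynomial ℤ_[p]) K (C w), ?_⟩
      rw [← IsScalarTower.algebraMap_apply]
      show evx p F x (C w) = _
      simp [evx]
    · refine ⟨algebraMap (Polynomial ℤ_[p]) K X, ?_⟩
      rw [← IsScalarTower.algebraMap_apply]
      show evx p F x X = _
      simp [evx]
  haveI : CharZero K := inferInstance
  obtain ⟨y0, hy0⟩ := Field.exists_primitive_element K F
  have hy0a : IsAlgebraic (Polynomial ℤ_[p]) y0 :=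
    (IsFractionRing.isAlgebraic_iff (Polynomial ℤ_[p]) K F).2 (Algebra.IsAlgebraic.isAlgebraic y0)
  obtain ⟨c, hc0, hyint⟩ := hy0a.exists_integral_multiple
  let y : F := c • y0
  have hyint : IsIntegral (Polynomial ℤ_[p]) y := hyint
  have hgen : Algebra.adjoin K {y} = ⊤ := by
    rw [← IntermediateField.adjoin_simple_toSubalgebra_of_isAlgebraic
      (Algebra.IsAlgebraic.isAlgebraic y)]
    have : IntermediateField.adjoin K {y} = ⊤ := by
      rw [eq_top_iff, ← hy0, IntermediateField.adjoin_simple_le_iff]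
      have h1 : y0 = (algebraMap K F (algebraMap _ K c))⁻¹ * y := by
        rw [← IsScalarTower.algebraMap_apply]
        have h2 : y = algebraMap _ F c * y0 := Algebra.smul_def _ _
        have h3 : algebraMap (Polynomial ℤ_[p]) F c ≠ 0 := by
          intro h0; exact hc0 (hinj (by rw [map_zero]; exact h0))
        rw [h2, inv_mul_cancel_left₀ h3]
      rw [h1]
      exact mul_mem (inv_mem (IntermediateField.algebraMap_mem _ _))
        (IntermediateField.mem_adjoin_simple_self K y)
    rw [this]; rfl
  have hyK : IsIntegral K y := Algebra.IsIntegral.isIntegral y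
  have hmp : minpoly K y = (minpoly (Polynomial ℤ_[p]) y).map (algebraMap _ K) :=
    minpoly.isIntegrallyClosed_eq_field_fractions' K hyint
  have hKi : Function.Injective (algebraMap (Polynomial ℤ_[p]) K) := IsFractionRing.injective _ _
  have hsep : (minpoly K y).Separable := Algebra.IsSeparable.isSeparable K y
  obtain ⟨A, B, hAB⟩ := hsep
  obtain ⟨dA, hdA⟩ := IsLocalization.integerNormalization_map_to_map
    (nonZeroDivisors (Polynomial ℤ_[p])) A
  obtain ⟨dB, hdB⟩ := IsLocalization.integerNormalization_map_to_map
    (nonZeroDivisors (Polynomial ℤ_[p])) B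
  set U := IsLocalization.integerNormalization (nonZeroDivisors (Polynomial ℤ_[p])) A
  set V := IsLocalization.integerNormalization (nonZeroDivisors (Polynomial ℤ_[p])) B
  refine ⟨x, y, minpoly _ y, C (dB : Polynomial ℤ_[p]) * U, C (dA : Polynomial ℤ_[p]) * V,
    dA * dB, minpoly.monic hyint, (minpoly.natDegree_pos hyint).ne', minpoly.aeval _ y, ?_, ?_, ?_⟩
  · apply Polynomial.map_injective _ hKi
    have e : ∀ (d : Polynomial ℤ_[p]) (G : Polynomial K), d • G = C (algebraMap _ K d) * G := by
      intro d G
      rw [← Polynomial.smul_eq_C_mul, algebraMap_smul]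
    simp only [Polynomial.map_add, Polynomial.map_mul, Polynomial.map_C, ← Polynomial.derivative_map,
      hdA, hdB, ← hmp, map_mul]
    rw [e, e]
    linear_combination (C (algebraMap _ K (dA : Polynomial ℤ_[p])) *
      C (algebraMap _ K (dB : Polynomial ℤ_[p]))) * hAB
  · exact mul_ne_zero (nonZeroDivisors.ne_zero dA.2) (nonZeroDivisors.ne_zero dB.2)
  · intro Ω _ g hg yΩ hy
    letI : Algebra K Ω := (IsFractionRing.lift hg : K →+* Ω).toAlgebra
    have hgK : ∀ r, algebraMap K Ω (algebraMap _ K r) = g r := IsFractionRing.lift_algebraMap hg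
    let pb := PowerBasis.ofAdjoinEqTop hyK hgen
    have hpb : pb.gen = y := rfl
    have hroot : aeval yΩ (minpoly K pb.gen) = 0 := by
      rw [hpb, hmp, Polynomial.aeval_def, Polynomial.eval₂_map]
      have e1 : (algebraMap K Ω).comp (algebraMap _ K) = g := RingHom.ext hgK
      rw [e1]
      exact hy
    let φ := pb.lift yΩ hroot
    have hφy : φ y = yΩ := pb.lift_gen yΩ hroot
    refine ⟨φ.toRingHom, ?_, hφy, ?_⟩
    · intro r
      show φ (algebraMap _ F r) = g r
      rw [IsScalarTower.algebraMap_apply (Polynomial ℤ_[p]) K F, φ.commutes, hgK]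
    · intro σ hσ hσy f
      have hσK : σ.comp (algebraMap K Ω) = algebraMap K Ω := by
        apply IsLocalization.ringHom_ext (nonZeroDivisors (Polynomial ℤ_[p]))
        refine RingHom.ext fun r => ?_
        simp only [RingHom.comp_apply]
        rw [hgK, hσ]
      let σ' : Ω →ₐ[K] Ω := { σ with commutes' := fun k => RingHom.congr_fun hσK k }
      have : σ'.comp φ = φ := by
        apply pb.algHom_ext
        rw [hpb, AlgHom.comp_apply, hφy]
        exact hσy
      exact AlgHom.congr_fun this f


theorem padic_clear (p : ℕ) [Fact p.Prime] (w : ℚ_[p]) :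
    ∃ (r : ℕ) (a : ℤ_[p]), (p : ℚ_[p]) ^ r * w = (a : ℚ_[p]) := by
  obtain ⟨a, b, hb, rfl⟩ := IsFractionRing.div_surjective (A := ℤ_[p]) w
  have hb0 : b ≠ 0 := nonZeroDivisors.ne_zero hb
  have h1 := PadicInt.unitCoeff_spec hb0
  refine ⟨b.valuation, a * ((PadicInt.unitCoeff hb0)⁻¹ : ℤ_[p]ˣ), ?_⟩
  have h2 : (b : ℚ_[p]) = (((PadicInt.unitCoeff hb0 : ℤ_[p]ˣ) : ℤ_[p]) : ℚ_[p]) * (p : ℚ_[p]) ^ b.valuation := by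
    have := congrArg (fun z : ℤ_[p] => (z : ℚ_[p])) h1
    simpa using this
  have h3 : (((PadicInt.unitCoeff hb0 : ℤ_[p]ˣ) : ℤ_[p]) : ℚ_[p]) *
      ((((PadicInt.unitCoeff hb0)⁻¹ : ℤ_[p]ˣ) : ℤ_[p]) : ℚ_[p]) = 1 := by
    rw [← PadicInt.coe_mul, Units.mul_inv, PadicInt.coe_one]
  have hbne : (b : ℚ_[p]) ≠ 0 := by simpa using hb0
  show (p : ℚ_[p]) ^ b.valuation * ((a : ℚ_[p]) / (b : ℚ_[p])) = _
  rw [PadicInt.coe_mul, ← mul_div_assoc, div_eq_iff hbne, h2]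
  linear_combination (-(a : ℚ_[p]) * (p : ℚ_[p]) ^ b.valuation) * h3

open Polynomial in
theorem exists_point (p : ℕ) [Fact p.Prime] (n : ℕ) (hn : 0 < n)
    (h U V : Polynomial (Polynomial ℤ_[p])) (d : Polynomial ℤ_[p]) (hm : h.Monic)
    (hdeg : h.natDegree ≠ 0) (hbez : U * h + V * derivative h = C d) (hd : d ≠ 0) :
    ∃ (k : Type) (_ : Field k) (_ : Algebra ℚ_[p] k) (_ : FiniteDimensional ℚ_[p] k)
      (ζ x0 y0 : k) (a0 : ℕ), IsPrimitiveRoot ζ n ∧ x0 = ζ + ((p * a0 : ℕ) : k) ∧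
      h.eval₂ (evx p k x0) y0 = 0 ∧ (derivative h).eval₂ (evx p k x0) y0 ≠ 0 ∧
      ((algebraMap ℚ_[p] k).comp (algebraMap ℤ_[p] ℚ_[p])).IsIntegralElem ζ ∧
      ((algebraMap ℚ_[p] k).comp (algebraMap ℤ_[p] ℚ_[p])).IsIntegralElem y0 ∧
      ∀ α : k, ∃ (r : ℕ) (P : Polynomial (Polynomial ℤ_[p])),
        (p : k) ^ r * α = P.eval₂ (evx p k x0) y0 := by
  let E := AlgebraicClosure ℚ_[p]
  haveI : CharZero E := charZero_of_injective_algebraMap (algebraMap ℚ_[p] E).injective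
  have hp0 : (p : E) ≠ 0 := by exact_mod_cast (Fact.out : p.Prime).ne_zero
  haveI : NeZero n := ⟨hn.ne'⟩
  haveI : NeZero (n : E) := ⟨by exact_mod_cast hn.ne'⟩
  obtain ⟨ζ, hζ⟩ := HasEnoughRootsOfUnity.exists_primitiveRoot E n
  let f0 : ℤ_[p] →+* E := (algebraMap ℚ_[p] E).comp (algebraMap ℤ_[p] ℚ_[p])
  have hf0 : Function.Injective f0 :=
    (algebraMap ℚ_[p] E).injective.comp (IsFractionRing.injective ℤ_[p] ℚ_[p])
  obtain ⟨a0, ha0⟩ : ∃ a0 : ℕ, d.eval₂ f0 (ζ + ((p * a0 : ℕ) : E)) ≠ 0 := by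
    by_contra hcon
    push Not at hcon
    have hd' : d.map f0 ≠ 0 := (Polynomial.map_ne_zero_iff hf0).2 hd
    apply hd'
    apply Polynomial.eq_zero_of_infinite_isRoot
    refine Set.Infinite.mono (s := Set.range fun a : ℕ => ζ + ((p * a : ℕ) : E)) ?_ ?_
    · rintro _ ⟨a, rfl⟩
      show (d.map f0).eval _ = 0
      rw [Polynomial.eval_map]; exact hcon a
    · apply Set.infinite_range_of_injective
      intro a b hab
      simp only [add_right_inj, Nat.cast_inj] at hab
      exact Nat.eq_of_mul_eq_mul_left (Fact.out : p.Prime).pos hab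
  set x0 : E := ζ + ((p * a0 : ℕ) : E) with hx0
  obtain ⟨y0, hy0⟩ := IsAlgClosed.exists_root (h.map (evx p E x0)) (by
    rw [Polynomial.degree_eq_natDegree (hm.map _).ne_zero, hm.natDegree_map]
    exact_mod_cast hdeg)
  have hy0 : h.eval₂ (evx p E x0) y0 = 0 := by
    rw [← Polynomial.eval_map]; exact hy0
  have hder : (derivative h).eval₂ (evx p E x0) y0 ≠ 0 := by
    intro h0
    apply ha0
    have := congrArg (Polynomial.eval₂ (evx p E x0) y0) hbez
    simp only [Polynomial.eval₂_add, Polynomial.eval₂_mul, hy0, h0, mul_zero, add_zero,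
      Polynomial.eval₂_C] at this
    exact this.symm
  have hζint : f0.IsIntegralElem ζ := by
    refine ⟨X ^ n - C 1, Polynomial.monic_X_pow_sub_C _ hn.ne', ?_⟩
    simp [hζ.pow_eq_one]
  have hyint : f0.IsIntegralElem y0 := by
    letI : Algebra ℤ_[p] E := f0.toAlgebra
    have hx0int : IsIntegral ℤ_[p] x0 := by
      have h1 : IsIntegral ℤ_[p] ζ := hζint
      have h2 : IsIntegral ℤ_[p] (((p * a0 : ℕ) : E)) := isIntegral_natCast _
      exact h1.add h2
    haveI : Algebra.IsIntegral ℤ_[p] (Algebra.adjoin ℤ_[p] {x0}) :=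
      Algebra.IsIntegral.adjoin (by simpa using hx0int)
    have : IsIntegral (Algebra.adjoin ℤ_[p] {x0}) y0 := by
      let g : Polynomial ℤ_[p] →+* Algebra.adjoin ℤ_[p] {x0} :=
        Polynomial.eval₂RingHom (algebraMap _ _) ⟨x0, Algebra.self_mem_adjoin_singleton _ _⟩
      refine ⟨h.map g, hm.map g, ?_⟩
      rw [Polynomial.eval₂_map]
      have e1 : (algebraMap (Algebra.adjoin ℤ_[p] {x0}) E).comp g = evx p E x0 := by
        apply Polynomial.ringHom_ext
        · intro a
          simp [g, evx]
          rfl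
        · simp [g, evx]
      rw [e1]; exact hy0
    exact isIntegral_trans y0 this
  let k := IntermediateField.adjoin ℚ_[p] ({x0, y0} : Set E)
  have hxk : x0 ∈ k := IntermediateField.subset_adjoin _ _ (by simp)
  have hyk : y0 ∈ k := IntermediateField.subset_adjoin _ _ (by simp)
  have hζk : ζ ∈ k := by
    have : ζ = x0 - ((p * a0 : ℕ) : E) := by rw [hx0]; ring
    rw [this]; exact sub_mem hxk (natCast_mem _ _)
  haveI hfd : FiniteDimensional ℚ_[p] k :=
    IntermediateField.finiteDimensional_adjoin fun z _ => Algebra.IsIntegral.isIntegral z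
  have hkE : Function.Injective (algebraMap k E) := (algebraMap k E).injective
  have hev : (algebraMap k E).comp (evx p k ⟨x0, hxk⟩) = evx p E x0 := by
    apply Polynomial.ringHom_ext
    · intro a
      simp [evx]
    · simp [evx]
  have hev2 : ∀ P : Polynomial (Polynomial ℤ_[p]),
      algebraMap k E (P.eval₂ (evx p k ⟨x0, hxk⟩) ⟨y0, hyk⟩) = P.eval₂ (evx p E x0) y0 := by
    intro P
    rw [Polynomial.hom_eval₂, hev]; rfl
  have hIntg : ∀ z : k, f0.IsIntegralElem (z : E) →
      ((algebraMap ℚ_[p] k).comp (algebraMap ℤ_[p] ℚ_[p])).IsIntegralElem z := by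
    rintro z ⟨q, hq, hqz⟩
    refine ⟨q, hq, hkE ?_⟩
    rw [Polynomial.hom_eval₂, map_zero]
    exact hqz
  refine ⟨k, inferInstance, inferInstance, hfd, ⟨ζ, hζk⟩, ⟨x0, hxk⟩, ⟨y0, hyk⟩, a0, ?_, ?_, ?_, ?_,
    hIntg _ hζint, hIntg _ hyint, ?_⟩
  · exact IsPrimitiveRoot.of_map_of_injective (f := algebraMap k E) hζ hkE
  · apply Subtype.ext
    simp [hx0]
  · apply hkE
    rw [hev2, hy0, map_zero]
  · intro h0
    apply hder
    rw [← hev2, h0, map_zero]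
  · rintro ⟨α, hα⟩
    have hα' : α ∈ Algebra.adjoin ℚ_[p] ({x0, y0} : Set E) := by
      rw [← IntermediateField.adjoin_toSubalgebra_of_isAlgebraic
        (fun z _ => Algebra.IsAlgebraic.isAlgebraic z)]
      exact hα
    have key : ∃ (r : ℕ) (P : Polynomial (Polynomial ℤ_[p])),
        (p : E) ^ r * α = P.eval₂ (evx p E x0) y0 := by
      refine Algebra.adjoin_induction (p := fun u _ => ∃ (r : ℕ)
        (P : Polynomial (Polynomial ℤ_[p])), (p : E) ^ r * u = P.eval₂ (evx p E x0) y0)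
        ?_ ?_ ?_ ?_ hα'
      · intro u hu
        rcases hu with rfl | hu
        · exact ⟨0, C X, by simp [evx]⟩
        · rw [Set.mem_singleton_iff] at hu
          subst hu
          exact ⟨0, X, by simp⟩
      · intro w
        obtain ⟨r, a, hra⟩ := padic_clear p w
        refine ⟨r, C (C a), ?_⟩
        have := congrArg (algebraMap ℚ_[p] E) hra
        simp only [map_mul, map_pow, map_natCast] at this
        rw [this]
        simp [evx]
      · rintro u v _ _ ⟨r, P, hP⟩ ⟨s, Q, hQ⟩
        refine ⟨r + s, (p : Polynomial (Polynomial ℤ_[p])) ^ s * P +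
          (p : Polynomial (Polynomial ℤ_[p])) ^ r * Q, ?_⟩
        simp only [Polynomial.eval₂_add, Polynomial.eval₂_mul, Polynomial.eval₂_pow,
          Polynomial.eval₂_natCast, ← hP, ← hQ]
        ring
      · rintro u v _ _ ⟨r, P, hP⟩ ⟨s, Q, hQ⟩
        refine ⟨r + s, P * Q, ?_⟩
        simp only [Polynomial.eval₂_mul, ← hP, ← hQ]
        ring
    obtain ⟨r, P, hP⟩ := key
    refine ⟨r, P, hkE ?_⟩
    rw [hev2, ← hP, map_mul, map_pow, map_natCast]
    rfl


/-- Evaluation of a bivariate polynomial. -/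
noncomputable def biev {W S : Type} [CommRing W] [CommRing S] (ι : W →+* S) (s t : S) :
    Polynomial (Polynomial W) →+* S :=
  Polynomial.eval₂RingHom (Polynomial.eval₂RingHom ι s) t

theorem map_biev {W S S' : Type} [CommRing W] [CommRing S] [CommRing S'] (ι : W →+* S) (s t : S)
    (f : S →+* S') (P : Polynomial (Polynomial W)) :
    f (biev ι s t P) = biev (f.comp ι) (f s) (f t) P := by
  have : f.comp (biev ι s t) = biev (f.comp ι) (f s) (f t) := by
    apply Polynomial.ringHom_ext'
    · apply Polynomial.ringHom_ext'
      · ext a; simp [biev]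
      · simp [biev]
    · simp [biev]
  exact RingHom.congr_fun this P

theorem biev_congr {W S : Type} [CommRing W] [CommRing S] (ι : W →+* S) (s t m a b : S)
    (P : Polynomial (Polynomial W)) :
    ∃ c, biev ι (s + m * a) (t + m * b) P = biev ι s t P + m * c := by
  have h : Ideal.Quotient.mk (Ideal.span {m}) (biev ι (s + m * a) (t + m * b) P) =
      Ideal.Quotient.mk (Ideal.span {m}) (biev ι s t P) := by
    have h0 : Ideal.Quotient.mk (Ideal.span {m}) m = 0 :=
      Ideal.Quotient.eq_zero_iff_mem.2 (Ideal.mem_span_singleton_self m)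
    rw [map_biev, map_biev]
    simp only [map_add, map_mul, h0, zero_mul, add_zero]
  rw [Ideal.Quotient.eq, Ideal.mem_span_singleton] at h
  obtain ⟨c, hc⟩ := h
  exact ⟨c, by rw [← hc]; ring⟩

theorem biev_taylor {W S : Type} [CommRing W] [CommRing S] (ι : W →+* S) (s t m a b : S)
    (P : Polynomial (Polynomial W)) :
    ∃ c, biev ι (s + m ^ 2 * a) (t + m * b) P =
      biev ι s t P + biev ι s t (Polynomial.derivative P) * (m * b) + m ^ 2 * c := by
  obtain ⟨c1, h1⟩ := biev_congr ι s (t + m * b) (m ^ 2) a 0 P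
  obtain ⟨c2, h2⟩ := Polynomial.binomExpansion (P.map (Polynomial.eval₂RingHom ι s)) t (m * b)
  rw [Polynomial.derivative_map] at h2
  have e : ∀ (Q : Polynomial (Polynomial W)) (t : S),
      (Q.map (Polynomial.eval₂RingHom ι s)).eval t = biev ι s t Q := by
    intro Q t; rw [Polynomial.eval_map]; rfl
  rw [e, e, e] at h2
  rw [mul_zero, add_zero] at h1
  refine ⟨c1 + c2 * b ^ 2, ?_⟩
  rw [h1, h2]; ring

open Polynomial in
theorem exists_layer {W O κ : Type} [CommRing W] [CommRing O] [IsDomain O] [Field κ] (ϖ : O)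
    (res : O →+* κ) (hres : RedData ϖ res) (hsurj : Function.Surjective res) (ι : W →+* O)
    (hdvr : ∀ a : O, a ≠ 0 → ∃ (D : ℕ) (w : O), IsUnit w ∧ a = ϖ ^ D * w)
    (x0 y0 : O) (h : Polynomial (Polynomial W)) (hroot : biev ι x0 y0 h = 0) (D : ℕ) (w : O)
    (hw : IsUnit w) (hder : biev ι x0 y0 (derivative h) = ϖ ^ D * w) (N : ℕ) (hN : D + 1 ≤ N) :
    ∃ (A : Type) (_ : CommRing A) (i : O →+* A) (ρ : A →+* Polynomial κ) (TA ZA : A),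
      RedData (i ϖ) ρ ∧ Function.Surjective ρ ∧ (∀ o, ρ (i o) = C (res o)) ∧ ρ TA = X ∧
      biev (i.comp ι) (i x0 + i ϖ ^ (2 * N) * TA) (i y0 + i ϖ ^ N * ZA) h = 0 ∧
      ∀ Q : Polynomial O, Q ≠ 0 → ∃ (j : ℕ) (u : A), Q.eval₂ i TA = i ϖ ^ j * u ∧ ρ u ≠ 0 := by
  have hpol := hres.polynomial
  have hpsurj : Function.Surjective (Polynomial.mapRingHom res) :=
    Polynomial.map_surjective res hsurj
  let c : O →+* Polynomial (Polynomial O) := (C : Polynomial O →+* _).comp C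
  obtain ⟨g, hg⟩ := biev_taylor (c.comp ι) (c x0) (c y0) (c ϖ ^ N) (C X) X h
  rw [← map_biev, ← map_biev, hroot, hder] at hg
  obtain ⟨w', hw'⟩ := hw.exists_right_inv
  obtain ⟨e, rfl⟩ := Nat.exists_eq_add_of_le hN
  let H : Polynomial (Polynomial O) := X + c (w' * ϖ ^ (e + 1)) * g
  have hH : c (ϖ ^ D * w) * c ϖ ^ (D + 1 + e) * H =
      biev (c.comp ι) (c x0 + (c ϖ ^ (D + 1 + e)) ^ 2 * C X) (c y0 + c ϖ ^ (D + 1 + e) * X) h := by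
    rw [hg]
    have h1 : c w * c w' = 1 := by rw [← map_mul, hw', map_one]
    simp only [H, map_mul, map_pow, map_zero]
    linear_combination (c ϖ ^ D * c ϖ ^ (D + 1 + e) * c ϖ ^ (e + 1) * g) * h1
  have hHmap : H.map (Polynomial.mapRingHom res) = X := by
    simp [H, c, hres.zero]
  obtain ⟨ρ, h1, h2, h3, h4⟩ := hpol.layer1 hpsurj H hHmap
  let i : O →+* AdjoinRoot H := (AdjoinRoot.of H).comp C
  have hmc : (AdjoinRoot.mk H).comp c = i := by
    ext o; simp [c, i]
  have hmc' : ∀ o, AdjoinRoot.mk H (c o) = i o := fun o => RingHom.congr_fun hmc o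
  refine ⟨AdjoinRoot H, inferInstance, i, ρ, AdjoinRoot.of H X, AdjoinRoot.root H, h1, h2, ?_, ?_,
    ?_, ?_⟩
  · intro o; simp [i, h3]
  · simp [h3]
  · have h5 := congrArg (AdjoinRoot.mk H) hH
    rw [map_mul (AdjoinRoot.mk H) _ H, AdjoinRoot.mk_self, mul_zero, map_biev, ← RingHom.comp_assoc,
      hmc] at h5
    simp only [map_add, map_mul, map_pow, hmc', AdjoinRoot.mk_X, AdjoinRoot.mk_C] at h5
    rw [h5, pow_mul']
  · intro Q hQ
    have hfin : Fin' (C ϖ) (Polynomial.mapRingHom res) Q := by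
      by_contra hnf
      obtain ⟨D', w1, hw1, hc⟩ := hdvr Q.leadingCoeff (by simpa using hQ)
      obtain ⟨b, hb, -⟩ := hpol.not_fin hnf (D' + 1)
      have h5 : Q.leadingCoeff = ϖ ^ (D' + 1) * b.coeff Q.natDegree := by
        have h8 := congrArg (fun q => Polynomial.coeff q Q.natDegree) hb
        simp only [← C_pow, Polynomial.coeff_C_mul] at h8
        exact h8
      have h6 := hres.nzd_pow D' (w1 - ϖ * b.coeff Q.natDegree) (by rw [mul_sub, ← hc, h5]; ring)
      have h7 := (hw1.map res).ne_zero
      apply h7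
      rw [sub_eq_zero.1 h6, map_mul, hres.zero, zero_mul]
    obtain ⟨j, u, rfl, hu⟩ := hfin
    refine ⟨j, AdjoinRoot.of H u, ?_, by rw [h3]; exact hu⟩
    have e2 : Polynomial.eval₂RingHom i (AdjoinRoot.of H X) = AdjoinRoot.of H := by
      apply Polynomial.ringHom_ext
      · intro a; simp [i]
      · simp
    have e3 := RingHom.congr_fun e2 (C ϖ ^ j * u)
    rw [Polynomial.coe_eval₂RingHom] at e3
    rw [e3, map_mul, map_pow]
    rfl


theorem final_main
    (p : ℕ) [Fact p.Prime] (F : Type) [Field F] [Algebra ℚ_[p] F]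
    (hfg : ∃ s : Finset F, IntermediateField.adjoin ℚ_[p] (s : Set F) = ⊤)
    (htd : ∃ x : F, IsTranscendenceBasis ℚ_[p] (fun _ : Fin 1 => x))
    (l : ℕ) (hl : l.Prime) (hlp : l ≠ p)
    (a b : ℕ) (ha : 1 ≤ a) (hab : a ≤ b) (hb : b ≤ 2 * a - 1) :
    ∃ D : CentralDivisionAlgebra F,
      BrauerClassHasOrder F D.carrier (l ^ a) ∧
      Module.finrank F D.carrier = l ^ (2 * b) ∧
      IsIndecomposableDivisionAlgebra F D.carrier := by
  haveI : CharZero F := charZero_of_injective_algebraMap (algebraMap ℚ_[p] F).injective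
  have hpp : p.Prime := Fact.out
  have hn : 0 < l ^ b := pow_pos hl.pos b
  obtain ⟨x, y, h, U, V, d, hm, hdeg, hxy, hbez, hd, hemb⟩ := exists_plane_model p F hfg htd
  obtain ⟨k, _, _, _, ζ, x0, y0, a0, hζ, hx0, hr0, hder0, hζi, hyi, happ⟩ :=
    exists_point p (l ^ b) hn h U V d hm hdeg hbez hd
  obtain ⟨O, κ, _, _, _, _, ϖ, res, ι, j, hres, hsurj, hj, hjι, hdvr, hresp, hIntg⟩ :=
    exists_dvr p k
  haveI : CharZero k := charZero_of_injective_algebraMap (algebraMap ℚ_[p] k).injective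
  obtain ⟨ζO, hζO⟩ := hIntg ζ hζi
  obtain ⟨yO, hyO⟩ := hIntg y0 hyi
  let xO : O := ζO + ((p * a0 : ℕ) : O)
  have hxO : j xO = x0 := by rw [hx0, ← hζO]; simp only [xO, map_add, map_natCast]
  have hjι' : j.comp ι = (algebraMap ℚ_[p] k).comp (algebraMap ℤ_[p] ℚ_[p]) := RingHom.ext hjι
  have hjev : ∀ P, j (biev ι xO yO P) = P.eval₂ (evx p k x0) y0 := by
    intro P
    rw [map_biev, hjι', hxO, hyO]; rfl
  have hroot : biev ι xO yO h = 0 := hj (by rw [hjev, hr0, map_zero])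
  have hderO : biev ι xO yO (Polynomial.derivative h) ≠ 0 := by
    intro h0
    apply hder0
    rw [← hjev, h0, map_zero]
  obtain ⟨D, w, hw, hDw⟩ := hdvr _ hderO
  -- the prime `p` in `O`
  have hpO : (p : O) ≠ 0 := by
    intro h0
    have := congrArg j h0
    rw [map_natCast, map_zero] at this
    exact hpp.ne_zero (by exact_mod_cast this)
  obtain ⟨e, wp, hwp, hpe⟩ := hdvr _ hpO
  obtain ⟨wp', hwp'⟩ := hwp.exists_right_inv
  -- approximation of elements of `O`
  have happO : ∀ o : O, ∃ (r : ℕ) (P : Polynomial (Polynomial ℤ_[p])),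
      (p : O) ^ r * o = biev ι xO yO P := by
    intro o
    obtain ⟨r, P, hP⟩ := happ (j o)
    refine ⟨r, P, hj ?_⟩
    rw [hjev, ← hP, map_mul, map_pow, map_natCast]
  choose r P hP using happO
  choose lift hlift using hsurj
  obtain ⟨B, hB⟩ : ∃ B, ∀ s, r (lift s) ≤ B := by
    obtain ⟨B, hB⟩ := (Set.finite_range fun s => r (lift s)).bddAbove
    exact ⟨B, fun s => hB ⟨s, rfl⟩⟩
  let N := D + 1 + e * B + e * r ϖ + 2
  obtain ⟨A, _, i, ρ, TA, ZA, hA, hAs, hρi, hρT, hAroot, hAQ⟩ :=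
    exists_layer ϖ res hres (fun s => ⟨lift s, hlift s⟩) ι hdvr xO yO h hroot D w hw hDw N
      (by simp only [N]; omega)
  let xA : A := i xO + i ϖ ^ (2 * N) * TA
  let yA : A := i yO + i ϖ ^ N * ZA
  -- approximants in `A`
  have hAapp : ∀ o : O, e * r o + 2 ≤ N → ∃ c : A,
      biev (i.comp ι) xA yA (P o) = (p : A) ^ r o * (i o + i ϖ ^ 2 * c) := by
    intro o ho
    obtain ⟨c, hc⟩ := biev_congr (i.comp ι) (i xO) (i yO) (i ϖ ^ N) (i ϖ ^ N * TA) ZA (P o)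
    have e1 : i xO + i ϖ ^ N * (i ϖ ^ N * TA) = xA := by simp only [xA]; ring
    rw [e1, ← map_biev, ← hP o] at hc
    obtain ⟨q, hq⟩ := Nat.exists_eq_add_of_le ho
    refine ⟨i ϖ ^ q * i wp' ^ r o * c, ?_⟩
    have e2 : (p : A) = i ϖ ^ e * i wp := by
      rw [← map_pow, ← map_mul, ← hpe, map_natCast]
    have e3 : i wp ^ r o * i wp' ^ r o = 1 := by
      rw [← mul_pow, ← map_mul, hwp', map_one, one_pow]
    show biev (i.comp ι) xA (i yO + i ϖ ^ N * ZA) (P o) = _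
    rw [hc, map_mul, map_pow, map_natCast, hq, mul_add]
    congr 1
    rw [e2, mul_pow, ← pow_mul, pow_add, pow_add]
    linear_combination (-(i ϖ ^ (e * r o) * i ϖ ^ 2 * i ϖ ^ q * c)) * e3
  obtain ⟨cπ, hcπ⟩ := hAapp ϖ (by simp only [N]; omega)
  have hs : ∀ s, ∃ c : A, biev (i.comp ι) xA yA (P (lift s)) =
      (p : A) ^ r (lift s) * (i (lift s) + i ϖ ^ 2 * c) := by
    intro s
    apply hAapp
    have := Nat.mul_le_mul_left e (hB s)
    simp only [N]; omega
  choose cs hcs using hs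
  let fF : O → F := fun o => (P o).eval₂ (evx p F x) y / (p : F) ^ r o
  have hresn : ((l ^ b : ℕ) : κ) ≠ 0 := by
    intro h0
    have h1 : (p : κ) = 0 := by simpa using hresp
    have h2 : Nat.Coprime p (l ^ b) := Nat.Coprime.pow_right b
      ((Nat.coprime_primes hpp hl).2 (Ne.symm hlp))
    have h3 := Nat.gcd_eq_gcd_ab p (l ^ b)
    rw [Nat.Coprime.gcd_eq_one h2] at h3
    have h4 := congrArg (fun z : ℤ => (z : κ)) h3
    simp only [Int.cast_add, Int.cast_mul, Int.cast_natCast, h0, h1, zero_mul, add_zero] at h4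
    simp at h4
  have hζOp : IsPrimitiveRoot ζO (l ^ b) :=
    IsPrimitiveRoot.of_map_of_injective (f := j) (by rw [hζO]; exact hζ) hj
  have hprim : IsPrimitiveRoot (res ζO) (l ^ b) := by
    haveI : NeZero ((l ^ b : ℕ) : κ) := ⟨hresn⟩
    rw [← Polynomial.isRoot_cyclotomic_iff]
    have h1 : (Polynomial.cyclotomic (l ^ b) O).IsRoot ζO := hζOp.isRoot_cyclotomic hn
    have h2 := h1.map (f := res)
    rwa [Polynomial.map_cyclotomic] at h2
  have I : Iface F (l ^ b) (i ϖ) ρ (i ζO) (res ζO) xA (p * a0) (2 * N) TA (1 + i ϖ * cπ) x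
      (fF ϖ) (fun s => fF (lift s)) (fun s => i (lift s) + i ϖ ^ 2 * cs s) := by
    have hρϖ : ρ (i ϖ) = 0 := hA.zero
    refine ⟨hA, hAs, ?_, hρi _, hprim, ?_, hρT, ?_, ?_, ?_, ?_⟩
    · rw [← map_pow, hζOp.pow_eq_one, map_one]
    · simp only [xA, xO, map_add, map_natCast]
    · have : 2 * N ≠ 0 := by simp only [N]; omega
      simp only [xA, xO, map_add, map_mul, map_pow, hρϖ, hρi, zero_pow this, zero_mul, add_zero,
        map_natCast, Nat.cast_mul]
      have h1 : (p : κ) = 0 := by simpa using hresp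
      have h2 : (p : Polynomial κ) = 0 := by
        rw [← Polynomial.C_eq_natCast, h1, map_zero]
      rw [h2, zero_mul, add_zero]
    · simp [hρϖ]
    · intro s
      simp [hρϖ, hρi, hlift]
    · intro Ω _ ψ hψϖ hψ
      let g : Polynomial ℤ_[p] →+* Ω := ψ.comp (Polynomial.eval₂RingHom (i.comp ι) xA)
      have hιinj : Function.Injective ι := by
        intro u v huv
        have h1 := congrArg j huv
        rw [hjι, hjι] at h1
        exact Subtype.ext ((algebraMap ℚ_[p] k).injective h1)
      have hϖ0 : ϖ ≠ 0 := by
        rintro rfl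
        exact one_ne_zero (hres.nzd 1 (by simp))
      have hg : Function.Injective g := by
        rw [injective_iff_map_eq_zero]
        intro q hq
        by_contra hq0
        let L : Polynomial O := Polynomial.C (ϖ ^ (2 * N)) * Polynomial.X + Polynomial.C xO
        have hL : (q.map ι).comp L ≠ 0 := by
          intro h0
          rw [Polynomial.comp_eq_zero_iff] at h0
          rcases h0 with h0 | ⟨-, h0⟩
          · exact hq0 ((Polynomial.map_eq_zero_iff hιinj).1 h0)
          · have h1 := congrArg (fun t => Polynomial.coeff t 1) h0
            simp [L, hϖ0, Polynomial.coeff_C, -map_pow] at h1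
        obtain ⟨J, u, hJ, hu⟩ := hAQ _ hL
        have h2 : ((q.map ι).comp L).eval₂ i TA = Polynomial.eval₂RingHom (i.comp ι) xA q := by
          rw [Polynomial.eval₂_comp, Polynomial.eval₂_map]
          have : Polynomial.eval₂ i TA L = xA := by
            simp only [L, xA, Polynomial.eval₂_add, Polynomial.eval₂_mul, Polynomial.eval₂_C,
              Polynomial.eval₂_X, map_pow (i), add_comm]
          rw [this]; rfl
        have h3 : g q = ψ (i ϖ) ^ J * ψ u := by
          show ψ _ = _
          rw [← h2, hJ, map_mul, map_pow]
        rw [hq] at h3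
        have h4 := (mul_eq_zero.1 h3.symm).resolve_left (pow_ne_zero _ hψϖ)
        exact hu (hψ u h4)
      have hbi : ∀ Q : Polynomial (Polynomial ℤ_[p]), Q.eval₂ g (ψ yA) =
          ψ (biev (i.comp ι) xA yA Q) := by
        intro Q
        have := Polynomial.hom_eval₂ Q (Polynomial.eval₂RingHom (i.comp ι) xA) ψ yA
        exact this.symm
      obtain ⟨φ, hφ1, hφ2, hφ3⟩ := hemb Ω g hg (ψ yA) (by rw [hbi, hAroot, map_zero])
      have hp0 : (p : Ω) ≠ 0 := by
        have : φ (p : F) ≠ 0 := (map_ne_zero φ).2 (by exact_mod_cast hpp.ne_zero)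
        rwa [map_natCast] at this
      have hφf : ∀ (o : O) (z : A), biev (i.comp ι) xA yA (P o) = (p : A) ^ r o * z →
          φ (fF o) = ψ z := by
        intro o z hz
        have h1 : φ ((P o).eval₂ (evx p F x) y) = (P o).eval₂ g (ψ yA) := by
          rw [Polynomial.hom_eval₂, hφ2]
          congr 1
          exact RingHom.ext hφ1
        simp only [fF]
        rw [map_div₀, h1, hbi, hz, map_pow, map_natCast, map_mul, map_pow, map_natCast,
          mul_div_cancel_left₀ _ (pow_ne_zero _ hp0)]
      refine ⟨φ, ?_, ?_, ?_, ?_⟩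
      · have h1 := hφ1 Polynomial.X
        have h2 : evx p F x Polynomial.X = x := by simp [evx]
        rw [h2] at h1
        rw [h1]
        simp [g]
      · rw [hφf ϖ _ hcπ]
        congr 1; ring
      · intro s
        exact hφf _ _ (hcs s)
      · intro σ hσ f
        exact hφ3 σ (fun q => hσ _) (hσ _) f
  exact arith_of_iface l hl a b ha hab hb _ _ _ _ _ _ _ _ _ _ _ _ _ I

/-- **Existence of indecomposable division algebras of unequal period and index**
(Brussel–Tengan).  Let `F` be a field extension of `ℚ_p`, finitely generated and of
transcendence degree one over `ℚ_p`, and let `ℓ ≠ p` be a prime.  For any naturals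
`1 ≤ a ≤ b ≤ 2a - 1` there is an indecomposable central division algebra over `F`
of period `ℓ^a` and index `ℓ^b` (i.e. of `F`-dimension `ℓ^(2b)`). -/
theorem indecomposable_division_algebras_exist
    (p : ℕ) [Fact p.Prime] (F : Type) [Field F] [Algebra ℚ_[p] F]
    (hfg : ∃ s : Finset F, IntermediateField.adjoin ℚ_[p] (s : Set F) = ⊤)
    (htd : ∃ x : F, IsTranscendenceBasis ℚ_[p] (fun _ : Fin 1 => x))
    (ℓ : ℕ) (hℓ : ℓ.Prime) (hℓp : ℓ ≠ p)
    (a b : ℕ) (ha : 1 ≤ a) (hab : a ≤ b) (hb : b ≤ 2 * a - 1) :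
    ∃ D : CentralDivisionAlgebra F,
      BrauerClassHasOrder F D.carrier (ℓ ^ a) ∧
      Module.finrank F D.carrier = ℓ ^ (2 * b) ∧
      IsIndecomposableDivisionAlgebra F D.carrier := by
  exact final_main p F hfg htd ℓ hℓ hℓp a b ha hab hb
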